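/- arXiv:2406.07452 — 4 statements merged into one kernel-verified Lean document; each statement's English description precedes it below -/
import Mathlib

section
/- Let κ be an infinite cardinal, and let X and Y be κ-compact Tychonoff spaces. If there exists a continuous linear map T : C_p(X) → C_p(Y) whose image is dense in C_p(Y), and X is strongly κ-dimensional, then Y is strongly κ-dimensional as well. -/
universe u

/-- The submodule of `X → ℝ` consisting of continuous functions. With the subspace
topology inherited from the product topology on `X → ℝ`, this is `C_p(X)`,
the space of continuous real functions with the topology of pointwise convergence. -/
def cpSubmodule (X : Type u) [TopologicalSpace X] : Submodule ℝ (X → ℝ) where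
  carrier := {f | Continuous f}
  add_mem' hf hg := hf.add hg
  zero_mem' := continuous_const
  smul_mem' := fun c {_} hf => hf.const_smul c

/-- `C_p(X)`: continuous real-valued functions on `X` with the pointwise convergence
topology (subspace of the product `X → ℝ`), as a topological real vector space. -/
abbrev Cp (X : Type u) [TopologicalSpace X] : Type u := ↥(cpSubmodule X)

/-- `CovDimLE X n` : the covering dimension of `X` is at most `n` (with `n : ℤ`, so
that `n = -1` is allowed): every finite open cover of `X` has a finite open
refinement covering `X` in which every point belongs to at most `n + 1` members. -/
def CovDimLE (X : Type*) [TopologicalSpace X] (n : ℤ) : Prop :=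
  ∀ 𝒰 : Set (Set X), 𝒰.Finite → (∀ u ∈ 𝒰, IsOpen u) → ⋃₀ 𝒰 = Set.univ →
    ∃ 𝒱 : Set (Set X), 𝒱.Finite ∧ (∀ v ∈ 𝒱, IsOpen v) ∧ ⋃₀ 𝒱 = Set.univ ∧
      (∀ v ∈ 𝒱, ∃ u ∈ 𝒰, v ⊆ u) ∧ ∀ x : X, ({v ∈ 𝒱 | x ∈ v}.ncard : ℤ) ≤ n + 1

/-- A space is finite dimensional if its covering dimension is at most `n` for some `n ∈ ℕ`. -/
def FiniteDim (X : Type*) [TopologicalSpace X] : Prop :=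
  ∃ n : ℕ, CovDimLE X n

/-- A space is `κ`-compact if it is a union of at most `κ` many compact subspaces. -/
def IsKappaCompact (κ : Cardinal.{u}) (X : Type u) [TopologicalSpace X] : Prop :=
  ∃ (ι : Type u) (C : ι → Set X), Cardinal.mk ι ≤ κ ∧ (∀ i, IsCompact (C i)) ∧
    ⋃ i, C i = Set.univ

/-- A space is strongly `κ`-dimensional if it is a union of at most `κ` many closed
finite-dimensional subspaces. -/
def StronglyKappaDim (κ : Cardinal.{u}) (X : Type u) [TopologicalSpace X] : Prop :=
  ∃ (ι : Type u) (F : ι → Set X), Cardinal.mk ι ≤ κ ∧ (∀ i, IsClosed (F i)) ∧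
    (∀ i, FiniteDim ↥(F i)) ∧ ⋃ i, F i = Set.univ

open Set Topology Filter Uniformity unitInterval

/-- `CoverOrderLE C N`: every finite family of open sets covering `C` can be shrunk to a family of
open sets which still covers `C` and has order at most `N` on `C`. For `C = univ` this says that
the covering dimension is at most `N - 1`. -/
def CoverOrderLE {X : Type*} [TopologicalSpace X] (C : Set X) (N : ℕ) : Prop :=
  ∀ (k : ℕ) (U : Fin k → Set X), (∀ i, IsOpen (U i)) → C ⊆ ⋃ i, U i →
    ∃ V : Fin k → Set X, (∀ i, IsOpen (V i)) ∧ (∀ i, V i ⊆ U i) ∧ C ⊆ ⋃ i, V i ∧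
      ∀ x ∈ C, {i | x ∈ V i}.ncard ≤ N

namespace CoverOrderLE

variable {X Z : Type*} [TopologicalSpace X] [TopologicalSpace Z] {C D E : Set X} {M N : ℕ}

theorem exists_shrinking (h : CoverOrderLE C N) {ι : Type*} [Finite ι] {U : ι → Set X}
    (hU : ∀ i, IsOpen (U i)) (hC : C ⊆ ⋃ i, U i) :
    ∃ V : ι → Set X, (∀ i, IsOpen (V i)) ∧ (∀ i, V i ⊆ U i) ∧ C ⊆ ⋃ i, V i ∧
      ∀ x ∈ C, {i | x ∈ V i}.ncard ≤ N := by
  obtain ⟨k, ⟨e⟩⟩ := Finite.exists_equiv_fin ι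
  obtain ⟨V, hVo, hVU, hVC, hVN⟩ := h k (fun i => U (e.symm i)) (fun i => hU _)
    (hC.trans_eq (e.symm.iSup_comp (g := U)).symm)
  refine ⟨fun i => V (e i), fun i => hVo _, fun i => by simpa using hVU (e i),
    hVC.trans_eq (e.iSup_comp (g := V)).symm, fun x hx => ?_⟩
  refine le_trans (ncard_le_ncard_of_injOn e (fun i hi => hi) e.injective.injOn (toFinite _))
    (hVN x hx)

theorem of_refinement
    (h : ∀ (k : ℕ) (U : Fin k → Set X), (∀ i, IsOpen (U i)) → C ⊆ ⋃ i, U i →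
      ∃ (ι : Type) (_ : Finite ι) (V : ι → Set X), (∀ j, IsOpen (V j)) ∧
        (∀ j, ∃ i, V j ⊆ U i) ∧ C ⊆ ⋃ j, V j ∧ ∀ x ∈ C, {j | x ∈ V j}.ncard ≤ N) :
    CoverOrderLE C N := by
  intro k U hU hC
  obtain ⟨ι, _, V, hVo, hVU, hVC, hVN⟩ := h k U hU hC
  choose g hg using hVU
  refine ⟨fun i => ⋃ j, ⋃ _ : g j = i, V j, fun i => isOpen_iUnion fun j =>
    isOpen_iUnion fun _ => hVo j, fun i => ?_, fun x hx => ?_, fun x hx => ?_⟩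
  · simp only [iUnion_subset_iff]
    rintro j rfl
    exact hg j
  · obtain ⟨j, hj⟩ := mem_iUnion.1 (hVC hx)
    simp only [mem_iUnion]
    exact ⟨g j, j, rfl, hj⟩
  · refine le_trans (ncard_le_ncard ?_ (toFinite _)) ((ncard_image_le (f := g) (toFinite _)).trans
      (hVN x hx))
    intro i hi
    simp only [mem_ofPred_eq, mem_iUnion] at hi
    obtain ⟨j, rfl, hj⟩ := hi
    exact ⟨j, hj, rfl⟩

theorem covDimLE_iff : CovDimLE X N ↔ CoverOrderLE (univ : Set X) (N + 1) := by
  constructor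
  · refine fun h => of_refinement fun k U hU hC => ?_
    obtain ⟨𝒱, hfin, hVo, hVc, hVU, hVN⟩ := h (range U) (finite_range U) (by simpa using hU)
      (by rw [sUnion_range]; exact univ_subset_iff.1 hC)
    obtain ⟨m, ⟨e⟩⟩ := @Finite.exists_equiv_fin 𝒱 hfin
    refine ⟨Fin m, inferInstance, fun j => (e.symm j : Set X), fun j => hVo _ (e.symm j).2,
      fun j => ?_, fun x _ => ?_, fun x _ => ?_⟩
    · obtain ⟨_, ⟨i, rfl⟩, hi⟩ := hVU _ (e.symm j).2
      exact ⟨i, hi⟩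
    · obtain ⟨v, hv, hx⟩ := mem_sUnion.1 (hVc.symm ▸ mem_univ x)
      exact mem_iUnion.2 ⟨e ⟨v, hv⟩, by simpa using hx⟩
    · refine le_trans (ncard_le_ncard_of_injOn (t := {v ∈ 𝒱 | x ∈ v})
        (fun j => (e.symm j : Set X)) (fun j hj => ⟨(e.symm j).2, hj⟩)
        (Subtype.val_injective.comp e.symm.injective).injOn (hfin.subset (sep_subset _ _))) ?_
      exact_mod_cast hVN x
  · intro h 𝒰 hfin hU hC
    have : Finite 𝒰 := hfin
    obtain ⟨V, hVo, hVU, hVC, hVN⟩ := h.exists_shrinking (U := fun u : 𝒰 => (u : Set X))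
      (fun u => hU _ u.2) (by rw [← sUnion_eq_iUnion, hC])
    refine ⟨range V, finite_range V, forall_mem_range.2 hVo, ?_, ?_, fun x => ?_⟩
    · rw [sUnion_range]
      exact univ_subset_iff.1 hVC
    · rintro _ ⟨u, rfl⟩
      exact ⟨u, u.2, hVU u⟩
    · have : {v ∈ range V | x ∈ v} = V '' {i | x ∈ V i} := by
        ext v
        constructor
        · rintro ⟨⟨i, rfl⟩, hi⟩
          exact ⟨i, hi, rfl⟩
        · rintro ⟨i, hi, rfl⟩
          exact ⟨⟨i, rfl⟩, hi⟩
      rw [this]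
      exact_mod_cast (ncard_image_le (toFinite _)).trans (hVN x (mem_univ x))

theorem finiteDim_iff : FiniteDim X ↔ ∃ N, CoverOrderLE (univ : Set X) N := by
  constructor
  · rintro ⟨n, hn⟩
    exact ⟨n + 1, covDimLE_iff.1 hn⟩
  · rintro ⟨N, hN⟩
    refine ⟨N, covDimLE_iff.2 fun k U hU hC => ?_⟩
    obtain ⟨V, hVo, hVU, hVC, hVN⟩ := hN k U hU hC
    exact ⟨V, hVo, hVU, hVC, fun x hx => (hVN x hx).trans N.le_succ⟩

theorem mono_right (h : CoverOrderLE C N) (hNM : N ≤ M) : CoverOrderLE C M := by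
  intro k U hU hC
  obtain ⟨V, hVo, hVU, hVC, hVN⟩ := h k U hU hC
  exact ⟨V, hVo, hVU, hVC, fun x hx => (hVN x hx).trans hNM⟩

theorem empty : CoverOrderLE (∅ : Set X) N :=
  fun _ U hU _ => ⟨U, hU, fun _ => Subset.rfl, empty_subset _, by simp⟩

theorem mono_left (h : CoverOrderLE E N) (hDE : D ⊆ E) (hD : IsClosed D) : CoverOrderLE D N := by
  intro k U hU hC
  rcases D.eq_empty_or_nonempty with rfl | ⟨d, hd⟩
  · exact empty k U hU hC
  obtain ⟨i₀, -⟩ := mem_iUnion.1 (hC hd)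
  obtain ⟨V, hVo, hVU, hVC, hVN⟩ := h k (fun i => U i ∪ Dᶜ) (fun i => (hU i).union hD.isOpen_compl)
    (fun x _ => by
      by_cases hx : x ∈ D
      · obtain ⟨i, hi⟩ := mem_iUnion.1 (hC hx)
        exact mem_iUnion.2 ⟨i, Or.inl hi⟩
      · exact mem_iUnion.2 ⟨i₀, Or.inr hx⟩)
  refine ⟨fun i => V i ∩ U i, fun i => (hVo i).inter (hU i), fun i => inter_subset_right,
    fun x hx => ?_, fun x hx => ?_⟩
  · obtain ⟨i, hi⟩ := mem_iUnion.1 (hVC (hDE hx))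
    exact mem_iUnion.2 ⟨i, hi, (hVU i hi).resolve_right (not_not_intro hx)⟩
  · exact (ncard_le_ncard (fun i hi => hi.1) (toFinite _)).trans (hVN x (hDE hx))

theorem image_iff {g : X → Z} (hg : IsInducing g) :
    CoverOrderLE (g '' C) N ↔ CoverOrderLE C N := by
  constructor
  · intro h k U hU hC
    choose U' hU' hUU' using fun i => hg.isOpen_iff.1 (hU i)
    obtain ⟨V, hVo, hVU, hVC, hVN⟩ := h k U' hU' (by
      rw [image_subset_iff, preimage_iUnion]
      simpa only [hUU'] using hC)
    refine ⟨fun i => g ⁻¹' V i, fun i => (hVo i).preimage hg.continuous, fun i => ?_, ?_,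
      fun x hx => hVN _ (mem_image_of_mem g hx)⟩
    · rw [← hUU' i]
      exact preimage_mono (hVU i)
    · rwa [← preimage_iUnion, ← image_subset_iff]
  · intro h k U hU hC
    obtain ⟨V, hVo, hVU, hVC, hVN⟩ := h k (fun i => g ⁻¹' U i)
      (fun i => (hU i).preimage hg.continuous) (by rwa [← preimage_iUnion, ← image_subset_iff])
    choose V' hV' hVV' using fun i => hg.isOpen_iff.1 (hVo i)
    have key : ∀ x i, g x ∈ V' i ∩ U i ↔ x ∈ V i := fun x i => by
      have : x ∈ V i ↔ g x ∈ V' i := by rw [← hVV' i]; rfl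
      exact ⟨fun hx => this.2 hx.1, fun hx => ⟨this.1 hx, hVU i hx⟩⟩
    refine ⟨fun i => V' i ∩ U i, fun i => (hV' i).inter (hU i), fun i => inter_subset_right, ?_, ?_⟩
    · rintro _ ⟨x, hx, rfl⟩
      obtain ⟨i, hi⟩ := mem_iUnion.1 (hVC hx)
      exact mem_iUnion.2 ⟨i, (key x i).2 hi⟩
    · rintro _ ⟨x, hx, rfl⟩
      simpa only [key] using hVN x hx

theorem of_injective [CompactSpace X] [T2Space Z] {f : X → Z} (hf : Continuous f)
    (hinj : Function.Injective f) (h : CoverOrderLE (univ : Set Z) N) :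
    CoverOrderLE (univ : Set X) N := by
  have hemb := hf.isClosedEmbedding hinj
  exact (image_iff hemb.isInducing).1 (h.mono_left (subset_univ _)
    (hemb.isClosedMap _ isClosed_univ))

theorem isOpen_ncard_le {ι : Type*} [Finite ι] {F : ι → Set X} (hF : ∀ i, IsClosed (F i)) :
    IsOpen {x | {i | x ∈ F i}.ncard ≤ N} := by
  refine isOpen_iff_mem_nhds.2 fun x hx => ?_
  have : ∀ᶠ y in 𝓝 x, ∀ i, y ∈ F i → x ∈ F i := eventually_all.2 fun i => by
    by_cases hi : x ∈ F i
    · exact Eventually.of_forall fun _ _ => hi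
    · filter_upwards [(hF i).isOpen_compl.mem_nhds hi] with y hy hy' using absurd hy' hy
  filter_upwards [this] with y hy
  exact (ncard_le_ncard (fun i hi => hy i hi) (toFinite _)).trans hx

theorem exists_shrinking_nhds [NormalSpace X] (h : CoverOrderLE C N) (hCE : C ⊆ E)
    (hC : IsClosed C) (hE : IsClosed E) {ι : Type*} [Finite ι] {U : ι → Set X}
    (hU : ∀ i, IsOpen (U i)) (hEU : E ⊆ ⋃ i, U i) :
    ∃ (V : ι → Set X) (O : Set X), (∀ i, IsOpen (V i)) ∧ (∀ i, V i ⊆ U i) ∧ E ⊆ ⋃ i, V i ∧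
      IsOpen O ∧ C ⊆ O ∧ ∀ x ∈ O, {i | x ∈ V i}.ncard ≤ N := by
  obtain ⟨W, hWo, hWU, hWC, hWN⟩ := h.exists_shrinking hU (hCE.trans hEU)
  obtain ⟨V, hVE, hVo, hVW⟩ := exists_subset_iUnion_closure_subset hE
    (u := fun i => W i ∪ (U i \ C)) (fun i => (hWo i).union ((hU i).sdiff hC))
    (fun x _ => toFinite _) (fun x hx => by
      by_cases hxC : x ∈ C
      · obtain ⟨i, hi⟩ := mem_iUnion.1 (hWC hxC)
        exact mem_iUnion.2 ⟨i, Or.inl hi⟩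
      · obtain ⟨i, hi⟩ := mem_iUnion.1 (hEU hx)
        exact mem_iUnion.2 ⟨i, Or.inr ⟨hi, hxC⟩⟩)
  refine ⟨V, {x | {i | x ∈ closure (V i)}.ncard ≤ N}, hVo, fun i => ?_, hVE,
    isOpen_ncard_le fun i => isClosed_closure, fun x hx => ?_, fun x hx => ?_⟩
  · exact subset_closure.trans ((hVW i).trans (union_subset (hWU i) sdiff_subset))
  · refine (ncard_le_ncard (fun i hi => ?_) (toFinite _)).trans (hWN x hx)
    exact (hVW i hi).resolve_right fun h' => h'.2 hx
  · exact (ncard_le_ncard (t := {i | x ∈ closure (V i)}) (fun i hi => subset_closure hi)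
      (toFinite _)).trans hx

/-- If a closed subset `C` of a closed set `E` and all closed subsets of `E` disjoint from `C` have
order at most `N`, then so does `E`. -/
theorem of_forall_disjoint [NormalSpace X] (hC : IsClosed C) (hE : IsClosed E) (hCE : C ⊆ E)
    (h : CoverOrderLE C N)
    (hD : ∀ D, IsClosed D → D ⊆ E → Disjoint D C → CoverOrderLE D N) : CoverOrderLE E N := by
  intro k U hU hEU
  obtain ⟨V, O, hVo, hVU, hVE, hO, hCO, hVN⟩ := h.exists_shrinking_nhds hCE hC hE hU hEU
  obtain ⟨W, O', hWo, hWV, hWE, -, hDO, hWN⟩ := (hD (E \ O) (hE.sdiff hO) sdiff_subset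
    (disjoint_left.2 fun x hx hxC => hx.2 (hCO hxC))).exists_shrinking_nhds sdiff_subset
    (hE.sdiff hO) hE hVo hVE
  refine ⟨W, hWo, fun i => (hWV i).trans (hVU i), hWE, fun x hx => ?_⟩
  by_cases hxO : x ∈ O
  · exact (ncard_le_ncard (fun i hi => hWV i hi) (toFinite _)).trans (hVN x hxO)
  · exact hWN x (hDO ⟨hx, hxO⟩)

theorem union [NormalSpace X] (hC : IsClosed C) (hD : IsClosed D) (h : CoverOrderLE C N)
    (h' : CoverOrderLE D N) : CoverOrderLE (C ∪ D) N := by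
  refine of_forall_disjoint hC (hC.union hD) subset_union_left h fun F hF hFE hFC => ?_
  exact h'.mono_left (fun x hx => (hFE hx).resolve_left (disjoint_left.1 hFC hx)) hF

theorem of_locally [CompactSpace X] [NormalSpace X] (hD : IsClosed D)
    (h : ∀ x ∈ D, ∃ t ∈ 𝓝[D] x, IsClosed t ∧ CoverOrderLE t N) : CoverOrderLE D N := by
  have : ∃ t, D ⊆ t ∧ IsClosed t ∧ CoverOrderLE t N := by
    refine hD.isCompact.induction_on (p := fun s => ∃ t, s ⊆ t ∧ IsClosed t ∧ CoverOrderLE t N)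
      ⟨∅, Subset.rfl, isClosed_empty, empty⟩ ?_ ?_ ?_
    · rintro s s' hs ⟨t, ht, h⟩
      exact ⟨t, hs.trans ht, h⟩
    · rintro s s' ⟨t, hst, htc, ht⟩ ⟨t', hst', htc', ht'⟩
      exact ⟨t ∪ t', union_subset_union hst hst', htc.union htc', ht.union htc htc' ht'⟩
    · intro x hx
      obtain ⟨t, htx, ht⟩ := h x hx
      exact ⟨t, htx, t, Subset.rfl, ht⟩
  obtain ⟨t, hDt, -, ht⟩ := this
  exact ht.mono_left hDt hD

theorem exists_subset_ball {Y : Type*} [UniformSpace Y] [CompactSpace Y] {A : Set (Y × Y)}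
    (h : CoverOrderLE (univ : Set Y) N) (hA : A ∈ 𝓤 Y) :
    ∃ (k : ℕ) (V : Fin k → Set Y), (∀ i, IsOpen (V i)) ∧
      (∀ i, ∃ a, V i ⊆ UniformSpace.ball a A) ∧ univ ⊆ ⋃ i, V i ∧
      ∀ x, {i | x ∈ V i}.ncard ≤ N := by
  obtain ⟨t, ht⟩ := CompactSpace.elim_nhds_subcover (fun a : Y => interior (UniformSpace.ball a A))
    fun a => interior_mem_nhds.2 (UniformSpace.ball_mem_nhds a hA)
  let e := t.equivFin
  obtain ⟨V, hVo, hVU, hVC, hVN⟩ := h _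
    (fun i => interior (UniformSpace.ball (e.symm i : Y) A)) (fun i => isOpen_interior)
    (fun x _ => by
      obtain ⟨a, ha, hx⟩ := mem_iUnion₂.1 (ht.ge (mem_univ x))
      exact mem_iUnion.2 ⟨e ⟨a, ha⟩, by simpa using hx⟩)
  exact ⟨_, V, hVo, fun i => ⟨_, (hVU i).trans interior_subset⟩, hVC, fun x => hVN x (mem_univ x)⟩

theorem prod [CompactSpace X] [T2Space X] [CompactSpace Z] [T2Space Z]
    (hX : CoverOrderLE (univ : Set X) N) (hZ : CoverOrderLE (univ : Set Z) M) :
    CoverOrderLE (univ : Set (X × Z)) (N * M) := by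
  refine of_refinement fun k U hU hC => ?_
  let _ : UniformSpace X := uniformSpaceOfCompactR1
  let _ : UniformSpace Z := uniformSpaceOfCompactR1
  obtain ⟨S, hS, hSU⟩ := lebesgue_number_lemma isCompact_univ hU hC
  obtain ⟨A, hA, B, hB, hAB⟩ := entourageProd_subset hS
  obtain ⟨k₁, P, hPo, hPA, hPC, hPN⟩ := hX.exists_subset_ball hA
  obtain ⟨k₂, Q, hQo, hQB, hQC, hQM⟩ := hZ.exists_subset_ball hB
  refine ⟨Fin k₁ × Fin k₂, inferInstance, fun j => P j.1 ×ˢ Q j.2,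
    fun j => (hPo j.1).prod (hQo j.2), fun j => ?_, fun x _ => ?_, fun x _ => ?_⟩
  · obtain ⟨a, ha⟩ := hPA j.1
    obtain ⟨b, hb⟩ := hQB j.2
    obtain ⟨i, hi⟩ := hSU (a, b) (mem_univ _)
    exact ⟨i, fun p hp => hi (hAB ⟨ha hp.1, hb hp.2⟩)⟩
  · obtain ⟨i, hi⟩ := mem_iUnion.1 (hPC (mem_univ x.1))
    obtain ⟨j, hj⟩ := mem_iUnion.1 (hQC (mem_univ x.2))
    exact mem_iUnion.2 ⟨(i, j), hi, hj⟩
  · have : {j : Fin k₁ × Fin k₂ | x ∈ P j.1 ×ˢ Q j.2} = {i | x.1 ∈ P i} ×ˢ {i | x.2 ∈ Q i} := rfl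
    rw [this, ncard_prod]
    exact Nat.mul_le_mul (hPN _) (hQM _)

theorem pi_fin [CompactSpace X] [T2Space X] (hX : CoverOrderLE (univ : Set X) N) (n : ℕ) :
    CoverOrderLE (univ : Set (Fin n → X)) (N ^ n) := by
  induction n with
  | zero =>
    intro k U hU hC
    obtain ⟨i, hi⟩ := mem_iUnion.1 (hC (mem_univ default))
    refine ⟨fun j => if j = i then univ else ∅, fun j => ?_, fun j => ?_, fun x _ => ?_,
      fun x _ => ?_⟩
    · by_cases h : j = i <;> simp [h]
    · by_cases h : j = i
      · subst h
        simp only [if_true]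
        intro x _
        rwa [Subsingleton.elim x default]
      · simp [h]
    · exact mem_iUnion.2 ⟨i, by simp⟩
    · refine (ncard_le_ncard (t := {i}) (fun j hj => ?_)).trans (by simp)
      by_contra h
      simp only [mem_singleton_iff] at h
      simp [h] at hj
  | succ n ih =>
    rw [pow_succ']
    refine of_injective (f := fun g : Fin (n + 1) → X => (g 0, Fin.tail g)) ?_ ?_ (hX.prod ih)
    · unfold Fin.tail
      fun_prop
    · intro g g' h
      simp only [Prod.mk.injEq] at h
      rw [← Fin.cons_self_tail g, ← Fin.cons_self_tail g', h.1, h.2]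

theorem unitInterval : CoverOrderLE (univ : Set I) 2 := by
  refine of_refinement fun k U hU hC => ?_
  obtain ⟨δ, hδ, hδU⟩ := lebesgue_number_lemma_of_metric isCompact_univ hU hC
  obtain ⟨m, hm⟩ := exists_nat_one_div_lt hδ
  set L : ℝ := m + 1 with hL
  have hL0 : 0 < L := by positivity
  have hfloor : ∀ x : I, ⌊(x : ℝ) * L⌋₊ < m + 2 := fun x => by
    rw [Nat.floor_lt (mul_nonneg x.2.1 hL0.le)]
    push_cast
    nlinarith [x.2.2]
  refine ⟨Fin (m + 2), inferInstance, fun j => {x | |(x : ℝ) * L - j| < 1}, fun j => ?_,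
    fun j => ?_, fun x _ => ?_, fun x _ => ?_⟩
  · exact isOpen_lt (by fun_prop) continuous_const
  · have hj : ((j : ℕ) : ℝ) / L ∈ I := by
      refine ⟨by positivity, (div_le_one hL0).2 ?_⟩
      have : (j : ℕ) ≤ m + 1 := by omega
      rw [hL]
      exact_mod_cast this
    obtain ⟨i, hi⟩ := hδU ⟨_, hj⟩ (mem_univ _)
    refine ⟨i, fun x hx => hi ?_⟩
    rw [Metric.mem_ball, Subtype.dist_eq, Real.dist_eq]
    refine lt_trans ?_ hm
    have : (x : ℝ) - (j : ℕ) / L = ((x : ℝ) * L - j) / L := by field_simp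
    simp only [this, abs_div, abs_of_pos hL0]
    exact div_lt_div_of_pos_right hx hL0
  · refine mem_iUnion.2 ⟨⟨_, hfloor x⟩, ?_⟩
    have h1 := Nat.floor_le (mul_nonneg x.2.1 hL0.le)
    have h2 := Nat.lt_floor_add_one ((x : ℝ) * L)
    simp only [mem_ofPred_eq, abs_lt]
    constructor <;> linarith
  · refine (ncard_le_ncard_of_injOn (t := {⌊(x : ℝ) * L⌋₊, ⌊(x : ℝ) * L⌋₊ + 1})
      (fun j : Fin (m + 2) => (j : ℕ)) (fun j hj => ?_) Fin.val_injective.injOn).trans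
      ((ncard_insert_le _ _).trans (by simp))
    have h1 := Nat.floor_le (mul_nonneg x.2.1 hL0.le)
    have h2 := Nat.lt_floor_add_one ((x : ℝ) * L)
    simp only [mem_ofPred_eq, abs_lt] at hj
    have h3 : ⌊(x : ℝ) * L⌋₊ < (j : ℕ) + 1 := by
      have : (⌊(x : ℝ) * L⌋₊ : ℝ) < (j : ℕ) + 1 := by linarith
      exact_mod_cast this
    have h4 : (j : ℕ) < ⌊(x : ℝ) * L⌋₊ + 2 := by
      have : ((j : ℕ) : ℝ) < ⌊(x : ℝ) * L⌋₊ + 2 := by linarith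
      exact_mod_cast this
    simp only [mem_insert_iff, mem_singleton_iff]
    omega

end CoverOrderLE

theorem exists_continuous_eq_one_of_isOpen {Z : Type*} [TopologicalSpace Z]
    [CompletelyRegularSpace Z] {O : Set Z} (hO : IsOpen O) {x : Z}
    (hx : x ∈ O) :
    ∃ f : Z → ℝ, Continuous f ∧ f x = 1 ∧ ∀ z ∉ O, f z = 0 := by
  obtain ⟨f, hf, hfx, hfO⟩ := CompletelyRegularSpace.completely_regular x Oᶜ hO.isClosed_compl
    (not_not_intro hx)
  refine ⟨fun z => 1 - f z, by fun_prop, by simp [hfx], fun z hz => ?_⟩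
  have : f z = 1 := hfO hz
  simp [this]

/-- A family of finitely supported measures on `Z` parametrised by `K` is weakly continuous if all
integrals of continuous functions depend continuously on the parameter. -/
def WeaklyContinuous {K Z : Type*} [TopologicalSpace K] [TopologicalSpace Z]
    (μ : K → Z →₀ ℝ) : Prop :=
  ∀ f : Z → ℝ, Continuous f → Continuous fun y => (μ y).sum fun x a => a * f x

namespace WeaklyContinuous

theorem comp_continuous {K L Z : Type*} [TopologicalSpace K] [TopologicalSpace L]
    [TopologicalSpace Z] {μ : K → Z →₀ ℝ} (hμ : WeaklyContinuous μ) {g : L → K}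
    (hg : Continuous g) : WeaklyContinuous (μ ∘ g) :=
  fun f hf => (hμ f hf).comp hg

variable {K Z : Type*} [TopologicalSpace K] [TopologicalSpace Z] [T2Space Z]
  [CompletelyRegularSpace Z] {μ : K → Z →₀ ℝ}

theorem eventually_exists_mem_support (hμ : WeaklyContinuous μ) {y₀ : K} {x : Z}
    (hx : x ∈ (μ y₀).support) {O : Set Z} (hO : IsOpen O) (hxO : x ∈ O) :
    ∀ᶠ y in 𝓝 y₀, ∃ z ∈ (μ y).support, z ∈ O := by
  classical
  have hO' : IsOpen (O \ ((μ y₀).support.erase x : Finset Z)) :=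
    hO.sdiff (Finset.finite_toSet _).isClosed
  obtain ⟨f, hf, hfx, hfO⟩ := exists_continuous_eq_one_of_isOpen hO'
    (x := x) ⟨hxO, by simp⟩
  have hne : ((μ y₀).sum fun x a => a * f x) ≠ 0 := by
    rw [Finsupp.sum, Finset.sum_eq_single_of_mem x hx, hfx, mul_one]
    · exact Finsupp.mem_support_iff.1 hx
    · intro z hz hzx
      rw [hfO z fun h => h.2 (Finset.mem_coe.2 (Finset.mem_erase.2 ⟨hzx, hz⟩)), mul_zero]
  filter_upwards [(hμ f hf).continuousAt.eventually_ne hne] with y hy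
  obtain ⟨z, hz, hzf⟩ := Finset.exists_ne_zero_of_sum_ne_zero hy
  exact ⟨z, hz, by_contra fun h => hzf (mul_eq_zero_of_right _ (hfO z fun h' => h h'.1))⟩

theorem eventually_card_support_le (hμ : WeaklyContinuous μ) (y₀ : K) :
    ∀ᶠ y in 𝓝 y₀, (μ y₀).support.card ≤ (μ y).support.card := by
  obtain ⟨U, hU, hdisj⟩ := (μ y₀).support.finite_toSet.t2_separation
  have : ∀ᶠ y in 𝓝 y₀, ∀ x ∈ (μ y₀).support, ∃ z ∈ (μ y).support, z ∈ U x :=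
    (Filter.eventually_all_finset _).2 fun x hx =>
      hμ.eventually_exists_mem_support hx (hU x).2 (hU x).1
  filter_upwards [this] with y hy
  choose! g hg hgU using hy
  refine Finset.card_le_card_of_injOn g hg fun a ha b hb hab => ?_
  by_contra hne
  exact disjoint_left.1 (hdisj ha hb hne) (hgU a ha) (hab ▸ hgU b hb)

theorem isClosed_support_subset_card_lt (hμ : WeaklyContinuous μ) {C : Set Z} (hC : IsClosed C)
    (n : ℕ) : IsClosed {y | ((μ y).support : Set Z) ⊆ C ∧ (μ y).support.card < n} := by
  rw [← isOpen_compl_iff, isOpen_iff_mem_nhds]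
  intro y₀ hy₀
  by_cases hsub : ((μ y₀).support : Set Z) ⊆ C
  · filter_upwards [hμ.eventually_card_support_le y₀] with y hy h
    exact hy₀ ⟨hsub, hy.trans_lt h.2⟩
  · obtain ⟨x, hx, hxC⟩ := not_subset.1 hsub
    filter_upwards [hμ.eventually_exists_mem_support hx hC.isOpen_compl hxC] with y hy h
    obtain ⟨z, hz, hzC⟩ := hy
    exact hzC (h.1 hz)

/-- If all `μ y` have exactly `n` support points, one in each of `n` disjoint open sets, then these
points and their masses depend continuously on `y`. -/
theorem exists_continuous_coordinates (hμ : WeaklyContinuous μ) {n : ℕ} {U : Fin n → Set Z}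
    (hU : ∀ i, IsOpen (U i)) (hdisj : Pairwise (Function.onFun Disjoint U))
    (hsupp : ∀ y i, ∃ z ∈ (μ y).support, z ∈ U i) (hcard : ∀ y, (μ y).support.card ≤ n) :
    ∃ p : Fin n → K → Z, (∀ i, Continuous (p i)) ∧ (∀ i, Continuous fun y => μ y (p i y)) ∧
      ∀ y, ((μ y).support : Set Z) = range fun i => p i y := by
  choose p' hp' hpU' using hsupp
  have hinj : ∀ y, Function.Injective (p' y) := fun y i j hij => by
    by_contra hne
    exact disjoint_left.1 (hdisj hne) (hpU' y i) (hij ▸ hpU' y j)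
  have hrange : ∀ y, (μ y).support = Finset.univ.map ⟨p' y, hinj y⟩ := fun y => by
    refine (Finset.eq_of_subset_of_card_le ?_ ?_).symm
    · intro z hz
      obtain ⟨i, -, rfl⟩ := Finset.mem_map.1 hz
      exact hp' y i
    · simpa using hcard y
  have hunique : ∀ y i, ∀ z ∈ (μ y).support, z ∈ U i → z = p' y i := fun y i z hz hzU => by
    rw [hrange y] at hz
    obtain ⟨j, -, rfl⟩ := Finset.mem_map.1 hz
    by_contra hne
    exact disjoint_left.1 (hdisj fun h : j = i => hne (h ▸ rfl)) (hpU' y j) hzU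
  have hcont : ∀ i, Continuous fun y => p' y i := fun i => by
    refine continuous_iff_continuousAt.2 fun y₀ => tendsto_nhds.2 fun O hO hpO => ?_
    filter_upwards [hμ.eventually_exists_mem_support (hp' y₀ i) (hO.inter (hU i))
      ⟨hpO, hpU' y₀ i⟩] with y hy
    obtain ⟨z, hz, hzO⟩ := hy
    rw [hunique y i z hz hzO.2] at hzO
    exact hzO.1
  refine ⟨fun i y => p' y i, hcont, fun i => ?_, fun y => ?_⟩
  · refine continuous_iff_continuousAt.2 fun y₀ => ?_
    obtain ⟨f, hf, hfx, hfO⟩ := exists_continuous_eq_one_of_isOpen (hU i) (hpU' y₀ i)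
    have hsum : ∀ y, ((μ y).sum fun x a => a * f x) = μ y (p' y i) * f (p' y i) := fun y => by
      rw [Finsupp.sum, Finset.sum_eq_single_of_mem _ (hp' y i)]
      intro z hz hne
      rw [hfO z fun h => hne (hunique y i z hz h), mul_zero]
    have hfc : ContinuousAt (fun y => f (p' y i)) y₀ := (hf.comp (hcont i)).continuousAt
    have hne : f (p' y₀ i) ≠ 0 := by simp [hfx]
    refine ((hμ f hf).continuousAt.div hfc hne).congr ?_
    filter_upwards [hfc.eventually_ne hne] with y hy
    rw [Pi.div_apply, hsum, mul_div_cancel_right₀ _ hy]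
  · rw [hrange y]
    simp

theorem coverOrderLE_of_card_eq [CompactSpace K] [CompactSpace Z]
    (hμ : WeaklyContinuous μ) (hinj : Function.Injective μ) {C : Set Z}
    (hC : IsClosed C) {N n : ℕ} (hN : CoverOrderLE C N) {U : Fin n → Set Z}
    (hU : ∀ i, IsOpen (U i)) (hdisj : Pairwise (Function.onFun Disjoint U))
    (hsupp : ∀ y i, ∃ z ∈ (μ y).support, z ∈ U i) (hcard : ∀ y, (μ y).support.card ≤ n)
    (hsub : ∀ y, ((μ y).support : Set Z) ⊆ C) :
    CoverOrderLE (univ : Set K) ((N * 2) ^ n) := by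
  obtain ⟨p, hp, hm, hrange⟩ := hμ.exists_continuous_coordinates hU hdisj hsupp hcard
  have hpC : ∀ i y, p i y ∈ C := fun i y => hsub y (hrange y ▸ mem_range_self i)
  have : CompactSpace C := isCompact_iff_compactSpace.1 hC.isCompact
  have hNC : CoverOrderLE (univ : Set C) N := by
    rwa [← CoverOrderLE.image_iff IsInducing.subtypeVal, image_univ, Subtype.range_coe]
  refine CoverOrderLE.of_injective
    (f := fun y i => ((⟨p i y, hpC i y⟩ : C), unitInterval.sigmoid (μ y (p i y)))) ?_ ?_
    ((hNC.prod CoverOrderLE.unitInterval).pi_fin n)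
  · exact continuous_pi fun i => ((hp i).subtype_mk _).prodMk
      (isEmbedding_sigmoid.continuous.comp (hm i))
  · intro y y' h
    have h1 : ∀ i, p i y = p i y' := fun i => congrArg Subtype.val (congrArg Prod.fst (congrFun h i))
    have h2 : ∀ i, μ y (p i y) = μ y' (p i y') := fun i =>
      unitInterval.sigmoid_injective (congrArg Prod.snd (congrFun h i))
    have hs : (μ y).support = (μ y').support := by
      rw [← Finset.coe_inj, hrange, hrange]
      simp only [h1]
    refine hinj (Finsupp.ext fun z => ?_)
    by_cases hz : z ∈ (μ y).support
    · obtain ⟨i, rfl⟩ : z ∈ range fun i => p i y := hrange y ▸ hz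
      change μ y (p i y) = μ y' (p i y)
      rw [h2, h1]
    · rw [Finsupp.notMem_support_iff.1 hz, Finsupp.notMem_support_iff.1 (hs ▸ hz)]

theorem exists_coverOrderLE [CompactSpace K] [T2Space K] [CompactSpace Z]
    (hμ : WeaklyContinuous μ) (hinj : Function.Injective μ) {C : Set Z} (hC : IsClosed C) {N : ℕ}
    (hN : CoverOrderLE C N) (n : ℕ) :
    ∃ M, CoverOrderLE {y | ((μ y).support : Set Z) ⊆ C ∧ (μ y).support.card < n} M := by
  induction n with
  | zero => exact ⟨0, by simpa using CoverOrderLE.empty⟩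
  | succ n ih =>
    obtain ⟨M, hM⟩ := ih
    refine ⟨max M ((N * 2) ^ n), .of_forall_disjoint (hμ.isClosed_support_subset_card_lt hC n)
      (hμ.isClosed_support_subset_card_lt hC (n + 1)) (fun y hy => ⟨hy.1, hy.2.trans n.lt_succ_self⟩)
      (hM.mono_right (le_max_left _ _)) fun D hD hDE hDC => ?_⟩
    have hDn : ∀ y ∈ D, (μ y).support.card = n := fun y hy => by
      have h1 := (hDE hy).2
      have h2 : ¬ (μ y).support.card < n := fun h => disjoint_left.1 hDC hy ⟨(hDE hy).1, h⟩
      omega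
    refine (CoverOrderLE.of_locally hD fun y₀ hy₀ => ?_).mono_right (le_max_right _ _)
    obtain ⟨U, hU, hdisj⟩ := (μ y₀).support.finite_toSet.t2_separation
    let e : Fin n ≃ (μ y₀).support := ((μ y₀).support.equivFinOfCardEq (hDn y₀ hy₀)).symm
    have : ∀ᶠ y in 𝓝 y₀, ∀ i, ∃ z ∈ (μ y).support, z ∈ U (e i) := eventually_all.2 fun i =>
      hμ.eventually_exists_mem_support (e i).2 (hU _).2 (hU _).1
    obtain ⟨G, hG, hGc, hGU⟩ := exists_mem_nhds_isClosed_subset this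
    have hGD : IsClosed (G ∩ D) := hGc.inter hD
    refine ⟨G ∩ D, inter_mem (mem_nhdsWithin_of_mem_nhds hG) self_mem_nhdsWithin, hGD, ?_⟩
    have : CompactSpace ↥(G ∩ D) := isCompact_iff_compactSpace.1 hGD.isCompact
    rw [← Subtype.range_coe (s := G ∩ D), ← image_univ, CoverOrderLE.image_iff .subtypeVal]
    refine coverOrderLE_of_card_eq (hμ.comp_continuous continuous_subtype_val)
      (hinj.comp Subtype.val_injective) hC hN (fun i => (hU (e i)).2) (fun i j hij => ?_)
      (fun y => hGU y.2.1) (fun y => (hDn y y.2.2).le) fun y => (hDE y.2.2).1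
    exact hdisj (e i).2 (e j).2 fun h => hij (e.injective (Subtype.ext h))

end WeaklyContinuous

theorem exists_finsupp_eq_sum_of_continuous {X : Type u} [TopologicalSpace X] (φ : Cp X →ₗ[ℝ] ℝ)
    (hφ : Continuous φ) :
    ∃ μ : X →₀ ℝ, ∀ f : Cp X, φ f = μ.sum fun x a => a * (f : X → ℝ) x := by
  let ev : X → Cp X →ₗ[ℝ] ℝ := fun x => LinearMap.proj x ∘ₗ (cpSubmodule X).subtype
  have hmem : φ ∈ Submodule.span ℝ (range ev) := by
    rw [LinearMap.mem_span_iff_continuous]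
    convert hφ
    simp only [instTopologicalSpaceSubtype, Pi.topologicalSpace, induced_iInf, induced_compose]
    rfl
  obtain ⟨μ, hμ⟩ := Finsupp.mem_span_range_iff_exists_finsupp.1 hmem
  refine ⟨μ, fun f => ?_⟩
  rw [← hμ, Finsupp.sum, LinearMap.sum_apply]
  rfl

theorem CoverOrderLE.exists_of_list {Z ι : Type*} [TopologicalSpace Z] [NormalSpace Z]
    {P : ι → Set Z} (hP : ∀ i, IsClosed (P i)) (h : ∀ i, ∃ N, CoverOrderLE (P i) N) (l : List ι) :
    IsClosed (⋃ i ∈ l, P i) ∧ ∃ N, CoverOrderLE (⋃ i ∈ l, P i) N := by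
  induction l with
  | nil => simpa using ⟨0, CoverOrderLE.empty⟩
  | cons i l ih =>
    obtain ⟨hl, N, hN⟩ := ih
    obtain ⟨M, hM⟩ := h i
    have : ⋃ j ∈ i :: l, P j = P i ∪ ⋃ j ∈ l, P j := by simp [iUnion_or, iUnion_union_distrib]
    rw [this]
    exact ⟨(hP i).union hl, max M N, (hM.mono_right (le_max_left _ _)).union (hP i) hl
      (hN.mono_right (le_max_right _ _))⟩

/-- A space which is both `κ`-compact and strongly `κ`-dimensional is covered by `κ` many compact
sets of finite covering dimension. -/
theorem exists_isCompact_coverOrderLE {κ : Cardinal.{u}} (hκ : Cardinal.aleph0 ≤ κ) {X : Type u}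
    [TopologicalSpace X] [T2Space X] (hX : IsKappaCompact κ X) (hdim : StronglyKappaDim κ X) :
    ∃ (ι : Type u) (P : ι → Set X), Cardinal.mk ι ≤ κ ∧ (∀ i, IsCompact (P i)) ∧
      (∀ i, ∃ N, CoverOrderLE (P i) N) ∧ ∀ x, ∃ i, x ∈ P i := by
  obtain ⟨ι, C, hι, hC, hCX⟩ := hX
  obtain ⟨ι', F, hι', hF, hFdim, hFX⟩ := hdim
  refine ⟨ι × ι', fun p => C p.1 ∩ F p.2, ?_, fun p => (hC p.1).inter_right (hF p.2), fun p => ?_,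
    fun x => ?_⟩
  · rw [Cardinal.mk_prod, Cardinal.lift_id, Cardinal.lift_id]
    exact Cardinal.mul_le_of_le hκ hι hι'
  · obtain ⟨N, hN⟩ := CoverOrderLE.finiteDim_iff.1 (hFdim p.2)
    refine ⟨N, ?_⟩
    change CoverOrderLE (C p.1 ∩ F p.2) N
    rw [inter_comm, ← Subtype.image_preimage_coe, CoverOrderLE.image_iff .subtypeVal]
    exact hN.mono_left (subset_univ _) ((hC p.1).isClosed.preimage continuous_subtype_val)
  · obtain ⟨i, hi⟩ := mem_iUnion.1 (hCX.ge (mem_univ x))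
    obtain ⟨j, hj⟩ := mem_iUnion.1 (hFX.ge (mem_univ x))
    exact ⟨(i, j), hi, hj⟩

theorem injective_of_denseRange {X Y : Type u} [TopologicalSpace X] [TopologicalSpace Y]
    [T2Space Y] [CompletelyRegularSpace Y] {T : Cp X →ₗ[ℝ] Cp Y} (hT : DenseRange T)
    {μ : Y → X →₀ ℝ}
    (hμ : ∀ y (f : Cp X), (T f : Y → ℝ) y = (μ y).sum fun x a => a * (f : X → ℝ) x) :
    Function.Injective μ := by
  intro y y' h
  by_contra hne
  obtain ⟨f, hf, hfy, hfy'⟩ := exists_continuous_eq_one_of_isOpen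
    (isClosed_singleton (x := y')).isOpen_compl (x := y) hne
  have hev : ∀ z, Continuous fun g : Cp Y => (g : Y → ℝ) z := fun z =>
    (continuous_apply z).comp continuous_subtype_val
  have : (⟨f, hf⟩ : Cp Y) ∈ {g : Cp Y | (g : Y → ℝ) y = (g : Y → ℝ) y'} := by
    refine (isClosed_eq (hev y) (hev y')).closure_subset_iff.2 ?_ (hT _)
    rintro _ ⟨g, rfl⟩
    change (T g : Y → ℝ) y = (T g : Y → ℝ) y'
    rw [hμ, hμ, h]
  have h1 : f y = f y' := this
  rw [hfy, hfy' y' (by simp)] at h1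
  exact one_ne_zero h1

/-- Let `κ` be an infinite cardinal, `X` and `Y` `κ`-compact Tychonoff spaces. If there
is a continuous linear map `T : C_p(X) → C_p(Y)` with dense image and `X` is strongly
`κ`-dimensional, then `Y` is strongly `κ`-dimensional as well. -/
theorem stmt1 (κ : Cardinal.{u}) (hκ : Cardinal.aleph0 ≤ κ)
    (X Y : Type u) [TopologicalSpace X] [T2Space X] [CompletelyRegularSpace X]
    [TopologicalSpace Y] [T2Space Y] [CompletelyRegularSpace Y]
    (hX : IsKappaCompact κ X) (hY : IsKappaCompact κ Y)
    (T : Cp X →ₗ[ℝ] Cp Y) (hTcont : Continuous T) (hTdense : DenseRange T)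
    (hXdim : StronglyKappaDim κ X) :
    StronglyKappaDim κ Y := by
  have : T35Space X := {}
  obtain ⟨ι, P, hι, hP, hPN, hPX⟩ := exists_isCompact_coverOrderLE hκ hX hXdim
  obtain ⟨ι', K, hι', hK, hKY⟩ := hY
  have hTy : ∀ y, Continuous fun f => (T f : Y → ℝ) y := fun y =>
    (continuous_apply y).comp (continuous_subtype_val.comp hTcont)
  choose μ hμ using fun y => exists_finsupp_eq_sum_of_continuous
    ((LinearMap.proj y ∘ₗ (cpSubmodule Y).subtype) ∘ₗ T) (hTy y)
  have hμinj : Function.Injective μ := injective_of_denseRange hTdense hμ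
  let β : X → StoneCech X := stoneCechUnit
  have hβ : IsEmbedding β := isEmbedding_stoneCechUnit
  let ν : Y → StoneCech X →₀ ℝ := fun y => (μ y).mapDomain β
  have hν : WeaklyContinuous ν := fun f hf => by
    have : (fun y => (ν y).sum fun x a => a * f x) = T ⟨f ∘ β, hf.comp hβ.continuous⟩ :=
      funext fun y => (Finsupp.sum_mapDomain_index (by simp) (by simp [add_mul])).trans
        (hμ y ⟨f ∘ β, hf.comp hβ.continuous⟩).symm
    rw [this]
    exact (T _).2
  have hνinj : Function.Injective ν := (Finsupp.mapDomain_injective hβ.injective).comp hμinj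
  have hνsupp : ∀ y, ((ν y).support : Set (StoneCech X)) ⊆ range β := fun y => by
    classical
    refine (Finset.coe_subset.2 Finsupp.mapDomain_support).trans ?_
    simp
  have hC := CoverOrderLE.exists_of_list (P := fun i => β '' P i)
    (fun i => ((hP i).image hβ.continuous).isClosed)
    fun i => (hPN i).imp fun N hN => (CoverOrderLE.image_iff hβ.isInducing).2 hN
  let C : List ι → Set (StoneCech X) := fun l => ⋃ i ∈ l, β '' P i
  let E : ∀ p : ι' × List ι × ℕ, Set (K p.1) := fun p =>
    {y | ((ν y).support : Set (StoneCech X)) ⊆ C p.2.1 ∧ (ν y).support.card < p.2.2}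
  have hcont : ∀ i, WeaklyContinuous fun y : K i => ν y := fun i =>
    hν.comp_continuous continuous_subtype_val
  have hKi : ∀ i, CompactSpace (K i) := fun i => isCompact_iff_compactSpace.1 (hK i)
  refine ⟨ι' × List ι × ℕ, fun p => Subtype.val '' E p, ?_, fun p => ?_, fun p => ?_, ?_⟩
  · have hl : Cardinal.mk (List ι) ≤ κ := (Cardinal.mk_list_le_max ι).trans (max_le hκ hι)
    simp only [Cardinal.mk_prod, Cardinal.lift_id, Cardinal.lift_uzero, Cardinal.mk_nat,
      Cardinal.lift_aleph0]
    exact Cardinal.mul_le_of_le hκ hι' (Cardinal.mul_le_of_le hκ hl hκ)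
  · exact (((hcont p.1).isClosed_support_subset_card_lt (hC p.2.1).1 p.2.2).isCompact.image
      continuous_subtype_val).isClosed
  · obtain ⟨N, hN⟩ := (hC p.2.1).2
    obtain ⟨M, hM⟩ := (hcont p.1).exists_coverOrderLE (hνinj.comp Subtype.val_injective)
      (hC p.2.1).1 hN p.2.2
    refine CoverOrderLE.finiteDim_iff.2 ⟨M, (CoverOrderLE.image_iff .subtypeVal).1 ?_⟩
    rw [image_univ, Subtype.range_coe]
    exact (CoverOrderLE.image_iff .subtypeVal).2 hM
  · refine eq_univ_of_forall fun y => ?_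
    obtain ⟨i, hi⟩ := mem_iUnion.1 (hKY.ge (mem_univ y))
    have hcov : ∀ z : (ν y).support, ∃ j, (z : StoneCech X) ∈ β '' P j := fun z => by
      obtain ⟨x, hx⟩ := hνsupp y z.2
      obtain ⟨j, hj⟩ := hPX x
      exact ⟨j, x, hj, hx⟩
    choose g hg using hcov
    refine mem_iUnion.2 ⟨(i, (ν y).support.attach.toList.map g, (ν y).support.card + 1),
      ⟨y, hi⟩, ⟨fun z hz => ?_, Nat.lt_succ_self _⟩, rfl⟩
    exact mem_iUnion₂.2 ⟨g ⟨z, hz⟩, List.mem_map.2 ⟨⟨z, hz⟩, by simp, rfl⟩, hg ⟨z, hz⟩⟩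
end

section
/- Let X and Y be σ-compact Tychonoff spaces with X normal and finite dimensional, and suppose there exists a continuous linear map T : C_p(X) → C_p(Y) whose image is dense in C_p(Y) and a natural number p such that |supp_T(y)| ≤ p for every y ∈ Y. Then Y is normal and dim(Y) ≤ p·dim(X) + p + p! − 1. -/
universe u

open Set Filter Topology
open scoped BoundedContinuousFunction Uniformity

/-- Swelling: a finite closed family inside an open family in a normal space enlarges to an open
family with the same multiplicity bound. -/
theorem exists_open_swelling {Y ι : Type*} [TopologicalSpace Y] [NormalSpace Y] [Finite ι]
    (k : ℕ) (C W : ι → Set Y) (hC : ∀ i, IsClosed (C i)) (hW : ∀ i, IsOpen (W i))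
    (hCW : ∀ i, C i ⊆ W i) (hk : ∀ x, {i | x ∈ C i}.ncard ≤ k) :
    ∃ V : ι → Set Y, (∀ i, IsOpen (V i)) ∧ (∀ i, C i ⊆ V i) ∧ (∀ i, V i ⊆ W i) ∧
      ∀ x, {i | x ∈ V i}.ncard ≤ k := by
  have key : ∀ S : Set ι, ∃ v : ι → Set Y, (∀ i, IsClosed (v i)) ∧ (∀ i, v i ⊆ (C i)ᶜ) ∧
      (k < S.ncard → ∀ x, ∃ i ∈ S, x ∈ v i) := by
    intro S
    by_cases hS : k < S.ncard
    · obtain ⟨v, hv, hvc, hvs⟩ := exists_iUnion_eq_closed_subset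
        (u := fun i => {x | i ∈ S ∧ x ∉ C i})
        (fun i => by
          by_cases hi : i ∈ S
          · simpa [hi] using (show IsOpen {x | x ∉ C i} from (hC i).isOpen_compl)
          · simp [hi])
        (fun x => Set.toFinite _)
        (by
          refine eq_univ_of_forall fun x => ?_
          by_contra hx
          simp only [mem_iUnion, mem_ofPred_eq, not_exists, not_and, not_not] at hx
          exact absurd ((Set.ncard_le_ncard (fun i hi => hx i hi) (Set.toFinite _)).trans (hk x))
            (by simpa using hS))
      refine ⟨v, hvc, fun i x hx => (hvs i hx).2, fun _ x => ?_⟩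
      obtain ⟨i, hi⟩ := mem_iUnion.1 (hv.symm ▸ mem_univ x : x ∈ ⋃ i, v i)
      exact ⟨i, (hvs i hi).1, hi⟩
    · exact ⟨fun _ => ∅, fun _ => isClosed_empty, fun _ => empty_subset _, fun h => absurd h hS⟩
  choose v hvc hvC hv using key
  refine ⟨fun i => W i \ ⋃ S, v S i, fun i => (hW i).sdiff (isClosed_iUnion_of_finite
    fun S => hvc S i), fun i x hx => ⟨hCW i hx, ?_⟩, fun i => sdiff_subset, fun x => ?_⟩
  · simp only [mem_iUnion, not_exists]
    exact fun S hxS => hvC S i hxS hx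
  · by_contra! h
    obtain ⟨i, hi, hxi⟩ := hv _ h x
    exact hi.2 (mem_iUnion.2 ⟨_, hxi⟩)

/-- Countable sum theorem, for covers indexed by a fixed finite type. -/
theorem exists_refinement_of_countable_union {Y ι : Type*} [TopologicalSpace Y] [NormalSpace Y]
    [Finite ι] (k : ℕ) (F : ℕ → Set Y) (hFc : ∀ m, IsClosed (F m)) (hFU : ⋃ m, F m = univ)
    (hF : ∀ (m : ℕ) (W : ι → Set Y), (∀ i, IsOpen (W i)) → ⋃ i, W i = univ →
      ∃ O : ι → Set Y, (∀ i, IsOpen (O i)) ∧ (∀ i, O i ⊆ W i) ∧ F m ⊆ ⋃ i, O i ∧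
        ∀ x ∈ F m, {i | x ∈ O i}.ncard ≤ k)
    (W : ι → Set Y) (hW : ∀ i, IsOpen (W i)) (hWU : ⋃ i, W i = univ) :
    ∃ V : ι → Set Y, (∀ i, IsOpen (V i)) ∧ (∀ i, V i ⊆ W i) ∧ ⋃ i, V i = univ ∧
      ∀ x, {i | x ∈ V i}.ncard ≤ k := by
  let Cov := {W : ι → Set Y // (∀ i, IsOpen (W i)) ∧ ⋃ i, W i = univ}
  have step : ∀ (m : ℕ) (W : Cov), ∃ V : Cov, (∀ i, closure (V.1 i) ⊆ W.1 i) ∧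
      ∀ x ∈ F m, {i | x ∈ closure (V.1 i)}.ncard ≤ k := by
    rintro m ⟨W, hW, hWU⟩
    obtain ⟨O, hO, hOW, hFO, hk⟩ := hF m W hW hWU
    obtain ⟨V, hVU, hV, hVO⟩ := exists_iUnion_eq_closure_subset
      (u := fun i => O i ∪ (W i \ F m)) (fun i => (hO i).union ((hW i).sdiff (hFc m)))
      (fun x => Set.toFinite _)
      (by
        refine eq_univ_of_forall fun x => ?_
        by_cases hx : x ∈ F m
        · obtain ⟨i, hi⟩ := mem_iUnion.1 (hFO hx)
          exact mem_iUnion.2 ⟨i, Or.inl hi⟩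
        · obtain ⟨i, hi⟩ := mem_iUnion.1 (hWU.symm ▸ mem_univ x : x ∈ ⋃ i, W i)
          exact mem_iUnion.2 ⟨i, Or.inr ⟨hi, hx⟩⟩)
    refine ⟨⟨V, hV, hVU⟩, fun i x hx => (hVO i hx).elim (fun h => hOW i h) (fun h => h.1),
      fun x hx => (Set.ncard_le_ncard (fun i hi => ?_) (Set.toFinite _)).trans (hk x hx)⟩
    exact (hVO i hi).elim id fun h => absurd hx h.2
  choose next hnext hnextk using step
  let V : ℕ → Cov := fun m => Nat.rec ⟨W, hW, hWU⟩ (fun m U => next m U) m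
  have hsucc : ∀ m i, closure ((V (m + 1)).1 i) ⊆ (V m).1 i := fun m i => hnext m (V m) i
  have hanti : ∀ i, Antitone fun m => (V m).1 i := fun i =>
    antitone_nat_of_succ_le fun m => subset_closure.trans (hsucc m i)
  obtain ⟨U, hU, hCU, hUW, hUk⟩ := exists_open_swelling k
    (fun i => ⋂ m, closure ((V m).1 i)) W (fun i => isClosed_iInter fun m => isClosed_closure) hW
    (fun i x hx => hsucc 0 i (mem_iInter.1 hx 1))
    (fun x => by
      obtain ⟨m, hm⟩ := mem_iUnion.1 (hFU.symm ▸ mem_univ x : x ∈ ⋃ m, F m)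
      refine le_trans (Set.ncard_le_ncard (fun i hi => ?_) (Set.toFinite _)) (hnextk m (V m) x hm)
      exact mem_iInter.1 hi (m + 1))
  refine ⟨U, hU, hUW, eq_univ_of_forall fun x => ?_, hUk⟩
  by_contra hx
  have hx' : ∀ i, ∃ m, x ∉ closure ((V m).1 i) := by
    intro i
    by_contra! h
    exact hx (mem_iUnion.2 ⟨i, hCU i (mem_iInter.2 h)⟩)
  choose m hm using hx'
  obtain ⟨M, hM⟩ := (Set.finite_range m).bddAbove
  obtain ⟨i, hi⟩ := mem_iUnion.1 ((V M).2.2.symm ▸ mem_univ x : x ∈ ⋃ i, (V M).1 i)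
  exact hm i (subset_closure (hanti i (hM ⟨i, rfl⟩) hi))

/-- A separating family of continuous functions on a compact set distinguishes points up to a given
open cover by finitely many functions and a positive tolerance. -/
theorem exists_finset_lebesgue {Y E ι : Type*} [TopologicalSpace Y] (e : E → Y → ℝ)
    (hcont : ∀ f, Continuous (e f)) (hsep : ∀ y y', y ≠ y' → ∃ f, e f y ≠ e f y')
    {K : Set Y} (hK : IsCompact K) (W : ι → Set Y) (hW : ∀ i, IsOpen (W i))
    (hKW : K ⊆ ⋃ i, W i) :
    ∃ (F : Finset E) (δ : ℝ), 0 < δ ∧ ∀ y ∈ K, ∃ i, ∀ y' ∈ K,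
      (∀ f ∈ F, |e f y' - e f y| < δ) → y' ∈ W i := by
  classical
  let Φ : Y → E → ℝ := fun y f => e f y
  have hΦ : Continuous Φ := continuous_pi hcont
  have hinj : ∀ y y', Φ y = Φ y' → y = y' := by
    intro y y' h
    by_contra hne
    obtain ⟨f, hf⟩ := hsep y y' hne
    exact hf (congrFun h f)
  obtain ⟨V, hV, hball⟩ := lebesgue_number_lemma (hK.image hΦ)
    (U := fun i => (Φ '' (K \ W i))ᶜ)
    (fun i => ((hK.diff (hW i)).image hΦ).isClosed.isOpen_compl)
    (by
      rintro _ ⟨y, hy, rfl⟩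
      obtain ⟨i, hi⟩ := mem_iUnion.1 (hKW hy)
      refine mem_iUnion.2 ⟨i, ?_⟩
      rintro ⟨y', hy', h⟩
      exact hy'.2 (hinj _ _ h ▸ hi))
  rw [Pi.uniformity] at hV
  obtain ⟨⟨I, r⟩, ⟨hI, hr⟩, hIV⟩ := (Filter.HasBasis.iInf' fun i : E =>
    (Metric.uniformity_basis_dist (α := ℝ)).comap
      (fun a : (E → ℝ) × (E → ℝ) => (a.1 i, a.2 i))).mem_iff.1 hV
  obtain ⟨δ, hδ, hδr⟩ : ∃ δ : ℝ, 0 < δ ∧ ∀ f ∈ hI.toFinset, δ ≤ r f := by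
    have : ∀ F : Finset E, (∀ f ∈ F, 0 < r f) → ∃ δ : ℝ, 0 < δ ∧ ∀ f ∈ F, δ ≤ r f := by
      intro F
      induction F using Finset.induction_on with
      | empty => exact fun _ => ⟨1, one_pos, by simp⟩
      | insert a s _ ih =>
        intro h
        obtain ⟨δ, h0, h1⟩ := ih fun f hf => h f (Finset.mem_insert_of_mem hf)
        refine ⟨min δ (r a), lt_min h0 (h a (Finset.mem_insert_self _ _)), fun f hf => ?_⟩
        rcases Finset.mem_insert.1 hf with rfl | hf
        · exact min_le_right _ _
        · exact (min_le_left _ _).trans (h1 f hf)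
    exact this _ fun f hf => hr f (hI.mem_toFinset.1 hf)
  refine ⟨hI.toFinset, δ, hδ, fun y hy => ?_⟩
  obtain ⟨i, hi⟩ := hball (Φ y) ⟨y, hy, rfl⟩
  refine ⟨i, fun y' hy' h => ?_⟩
  by_contra hyW
  refine hi (?_ : Φ y' ∈ UniformSpace.ball (Φ y) V) ⟨y', ⟨hy', hyW⟩, rfl⟩
  refine hIV (?_ : (Φ y, Φ y') ∈ _)
  simp only [mem_iInter, mem_preimage, mem_ofPred_eq]
  intro f hf
  rw [Real.dist_eq, abs_sub_comm]
  exact (h f (hI.mem_toFinset.2 hf)).trans_le (hδr f (hI.mem_toFinset.2 hf))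

/-- Among `d + 1` suitably translated lattice cube families, one covers a given vector with at most
`d` nonzero coordinates. -/
theorem exists_offset_avoiding_integers (d : ℕ) {κ : Type*} [Finite κ] (z : κ → ℝ)
    (hz : {j | z j ≠ 0}.ncard ≤ d) :
    ∃ c : Fin (d + 1), ∀ (j : κ) (m : ℤ), z j - ((c : ℕ) + 1 : ℝ) / (d + 2) ≠ m := by
  by_contra! h
  choose j m hm using h
  have hd : (0 : ℝ) < d + 2 := by positivity
  have hne : ∀ c, z (j c) ≠ 0 := by
    intro c hc
    have h1 := hm c
    rw [hc, zero_sub, neg_eq_iff_eq_neg, div_eq_iff hd.ne'] at h1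
    have h2 : ((c : ℕ) + 1 : ℤ) = -m c * (d + 2) := by exact_mod_cast h1
    have hlt := c.2
    have h3 : 0 < -m c := by
      by_contra! h3
      nlinarith
    nlinarith
  have hinj : Function.Injective j := by
    intro c c' hcc
    have h1 := hm c
    have h2 := hm c'
    rw [hcc] at h1
    have h3 : ((c : ℕ) : ℝ) - (c' : ℕ) = (m c' - m c) * (d + 2) := by
      rw [← h1, ← h2]
      field_simp
      ring
    have h4 : ((c : ℕ) : ℤ) - (c' : ℕ) = (m c' - m c) * (d + 2) := by exact_mod_cast h3
    have hlt := c.2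
    have hlt' := c'.2
    have h5 : m c' - m c < 1 := by
      by_contra! h5
      nlinarith
    have h6 : -1 < m c' - m c := by
      by_contra! h6
      nlinarith
    have h7 : m c' - m c = 0 := by omega
    rw [h7, zero_mul] at h4
    exact Fin.ext (by omega)
  have h1 : (range j).ncard ≤ {j | z j ≠ 0}.ncard :=
    Set.ncard_le_ncard (by rintro _ ⟨c, rfl⟩; exact hne c) (Set.toFinite _)
  rw [← Set.image_univ, Set.ncard_image_of_injective _ hinj, Set.ncard_univ,
    Nat.card_eq_fintype_card, Fintype.card_fin] at h1
  omega

/-- On a normal space of covering dimension at most `n`, finitely many bounded continuous functions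
are uniformly approximated from the span of a finite family of multiplicity at most `n + 1`. -/
theorem CovDimLE.exists_approx {X : Type*} [TopologicalSpace X] [NormalSpace X] {n : ℕ}
    (hn : CovDimLE X n) (F : Finset (X →ᵇ ℝ)) {ε : ℝ} (hε : 0 < ε) :
    ∃ (𝒱 : Finset (Set X)) (g : 𝒱 → (X →ᵇ ℝ)) (c : (X →ᵇ ℝ) → 𝒱 → ℝ),
      (∀ x, {j | g j x ≠ 0}.ncard ≤ n + 1) ∧ ∀ f ∈ F, ‖f - ∑ j, c f j • g j‖ ≤ ε := by
  classical
  let Φ : X → F → ℝ := fun x f => f.1 x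
  have hΦ : Continuous Φ := continuous_pi fun f => f.1.continuous
  have hbdd : TotallyBounded (range Φ) := by
    have hb : Bornology.IsBounded (range Φ) := by
      refine Bornology.forall_isBounded_image_eval_iff.1 fun f => ?_
      rw [← Set.range_comp]
      exact f.1.isBounded_range
    exact hb.isCompact_closure.totallyBounded.subset subset_closure
  obtain ⟨t, ht, htU⟩ := Metric.totallyBounded_iff.1 hbdd ε hε
  obtain ⟨𝒱, h𝒱, hopen, hU, href, hord⟩ := hn ((fun z => Φ ⁻¹' Metric.ball z ε) '' t) (ht.image _)
    (by
      rintro _ ⟨z, -, rfl⟩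
      exact Metric.isOpen_ball.preimage hΦ)
    (by
      refine eq_univ_of_forall fun x => ?_
      obtain ⟨z, hz, hxz⟩ := mem_iUnion₂.1 (htU ⟨x, rfl⟩)
      exact ⟨_, ⟨z, hz, rfl⟩, hxz⟩)
  lift 𝒱 to Finset (Set X) using h𝒱
  have hcenter : ∀ v : 𝒱, ∃ z : F → ℝ, ∀ x ∈ v.1, dist (Φ x) z < ε := by
    intro v
    obtain ⟨_, ⟨z, -, rfl⟩, hv⟩ := href v.1 v.2
    exact ⟨z, fun x hx => hv hx⟩
  choose z hz using hcenter
  obtain ⟨ρ, hρ⟩ := PartitionOfUnity.exists_isSubordinate_of_locallyFinite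
    (isClosed_univ (X := X)) (fun v : 𝒱 => v.1) (fun v => hopen v.1 v.2)
    (locallyFinite_of_finite _)
    (by
      intro x _
      obtain ⟨v, hv, hx⟩ := (hU.symm ▸ mem_univ x : x ∈ ⋃₀ (𝒱 : Set (Set X)))
      exact mem_iUnion.2 ⟨⟨v, hv⟩, hx⟩)
  have hmem : ∀ j x, ρ j x ≠ 0 → x ∈ j.1 := fun j x h => hρ j (subset_tsupport _ h)
  have hsum : ∀ x, ∑ j, ρ j x = 1 := fun x => by
    rw [← finsum_eq_sum_of_fintype]
    exact ρ.sum_eq_one (mem_univ x)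
  refine ⟨𝒱, fun j => BoundedContinuousFunction.ofNormedAddCommGroup (ρ j) (ρ j).continuous 1
    (fun x => by rw [Real.norm_of_nonneg (ρ.nonneg j x)]; exact ρ.le_one j x),
    fun f j => if h : f ∈ F then z j ⟨f, h⟩ else 0, fun x => ?_, fun f hf => ?_⟩
  · have h1 : ({j : 𝒱 | ρ j x ≠ 0} : Set 𝒱).ncard ≤ {v ∈ (𝒱 : Set (Set X)) | x ∈ v}.ncard := by
      rw [← Set.ncard_image_of_injective _ (Subtype.val_injective (p := (· ∈ 𝒱)))]
      refine Set.ncard_le_ncard ?_ (𝒱.finite_toSet.subset fun v hv => hv.1)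
      rintro _ ⟨j, hj, rfl⟩
      exact ⟨j.2, hmem j x hj⟩
    have h2 := hord x
    exact h1.trans (by exact_mod_cast h2)
  · refine (BoundedContinuousFunction.norm_le hε.le).2 fun x => ?_
    have hx : (f - ∑ j, (if h : f ∈ F then z j ⟨f, h⟩ else 0) •
        BoundedContinuousFunction.ofNormedAddCommGroup (ρ j) (ρ j).continuous 1
        (fun x => by rw [Real.norm_of_nonneg (ρ.nonneg j x)]; exact ρ.le_one j x)) x
        = ∑ j, ρ j x * (f x - z j ⟨f, hf⟩) := by
      simp only [mul_sub, Finset.sum_sub_distrib, ← Finset.sum_mul, hsum, one_mul, hf]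
      simp [mul_comm]
    rw [hx]
    calc ‖∑ j, ρ j x * (f x - z j ⟨f, hf⟩)‖ ≤ ∑ j, ρ j x * ε := by
          refine (norm_sum_le _ _).trans (Finset.sum_le_sum fun j _ => ?_)
          rw [norm_mul, Real.norm_of_nonneg (ρ.nonneg j x)]
          by_cases h0 : ρ j x = 0
          · simp [h0]
          · refine mul_le_mul_of_nonneg_left ?_ (ρ.nonneg j x)
            exact (dist_le_pi_dist (Φ x) (z j) ⟨f, hf⟩).trans (hz j x (hmem j x h0)).le
      _ = ε := by rw [← Finset.sum_mul, hsum, one_mul]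

/-- A compact set whose points are represented, continuously and injectively, by functionals with at
most `p` support points in a normal space of dimension at most `n` admits open refinements of
multiplicity at most `p * (n + 1) + 1`. -/
theorem CovDimLE.exists_refinement_on_compact {X Y ι : Type*} [TopologicalSpace X] [NormalSpace X]
    [TopologicalSpace Y] [Finite ι] {n : ℕ} (hn : CovDimLE X n) (φ : Y → (X →ᵇ ℝ) →L[ℝ] ℝ)
    (hcont : ∀ f, Continuous fun y => φ y f) (hsep : ∀ y y', y ≠ y' → ∃ f, φ y f ≠ φ y' f)
    {p : ℕ} (hsupp : ∀ y, ∃ (x : Fin p → X) (a : Fin p → ℝ), ∀ f, φ y f = ∑ i, a i * f (x i))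
    {K : Set Y} (hK : IsCompact K) (W : ι → Set Y) (hW : ∀ i, IsOpen (W i))
    (hKW : K ⊆ ⋃ i, W i) :
    ∃ O : ι → Set Y, (∀ i, IsOpen (O i)) ∧ (∀ i, O i ⊆ W i) ∧ K ⊆ ⋃ i, O i ∧
      ∀ y, {i | y ∈ O i}.ncard ≤ p * (n + 1) + 1 := by
  classical
  rcases isEmpty_or_nonempty ι with hι | hι
  · exact ⟨W, hW, fun i => Subset.rfl, hKW, fun y => by simp [Set.eq_empty_of_isEmpty]⟩
  obtain ⟨F, δ, hδ, hF⟩ := exists_finset_lebesgue (fun f y => φ y f) hcont hsep hK W hW hKW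
  obtain ⟨C, hC⟩ : ∃ C, ∀ y : K, ‖φ y‖ ≤ C := by
    refine banach_steinhaus fun f => ?_
    obtain ⟨C, hC⟩ := hK.exists_bound_of_continuousOn (hcont f).continuousOn
    exact ⟨C, fun y => hC y y.2⟩
  obtain ⟨𝒱, g, c, hg, hc⟩ := hn.exists_approx F (ε := δ / (4 * (|C| + 1))) (by positivity)
  have herr : ∀ y ∈ K, ∀ f ∈ F, |φ y f - ∑ j, c f j * φ y (g j)| ≤ δ / 4 := by
    intro y hy f hf
    have h1 : φ y f - ∑ j, c f j * φ y (g j) = φ y (f - ∑ j, c f j • g j) := by simp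
    rw [h1]
    calc |φ y (f - ∑ j, c f j • g j)| ≤ ‖φ y‖ * ‖f - ∑ j, c f j • g j‖ := (φ y).le_opNorm _
      _ ≤ (|C| + 1) * (δ / (4 * (|C| + 1))) := by
          refine mul_le_mul ?_ (hc f hf) (norm_nonneg _) (by positivity)
          linarith [hC ⟨y, hy⟩, le_abs_self C]
      _ = δ / 4 := by field_simp
  let B : ℝ := ∑ f ∈ F, ∑ j, |c f j|
  have hB : 0 ≤ B := Finset.sum_nonneg fun f _ => Finset.sum_nonneg fun j _ => abs_nonneg _
  let η : ℝ := δ / (4 * (B + 1))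
  have hη : 0 < η := by positivity
  let h : Y → 𝒱 → ℝ := fun y j => φ y (g j) / η
  have hh : Continuous h := continuous_pi fun j => (hcont (g j)).div_const η
  let d := p * (n + 1)
  have hnz : ∀ y, {j | h y j ≠ 0}.ncard ≤ d := by
    intro y
    obtain ⟨x, a, hxa⟩ := hsupp y
    have h1 : {j | h y j ≠ 0} ⊆ ⋃ i, {j | g j (x i) ≠ 0} := by
      intro j hj
      by_contra hcon
      simp only [mem_iUnion, mem_ofPred_eq, not_exists, not_not] at hcon
      exact hj (by simp [h, hxa, hcon])
    calc {j | h y j ≠ 0}.ncard ≤ (⋃ i, {j | g j (x i) ≠ 0}).ncard :=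
          Set.ncard_le_ncard h1 (Set.toFinite _)
      _ ≤ ∑ i, {j | g j (x i) ≠ 0}.ncard := Set.ncard_iUnion_le_of_fintype _
      _ ≤ ∑ _i : Fin p, (n + 1) := Finset.sum_le_sum fun i _ => hg (x i)
      _ = d := by simp [d]
  let θ : Fin (d + 1) → ℝ := fun s => ((s : ℕ) + 1 : ℝ) / (d + 2)
  let cell : Fin (d + 1) → (𝒱 → ℤ) → Set (𝒱 → ℝ) := fun s q =>
    {u | ∀ j, u j - θ s ∈ Ioo (q j : ℝ) (q j + 1)}
  have hcell : ∀ s q, IsOpen (cell s q) := by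
    intro s q
    have : cell s q = ⋂ j, (fun u : 𝒱 → ℝ => u j - θ s) ⁻¹' Ioo (q j : ℝ) (q j + 1) := by
      ext u
      simp [cell]
    rw [this]
    exact isOpen_iInter_of_finite fun j => isOpen_Ioo.preimage (by fun_prop)
  have hsmall : ∀ s q, ∃ i, ∀ y ∈ K, h y ∈ cell s q → y ∈ W i := by
    intro s q
    by_cases hex : ∃ y ∈ K, h y ∈ cell s q
    · obtain ⟨y, hy, hyc⟩ := hex
      obtain ⟨i, hi⟩ := hF y hy
      refine ⟨i, fun y' hy' hyc' => hi y' hy' fun f hf => ?_⟩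
      have hdiff : ∀ j, |φ y' (g j) - φ y (g j)| ≤ η := by
        intro j
        have h1 := hyc j
        have h2 := hyc' j
        have h3 : |h y' j - h y j| ≤ 1 := by
          rw [abs_le]
          constructor <;> linarith [h1.1, h1.2, h2.1, h2.2]
        rwa [← sub_div, abs_div, abs_of_pos hη, div_le_one hη] at h3
      have hmid : |∑ j, c f j * φ y' (g j) - ∑ j, c f j * φ y (g j)| ≤ δ / 4 := by
        rw [← Finset.sum_sub_distrib]
        calc |∑ j, (c f j * φ y' (g j) - c f j * φ y (g j))| ≤ ∑ j, |c f j| * η := by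
              refine (Finset.abs_sum_le_sum_abs _ _).trans (Finset.sum_le_sum fun j _ => ?_)
              rw [← mul_sub, abs_mul]
              exact mul_le_mul_of_nonneg_left (hdiff j) (abs_nonneg _)
          _ = (∑ j, |c f j|) * η := by rw [Finset.sum_mul]
          _ ≤ (B + 1) * η := by
              refine mul_le_mul_of_nonneg_right ?_ hη.le
              have : ∑ j, |c f j| ≤ B := Finset.single_le_sum (f := fun f => ∑ j, |c f j|)
                (fun f _ => Finset.sum_nonneg fun j _ => abs_nonneg _) hf
              linarith
          _ = δ / 4 := by
              simp only [η]
              field_simp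
      have e1 := abs_le.1 (herr y hy f hf)
      have e2 := abs_le.1 (herr y' hy' f hf)
      have e3 := abs_le.1 hmid
      rw [abs_lt]
      constructor <;> linarith [e1.1, e1.2, e2.1, e2.2, e3.1, e3.2]
    · push Not at hex
      exact ⟨Classical.arbitrary ι, fun y hy hyc => absurd hyc (hex y hy)⟩
  choose J hJ using hsmall
  refine ⟨fun i => W i ∩ ⋃ (s) (q) (_ : J s q = i), h ⁻¹' cell s q, fun i => ?_,
    fun i => inter_subset_left, fun y hy => ?_, fun y => ?_⟩
  · exact (hW i).inter (isOpen_iUnion fun s => isOpen_iUnion fun q => isOpen_iUnion fun _ =>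
      (hcell s q).preimage hh)
  · obtain ⟨s, hs⟩ := exists_offset_avoiding_integers d (h y) (hnz y)
    have hmem : h y ∈ cell s fun j => ⌊h y j - θ s⌋ := fun j =>
      ⟨(Int.floor_le _).lt_of_ne (hs j _).symm, Int.lt_floor_add_one _⟩
    exact mem_iUnion.2 ⟨_, hJ s _ y hy hmem, mem_iUnion.2 ⟨s, mem_iUnion.2 ⟨_,
      mem_iUnion.2 ⟨rfl, hmem⟩⟩⟩⟩
  · have hsub : {i | y ∈ W i ∩ ⋃ (s) (q) (_ : J s q = i), h ⁻¹' cell s q} ⊆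
        (fun s => J s fun j => ⌊h y j - θ s⌋) '' univ := by
      rintro i ⟨-, hi⟩
      simp only [mem_iUnion] at hi
      obtain ⟨s, q, rfl, hq⟩ := hi
      refine ⟨s, mem_univ _, ?_⟩
      have : (fun j => ⌊h y j - θ s⌋) = q :=
        funext fun j => Int.floor_eq_iff.2 ⟨(hq j).1.le, (hq j).2⟩
      exact congrArg (J s) this
    refine (Set.ncard_le_ncard hsub (Set.toFinite _)).trans ((Set.ncard_image_le).trans ?_)
    simp [d, Set.ncard_univ]

/-- Evaluation of `T` at `y`, as a continuous functional on bounded continuous functions. -/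
theorem exists_boundedFunctional {X Y : Type*} [TopologicalSpace X] [TopologicalSpace Y]
    (T : Cp X →ₗ[ℝ] Cp Y) {p : ℕ} (y : Y)
    (hsupp : ∃ (x : Fin p → X) (a : Fin p → ℝ),
      ∀ f : Cp X, (T f : Y → ℝ) y = ∑ i, a i * (f : X → ℝ) (x i)) :
    ∃ φ : (X →ᵇ ℝ) →L[ℝ] ℝ, ∀ f : X →ᵇ ℝ, φ f = (T ⟨f, f.continuous⟩ : Y → ℝ) y := by
  obtain ⟨x, a, h⟩ := hsupp
  exact ⟨∑ i, a i • BoundedContinuousFunction.evalCLM ℝ (x i), fun f => by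
    simp [h]⟩

/-- If `T` has dense range and finitely supported functionals, images of bounded functions separate
points. -/
theorem exists_bounded_separating {X Y : Type*} [TopologicalSpace X] [TopologicalSpace Y]
    [T2Space Y] [CompletelyRegularSpace Y] (T : Cp X →ₗ[ℝ] Cp Y) (hT : DenseRange T) {p : ℕ}
    (hsupp : ∀ y : Y, ∃ (x : Fin p → X) (a : Fin p → ℝ),
      ∀ f : Cp X, (T f : Y → ℝ) y = ∑ i, a i * (f : X → ℝ) (x i))
    {y y' : Y} (hne : y ≠ y') :
    ∃ f : X →ᵇ ℝ, (T ⟨f, f.continuous⟩ : Y → ℝ) y ≠ (T ⟨f, f.continuous⟩ : Y → ℝ) y' := by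
  by_contra! hb
  have hall : ∀ f : Cp X, (T f : Y → ℝ) y = (T f : Y → ℝ) y' := by
    rintro ⟨f, hf⟩
    obtain ⟨x, a, hx⟩ := hsupp y
    obtain ⟨x', a', hx'⟩ := hsupp y'
    obtain ⟨c, hc⟩ := ((Set.finite_range fun i => |f (x i)|).union
      (Set.finite_range fun i => |f (x' i)|)).bddAbove
    have hf' : Continuous fun t => max (-|c|) (min |c| (f t)) :=
      continuous_const.max (continuous_const.min hf)
    have hfix : ∀ t, |f t| ≤ c → max (-|c|) (min |c| (f t)) = f t := by
      intro t ht
      have := abs_le.1 (ht.trans (le_abs_self c))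
      rw [min_eq_right this.2, max_eq_right this.1]
    have hbd := hb (BoundedContinuousFunction.ofNormedAddCommGroup _ hf' |c| fun t => by
      rw [Real.norm_eq_abs, abs_le]
      exact ⟨le_max_left _ _, max_le (by linarith [abs_nonneg c]) (min_le_left _ _)⟩)
    rw [hx, hx'] at hbd ⊢
    convert hbd using 3 with i _ i _
    · exact (hfix _ (hc (Or.inl ⟨i, rfl⟩))).symm
    · exact (hfix _ (hc (Or.inr ⟨i, rfl⟩))).symm
  have heval : ∀ t : Y, Continuous fun g : Cp Y => (g : Y → ℝ) t := fun t =>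
    (continuous_apply t).comp continuous_subtype_val
  have hextend : ∀ g : Cp Y, (g : Y → ℝ) y = (g : Y → ℝ) y' := fun g =>
    hT.induction_on (p := fun g : Cp Y => (g : Y → ℝ) y = (g : Y → ℝ) y') g
      (isClosed_eq (heval y) (heval y')) hall
  obtain ⟨f, hf, hf0, hf1⟩ := CompletelyRegularSpace.completely_regular y {y'}
    isClosed_singleton hne
  have h1 := hextend ⟨fun t => (f t : ℝ), continuous_subtype_val.comp hf⟩
  have h2 : f y' = 1 := hf1 rfl
  simp [hf0, h2] at h1

/-- Let `X` and `Y` be σ-compact Tychonoff spaces, `X` normal with `dim X ≤ n`. Suppose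
there is a continuous linear map `T : C_p(X) → C_p(Y)` with dense image such that, for
every `y ∈ Y`, the functional `f ↦ T(f)(y)` admits a representation
`f ↦ a₁ f(x₁) + ⋯ + a_p f(x_p)` with at most `p` terms (i.e. `|supp_T(y)| ≤ p`).
Then `Y` is normal and `dim Y ≤ p · dim X + p + p! - 1`. -/
theorem stmt3 (X Y : Type u)
    [TopologicalSpace X] [T2Space X] [CompletelyRegularSpace X] [NormalSpace X]
    [SigmaCompactSpace X]
    [TopologicalSpace Y] [T2Space Y] [CompletelyRegularSpace Y] [SigmaCompactSpace Y]
    (hfd : FiniteDim X)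
    (T : Cp X →ₗ[ℝ] Cp Y) (hTcont : Continuous T) (hTdense : DenseRange T)
    (p : ℕ)
    (hsupp : ∀ y : Y, ∃ (x : Fin p → X) (a : Fin p → ℝ),
      ∀ f : Cp X, (T f : Y → ℝ) y = ∑ i, a i * (f : X → ℝ) (x i))
    (n : ℕ) (hn : CovDimLE X n) :
    NormalSpace Y ∧ CovDimLE Y ((p : ℤ) * n + p + (Nat.factorial p : ℤ) - 1) := by
  have hnormal : NormalSpace Y := NormalSpace.of_regularSpace_lindelofSpace
  refine ⟨hnormal, fun 𝒰 h𝒰 hopen hU => ?_⟩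
  have : Finite 𝒰 := h𝒰
  choose φ hφ using fun y => exists_boundedFunctional T y (hsupp y)
  have hcont : ∀ f, Continuous fun y => φ y f := fun f => by
    simp only [hφ]
    exact (T ⟨f, f.continuous⟩).2
  obtain ⟨V, hV, hVU, hVcov, hVk⟩ := exists_refinement_of_countable_union (p * (n + 1) + 1)
    (compactCovering Y) (fun m => (isCompact_compactCovering Y m).isClosed)
    (iUnion_compactCovering Y)
    (fun m W hW hWU => by
      obtain ⟨O, hO, hOW, hKO, hk⟩ := hn.exists_refinement_on_compact φ hcont
        (fun y y' hne => by
          simpa only [hφ] using exists_bounded_separating T hTdense hsupp hne)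
        (fun y => by
          obtain ⟨x, a, hx⟩ := hsupp y
          exact ⟨x, a, fun f => by rw [hφ, hx]⟩)
        (isCompact_compactCovering Y m) W hW (hWU.symm ▸ subset_univ _)
      exact ⟨O, hO, hOW, hKO, fun y _ => hk y⟩)
    (fun u : 𝒰 => u.1) (fun u => hopen u.1 u.2) (by rw [← sUnion_eq_iUnion, hU])
  refine ⟨range V, Set.finite_range V, ?_, by rw [sUnion_range, hVcov], ?_, fun y => ?_⟩
  · rintro _ ⟨i, rfl⟩
    exact hV i
  · rintro _ ⟨i, rfl⟩
    exact ⟨i.1, i.2, hVU i⟩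
  · have h1 : {v ∈ range V | y ∈ v}.ncard ≤ p * (n + 1) + 1 := by
      refine le_trans ?_ ((Set.ncard_image_le (f := V) (Set.toFinite {i | y ∈ V i})).trans (hVk y))
      refine Set.ncard_le_ncard ?_ (Set.toFinite _)
      rintro _ ⟨⟨i, rfl⟩, hy⟩
      exact ⟨i, hy, rfl⟩
    have h2 : ({v ∈ range V | y ∈ v}.ncard : ℤ) ≤ p * (n + 1) + 1 := by exact_mod_cast h1
    have h3 : (1 : ℤ) ≤ Nat.factorial p := by exact_mod_cast Nat.factorial_pos p
    linarith
end

section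
/- Let K and L be compact Hausdorff spaces. Assume there exists a linear map T : C_p(K) → C_p(L) which is a homeomorphism onto its image and whose image is closed in C_p(L). If L is Eberlein compact, then K is Eberlein compact as well. -/
universe u

/-- A space is Eberlein compact if it is a compact Hausdorff space homeomorphic to a
subspace of `c₀(Γ) = {x ∈ ℝ^Γ : ∀ ε > 0, {γ : ε ≤ |x γ|} is finite}` (with the topology
of pointwise convergence) for some index set `Γ`. -/
def IsEberleinCompact (K : Type u) [TopologicalSpace K] : Prop :=
  CompactSpace K ∧ T2Space K ∧
    ∃ (Γ : Type u) (f : K → Γ → ℝ),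
      Topology.IsEmbedding f ∧ ∀ k, ∀ ε > (0 : ℝ), {γ | ε ≤ |f k γ|}.Finite

open Set Filter Topology Cardinal

namespace EberleinCompact

section ClosedUnder

variable {Γ : Type u}

/-- `A` is closed under the set-valued finitary operation `h`. -/
def ClosedUnder (h : Finset Γ → Set Γ) (A : Set Γ) : Prop :=
  ∀ F : Finset Γ, (F : Set Γ) ⊆ A → h F ⊆ A

/-- The smallest superset of `S` closed under `h`. -/
def closureUnder (h : Finset Γ → Set Γ) (S : Set Γ) : Set Γ :=
  ⋂₀ {A | ClosedUnder h A ∧ S ⊆ A}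

variable {h : Finset Γ → Set Γ}

lemma closedUnder_closureUnder (S : Set Γ) : ClosedUnder h (closureUnder h S) :=
  fun F hF => subset_sInter fun _ hA => hA.1 F (hF.trans (sInter_subset_of_mem hA))

lemma subset_closureUnder (S : Set Γ) : S ⊆ closureUnder h S :=
  subset_sInter fun _ hA => hA.2

lemma closureUnder_subset {S A : Set Γ} (hA : ClosedUnder h A) (hS : S ⊆ A) :
    closureUnder h S ⊆ A :=
  sInter_subset_of_mem ⟨hA, hS⟩

lemma closureUnder_mono {S S' : Set Γ} (hS : S ⊆ S') : closureUnder h S ⊆ closureUnder h S' :=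
  closureUnder_subset (closedUnder_closureUnder _) (hS.trans (subset_closureUnder _))

lemma ClosedUnder.iUnion {ι : Type*} [LinearOrder ι] [Nonempty ι] {B : ι → Set Γ}
    (hB : Monotone B) (hc : ∀ i, ClosedUnder h (B i)) : ClosedUnder h (⋃ i, B i) := by
  intro F hF
  obtain ⟨i, hi⟩ := hB.directed_le.exists_mem_subset_of_finset_subset_biUnion hF
  exact (hc i F hi).trans (subset_iUnion _ i)

lemma closureUnder_iUnion {ι : Type*} [LinearOrder ι] [Nonempty ι] {S : ι → Set Γ}
    (hS : Monotone S) : closureUnder h (⋃ i, S i) = ⋃ i, closureUnder h (S i) := by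
  refine Subset.antisymm (closureUnder_subset ?_ ?_) ?_
  · exact ClosedUnder.iUnion (fun _ _ hij => closureUnder_mono (hS hij))
      fun i => closedUnder_closureUnder _
  · exact iUnion_mono fun i => subset_closureUnder _
  · exact iUnion_subset fun i => closureUnder_mono (subset_iUnion _ i)

lemma mk_closureUnder_le (hh : ∀ F, (h F).Countable) (S : Set Γ) :
    #(closureUnder h S) ≤ max #S ℵ₀ := by
  classical
  let step : Set Γ → Set Γ := fun A => A ∪ ⋃ F : Finset A, h (F.map (Function.Embedding.subtype _))
  let B : ℕ → Set Γ := fun n => step^[n] S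
  have hsucc : ∀ n, B (n + 1) = step (B n) := fun n => Function.iterate_succ_apply' _ _ _
  have hmono : Monotone B := monotone_nat_of_le_succ fun n => by
    rw [hsucc]; exact subset_union_left
  have hcard : ∀ n, #(B n) ≤ max #S ℵ₀ := by
    intro n
    induction n with
    | zero => exact le_max_left _ _
    | succ n ih =>
      rw [hsucc]
      refine (mk_union_le _ _).trans ?_
      refine (add_le_add ih ?_).trans_eq (add_eq_self (le_max_right _ _))
      refine (mk_iUnion_le _).trans ?_
      have h1 : #(Finset (B n)) ≤ max #S ℵ₀ := by
        rcases finite_or_infinite (B n) with hf | hf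
        · exact (Cardinal.mk_le_aleph0).trans (le_max_right _ _)
        · rw [mk_finset_of_infinite]; exact ih
      have h2 : (⨆ F : Finset (B n), #(h (F.map (Function.Embedding.subtype _)))) ≤ max #S ℵ₀ :=
        ciSup_le' fun F => ((hh _).le_aleph0).trans (le_max_right _ _)
      exact (mul_le_mul' h1 h2).trans_eq (mul_eq_self (le_max_right _ _))
  have hcl : ClosedUnder h (⋃ n, B n) := by
    intro F hF
    obtain ⟨n, hn⟩ := hmono.directed_le.exists_mem_subset_of_finset_subset_biUnion hF
    refine Subset.trans ?_ (subset_iUnion B (n + 1))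
    rw [hsucc]
    refine Subset.trans ?_ subset_union_right
    refine Subset.trans ?_ (subset_iUnion _ (F.subtype (· ∈ B n)))
    rw [Finset.subtype_map_of_mem fun x hx => hn hx]
  refine (mk_le_mk_of_subset (closureUnder_subset hcl (subset_iUnion B 0))).trans ?_
  have := mk_iUnion_le_lift.{u, 0} B
  simp only [lift_uzero, mk_nat, lift_aleph0] at this
  refine this.trans ((mul_le_mul' (le_max_right #S ℵ₀) (ciSup_le' hcard)).trans_eq
    (mul_eq_self (le_max_right _ _)))

end ClosedUnder

/-- A family of continuous functions which, for every `ε`, splits into countably many pieces, on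
each of which only finitely many functions exceed `ε` at any given point. -/
def IsSigmaCZero {Y : Type*} [TopologicalSpace Y] {ι : Type*} (e : ι → C(Y, ℝ)) : Prop :=
  ∀ ε > 0, ∃ c : ι → ℕ, ∀ n y, {i | c i = n ∧ ε < |e i y|}.Finite

/-- A continuous system of retractions of `Y`, indexed by the sets closed under a finitary
operation `h` with countable values. The last condition is a smallness property of
long sequences of functions which are adapted to increasing chains of retractions. -/
structure IsRetractionSystem {Γ Y : Type u} [TopologicalSpace Y] (h : Finset Γ → Set Γ)
    (ρ : Set Γ → Y → Y) : Prop where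
  countable : ∀ F, (h F).Countable
  continuous : ∀ {A}, ClosedUnder h A → Continuous (ρ A)
  apply_apply_of_subset : ∀ {A B}, ClosedUnder h A → ClosedUnder h B → A ⊆ B →
    ∀ y, ρ A (ρ B y) = ρ A y ∧ ρ B (ρ A y) = ρ A y
  univ : ∀ y, ρ univ y = y
  tendsto : ∀ {ι : Type u} [LinearOrder ι] [Nonempty ι] (B : ι → Set Γ), Monotone B →
    (∀ i, ClosedUnder h (B i)) → ∀ y, Tendsto (fun i => ρ (B i) y) atTop (𝓝 (ρ (⋃ i, B i) y))
  exists_separating : ∀ {A}, ClosedUnder h A → A.Countable → ∃ e : ℕ → C(Y, ℝ),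
    (∀ n y, e n (ρ A y) = e n y) ∧ ∀ y y', (∀ n, e n y = e n y') → ρ A y = ρ A y'
  exists_coloring : ∀ ε > 0, ∃ c : C(Y, ℝ) → ℕ, ∀ (m : ℕ) (B : ℕ → Set Γ), Monotone B →
    (∀ k, ClosedUnder h (B k)) → ∀ e : ℕ → C(Y, ℝ), (∀ k, c (e k) = m) →
    (∀ k y, e k (ρ (B k) y) = 0) → (∀ k y, e k (ρ (B (k + 1)) y) = e k y) →
    ∀ y, ∃ k, |e k y| ≤ ε

namespace IsRetractionSystem

variable {Γ Y : Type u} [TopologicalSpace Y] {h : Finset Γ → Set Γ} {ρ : Set Γ → Y → Y}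

lemma exists_family_of_countable (hρ : IsRetractionSystem h ρ) {A : Set Γ} (hA : ClosedUnder h A)
    (hAc : A.Countable) : ∃ (ι : Type u) (e : ι → C(Y, ℝ)), IsSigmaCZero e ∧
      (∀ i y, e i (ρ A y) = e i y) ∧ ∀ y y', (∀ i, e i y = e i y') → ρ A y = ρ A y' := by
  obtain ⟨e, he, hs⟩ := hρ.exists_separating hA hAc
  refine ⟨ULift ℕ, fun i => e i.down, fun ε _ => ⟨ULift.down, fun n y => ?_⟩, fun i y => he _ y,
    fun y y' hyy => hs y y' fun n => hyy ⟨n⟩⟩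
  exact (finite_singleton (ULift.up n)).subset fun i hi => ULift.ext _ _ hi.1

/-- The functions `e a i - e a i ∘ ρ (B a)` form a `σ`-`c₀` family when the `B a` increase along a
well order and `e a i` is invariant under a retraction coming before the next `B b`. -/
lemma isSigmaCZero_sigma (hρ : IsRetractionSystem h ρ) {α : Type u} [LinearOrder α]
    [WellFoundedLT α] {B B' : α → Set Γ} (hB : ∀ a, ClosedUnder h (B a))
    (hB' : ∀ a, ClosedUnder h (B' a)) (hBB' : ∀ a, B a ⊆ B' a) (hlt : ∀ a b, a < b → B' a ⊆ B b)
    {ι : α → Type u} {e e' : ∀ a, ι a → C(Y, ℝ)} (he : ∀ a, IsSigmaCZero (e a))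
    (hinv : ∀ a i y, e a i (ρ (B' a) y) = e a i y)
    (he' : ∀ a i y, e' a i y = e a i y - e a i (ρ (B a) y)) :
    IsSigmaCZero fun p : Σ a, ι a => e' p.1 p.2 := by
  intro ε hε
  obtain ⟨c, hc⟩ := hρ.exists_coloring ε hε
  choose d hd using fun a => he a (ε / 2) (half_pos hε)
  refine ⟨fun p => Nat.pair (d p.1 p.2) (c (e' p.1 p.2)), fun n y => ?_⟩
  set s : Set (Σ a, ι a) := {p | Nat.pair (d p.1 p.2) (c (e' p.1 p.2)) = n ∧ ε < |e' p.1 p.2 y|}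
    with hs
  have hfib : ∀ a, {i | (⟨a, i⟩ : Σ a, ι a) ∈ s}.Finite := by
    intro a
    refine ((hd a n.unpair.1 y).union (hd a n.unpair.1 (ρ (B a) y))).subset ?_
    rintro i ⟨hi, hi'⟩
    have h1 : d a i = n.unpair.1 := by rw [← hi]; simp
    simp only [he'] at hi'
    by_cases h2 : ε / 2 < |e a i y|
    · exact Or.inl ⟨h1, h2⟩
    · refine Or.inr ⟨h1, ?_⟩
      have := abs_sub (e a i y) (e a i (ρ (B a) y))
      linarith
  have hbase : (Sigma.fst '' s).Finite := by
    by_contra hinf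
    have : Infinite (Sigma.fst '' s) := Set.infinite_coe_iff.2 hinf
    obtain ⟨f, hf | hf⟩ := Infinite.exists_strictMono_or_strictAnti (Sigma.fst '' s)
    · choose p hp hpf using fun k => (f k).2
      have hmono : ∀ j k, j < k → (p j).1 < (p k).1 := fun j k hjk => by
        rw [hpf, hpf]; exact hf hjk
      obtain ⟨k, hk⟩ := hρ.exists_coloring ε hε |>.elim fun _ _ => hc n.unpair.2
        (fun k => B (p k).1)
        (monotone_nat_of_le_succ fun k => (hBB' _).trans (hlt _ _ (hmono _ _ k.lt_succ_self)))
        (fun k => hB _) (fun k => e' (p k).1 (p k).2)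
        (fun k => by rw [← (hp k).1]; simp)
        (fun k y => by
          rw [he', (hρ.apply_apply_of_subset (hB _) (hB _) subset_rfl y).2, sub_self])
        (fun k y => by
          have h1 := hρ.apply_apply_of_subset (hB' (p k).1) (hB (p (k + 1)).1)
            (hlt _ _ (hmono _ _ k.lt_succ_self)) y
          have h2 := hρ.apply_apply_of_subset (hB (p k).1) (hB (p (k + 1)).1)
            ((hBB' _).trans (hlt _ _ (hmono _ _ k.lt_succ_self))) y
          rw [he', he', h2.1, ← hinv _ _ (ρ (B (p (k + 1)).1) y), h1.1, hinv]) y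
      exact absurd (hp k).2 (not_lt.2 hk)
    · exact not_strictAnti_of_wellFoundedLT f hf
  refine (hbase.biUnion fun a _ => (hfib a).image (Sigma.mk a)).subset ?_
  rintro ⟨a, i⟩ hp
  exact mem_biUnion (mem_image_of_mem Sigma.fst hp) ⟨i, hp, rfl⟩

lemma exists_family_of_closedUnder [T2Space Y] (hρ : IsRetractionSystem h ρ) (A : Set Γ)
    (hA : ClosedUnder h A) : ∃ (ι : Type u) (e : ι → C(Y, ℝ)), IsSigmaCZero e ∧
      (∀ i y, e i (ρ A y) = e i y) ∧ ∀ y y', ρ (closureUnder h ∅) y = ρ (closureUnder h ∅) y' →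
        (∀ i, e i y = e i y') → ρ A y = ρ A y' := by
  suffices H : ∀ κ : Cardinal.{u}, ∀ A : Set Γ, ClosedUnder h A → #A = κ →
      ∃ (ι : Type u) (e : ι → C(Y, ℝ)), IsSigmaCZero e ∧
      (∀ i y, e i (ρ A y) = e i y) ∧ ∀ y y', ρ (closureUnder h ∅) y = ρ (closureUnder h ∅) y' →
        (∀ i, e i y = e i y') → ρ A y = ρ A y' from H _ A hA rfl
  clear hA A
  intro κ
  induction κ using WellFoundedLT.induction with
  | ind κ ih =>
  intro A hA hκ
  by_cases hAc : A.Countable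
  · obtain ⟨ι, e, h1, h2, h3⟩ := hρ.exists_family_of_countable hA hAc
    exact ⟨ι, e, h1, h2, fun y y' _ => h3 y y'⟩
  have hunc : ℵ₀ < κ := by rw [← hκ]; exact not_le.1 fun hle => hAc (le_aleph0_iff_set_countable.1 hle)
  let α : Type u := κ.ord.ToType
  have hα : #α = κ := mk_ord_toType κ
  obtain ⟨σ⟩ : Nonempty (α ≃ A) := Cardinal.eq.1 (hα.trans hκ.symm)
  have hIio : ∀ a : α, #(Iio a) < κ := fun a => by
    have := mk_Iio_lt a (by rw [hα]; exact (Ordinal.type_toType _).symm)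
    rwa [hα] at this
  have hIic : ∀ a : α, #(Iic a) < κ := fun a => by
    rw [← Iio_insert]
    refine (mk_insert_le).trans_lt (add_lt_of_lt hunc.le (hIio a) (one_lt_aleph0.trans hunc))
  let v : α → Γ := fun a => σ a
  let B : α → Set Γ := fun a => closureUnder h (v '' Iio a)
  let B' : α → Set Γ := fun a => closureUnder h (v '' Iic a)
  have hB : ∀ a, ClosedUnder h (B a) := fun a => closedUnder_closureUnder _
  have hB' : ∀ a, ClosedUnder h (B' a) := fun a => closedUnder_closureUnder _
  have hBB' : ∀ a, B a ⊆ B' a := fun a => closureUnder_mono (image_mono Iio_subset_Iic_self)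
  have hlt : ∀ a b, a < b → B' a ⊆ B b := fun a b hab =>
    closureUnder_mono (image_mono (Iic_subset_Iio.2 hab))
  have hB'A : ∀ a, B' a ⊆ A := fun a => closureUnder_subset hA (by
    rintro _ ⟨b, _, rfl⟩; exact (σ b).2)
  have hcard : ∀ a, #(B' a) < κ := fun a =>
    (mk_closureUnder_le hρ.countable _).trans_lt (max_lt (mk_image_le.trans_lt (hIic a)) hunc)
  have hne : Nonempty α := mk_ne_zero_iff.1 (by rw [hα]; exact (aleph0_pos.trans hunc).ne')
  have hmono' : Monotone B' := fun a b hab => closureUnder_mono (image_mono (Iic_subset_Iic.2 hab))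
  have hAU : A = ⋃ a, B' a := by
    refine Subset.antisymm (fun x hx => ?_) (iUnion_subset hB'A)
    refine mem_iUnion.2 ⟨σ.symm ⟨x, hx⟩, subset_closureUnder _ ⟨σ.symm ⟨x, hx⟩, self_mem_Iic, ?_⟩⟩
    simp [v]
  choose ι e he hinv hsep using fun a => ih _ (hcard a) (B' a) (hB' a) rfl
  let e' : ∀ a, ι a → C(Y, ℝ) := fun a i => e a i - (e a i).comp ⟨ρ (B a), hρ.continuous (hB a)⟩
  have he' : ∀ a i y, e' a i y = e a i y - e a i (ρ (B a) y) := fun a i y => rfl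
  refine ⟨Σ a, ι a, fun p => e' p.1 p.2,
    hρ.isSigmaCZero_sigma hB hB' hBB' hlt he hinv he', ?_, ?_⟩
  · rintro ⟨a, i⟩ y
    simp only [he']
    rw [(hρ.apply_apply_of_subset (hB a) hA ((hBB' a).trans (hB'A a)) y).1,
      ← hinv, (hρ.apply_apply_of_subset (hB' a) hA (hB'A a) y).1, hinv]
  · intro y y' h0 hyy
    have key : ∀ a, ρ (B' a) y = ρ (B' a) y' := by
      intro a
      induction a using WellFoundedLT.induction with
      | ind a iha =>
      have hBa : ρ (B a) y = ρ (B a) y' := by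
        rcases (Iio a).eq_empty_or_nonempty with hemp | hnon
        · simpa [B, hemp] using h0
        · have : Nonempty (Iio a) := hnon.to_subtype
          have hU : B a = ⋃ b : Iio a, B' b := by
            have hIic : Monotone fun b : Iio a => v '' Iic (b : α) :=
              fun b c hbc => image_mono (Iic_subset_Iic.2 hbc)
            refine Eq.trans ?_ (closureUnder_iUnion hIic)
            rw [← image_iUnion]
            refine congrArg (fun s => closureUnder h (v '' s)) ?_
            ext b
            simp only [mem_Iio, mem_iUnion, mem_Iic, Subtype.exists, exists_prop]
            exact ⟨fun hb => ⟨b, hb, le_rfl⟩, fun ⟨c, hc, hbc⟩ => hbc.trans_lt hc⟩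
          rw [hU]
          have hm : Monotone fun b : Iio a => B' b := fun b c hbc => hmono' hbc
          refine tendsto_nhds_unique (hρ.tendsto _ hm (fun b => hB' b) y) ?_
          refine (hρ.tendsto _ hm (fun b => hB' b) y').congr fun b => (iha b b.2).symm
      refine hsep a y y' h0 fun i => ?_
      have := hyy ⟨a, i⟩
      simp only [he', hBa] at this
      linarith
    rw [hAU]
    refine tendsto_nhds_unique (hρ.tendsto _ hmono' hB' y) ?_
    exact (hρ.tendsto _ hmono' hB' y').congr fun b => (key b).symm

theorem exists_family [T2Space Y] (hρ : IsRetractionSystem h ρ) :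
    ∃ (ι : Type u) (e : ι → C(Y, ℝ)), IsSigmaCZero e ∧
      ∀ y y', (∀ i, e i y = e i y') → y = y' := by
  obtain ⟨ι, e, he, -, hs⟩ := hρ.exists_family_of_closedUnder Set.univ fun _ _ => subset_univ _
  obtain ⟨ι', e', he', -, hs'⟩ := hρ.exists_family_of_countable (closedUnder_closureUnder ∅)
    (le_aleph0_iff_set_countable.1 ((mk_closureUnder_le hρ.countable ∅).trans (by simp)))
  refine ⟨ι ⊕ ι', Sum.elim e e', fun ε hε => ?_, fun y y' hyy => ?_⟩
  · obtain ⟨c, hc⟩ := he ε hε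
    obtain ⟨c', hc'⟩ := he' ε hε
    refine ⟨Sum.elim c c', fun n y => ?_⟩
    refine (((hc n y).image Sum.inl).union ((hc' n y).image Sum.inr)).subset ?_
    rintro (i | i) hi
    · exact Or.inl ⟨i, hi, rfl⟩
    · exact Or.inr ⟨i, hi, rfl⟩
  · have := hs y y' (hs' y y' fun i => hyy (Sum.inr i)) fun i => hyy (Sum.inl i)
    rwa [hρ.univ, hρ.univ] at this

end IsRetractionSystem

/-- The soft thresholding function `t ↦ t - max (-ε) (min ε t)`. -/
noncomputable def softThreshold (ε t : ℝ) : ℝ := t - max (-ε) (min ε t)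

lemma continuous_softThreshold (ε : ℝ) : Continuous (softThreshold ε) := by
  unfold softThreshold; fun_prop

lemma softThreshold_eq_zero {ε t : ℝ} (ht : |t| ≤ ε) : softThreshold ε t = 0 := by
  rw [abs_le] at ht
  rw [softThreshold, min_eq_right ht.2, max_eq_right ht.1, sub_self]

lemma abs_softThreshold_sub_le {ε : ℝ} (hε : 0 ≤ ε) (t : ℝ) : |softThreshold ε t - t| ≤ ε := by
  rw [softThreshold, sub_sub_cancel_left, abs_neg, abs_le]
  exact ⟨le_max_left _ _, max_le (by linarith) (min_le_left _ _)⟩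

/-- A compact Hausdorff space with a separating `σ`-`c₀` family of continuous functions is
Eberlein compact. -/
theorem isEberleinCompact_of_isSigmaCZero {Y : Type u} [TopologicalSpace Y] [CompactSpace Y]
    [T2Space Y] {ι : Type u} {e : ι → C(Y, ℝ)} (he : IsSigmaCZero e)
    (hs : ∀ y y', (∀ i, e i y = e i y') → y = y') : IsEberleinCompact Y := by
  let δ : ℕ → ℝ := fun j => 1 / ((j : ℝ) + 1)
  have hδ : ∀ j, 0 < δ j := fun j => Nat.one_div_pos_of_nat
  choose c hc using fun j => he (δ j) (hδ j)
  let F : Y → ι × ℕ → ℝ := fun y p =>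
    Real.arctan (softThreshold (δ p.2) (e p.1 y)) / (c p.2 p.1 + p.2 + 1)
  have hden : ∀ p : ι × ℕ, (0 : ℝ) < c p.2 p.1 + p.2 + 1 := fun p => by positivity
  refine ⟨inferInstance, inferInstance, ι × ℕ, F, ?_, ?_⟩
  · refine (Continuous.isClosedEmbedding (continuous_pi fun p => ?_) fun y y' hyy => ?_).isEmbedding
    · exact (Real.continuous_arctan.comp
        ((continuous_softThreshold _).comp (e p.1).continuous)).div_const _
    · refine hs y y' fun i => ?_
      have h1 : ∀ j, softThreshold (δ j) (e i y) = softThreshold (δ j) (e i y') := fun j => by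
        have := congrFun hyy (i, j)
        exact Real.arctan_injective ((div_left_inj' (hden (i, j)).ne').1 this)
      refine eq_of_abs_sub_nonpos (le_of_forall_pos_le_add fun ε hε => ?_)
      obtain ⟨j, hj⟩ := exists_nat_one_div_lt (half_pos hε)
      have h2 := abs_softThreshold_sub_le (hδ j).le (e i y)
      have h3 := abs_softThreshold_sub_le (hδ j).le (e i y')
      rw [h1] at h2
      rw [abs_le] at *
      constructor <;> simp only [δ] at * <;> linarith [h2.1, h2.2, h3.1, h3.2]
  · intro y ε hε
    obtain ⟨N, hN⟩ := exists_nat_gt (2 / ε)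
    refine ((finite_Iio N).biUnion fun j _ => (finite_Iio N).biUnion fun n _ =>
      (hc j n y).image fun i => (i, j)).subset ?_
    rintro ⟨i, j⟩ hij
    have hij' : ε ≤ |Real.arctan (softThreshold (δ j) (e i y)) / (c j i + j + 1)| := hij
    have hd := hden (i, j)
    simp only at hd
    rw [abs_div, abs_of_pos hd, le_div_iff₀ hd] at hij'
    have h2 : |Real.arctan (softThreshold (δ j) (e i y))| ≤ 2 := by
      have := Real.pi_lt_four
      have h3 := Real.neg_pi_div_two_lt_arctan (softThreshold (δ j) (e i y))
      have h4 := Real.arctan_lt_pi_div_two (softThreshold (δ j) (e i y))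
      rw [abs_le]; constructor <;> linarith
    have h5 : (c j i + j + 1 : ℝ) < N := by
      refine lt_of_le_of_lt ?_ hN
      rw [le_div_iff₀ hε]; linarith
    have h6 : c j i + j + 1 < N := by exact_mod_cast h5
    refine mem_biUnion (show j ∈ Iio N by simp only [mem_Iio]; omega)
      (mem_biUnion (show c j i ∈ Iio N by simp only [mem_Iio]; omega) ⟨i, ⟨rfl, ?_⟩, rfl⟩)
    by_contra hlt
    rw [softThreshold_eq_zero (not_lt.1 hlt), Real.arctan_zero, abs_zero] at hij'
    nlinarith

lemma exists_countable_subset_image_subset_closure {α β : Type*} [TopologicalSpace β]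
    [SecondCountableTopology β] (g : α → β) (R : Set α) :
    ∃ Q ⊆ R, Q.Countable ∧ g '' R ⊆ closure (g '' Q) := by
  obtain ⟨D, hDc, hDd⟩ := TopologicalSpace.exists_countable_dense (g '' R)
  obtain ⟨Q, hQR, hQ⟩ := (surjOn_image g R).mono subset_rfl
    (Subtype.coe_image_subset (g '' R) D) |>.exists_bijOn_subset
  refine ⟨Q, hQR, ?_, ?_⟩
  · exact countable_of_injective_of_countable_image hQ.injOn (hQ.image_eq ▸ hDc.image _)
  · rw [hQ.image_eq]
    intro x hx
    exact mem_closure_image (f := Subtype.val) continuous_subtype_val.continuousAt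
      (hDd ⟨x, hx⟩)

lemma countable_support_of_finite {Γ : Type*} {x : Γ → ℝ}
    (hx : ∀ ε > (0 : ℝ), {γ | ε ≤ |x γ|}.Finite) : (Function.support x).Countable := by
  refine (countable_iUnion fun n : ℕ => (hx _ (Nat.one_div_pos_of_nat (n := n))).countable).mono ?_
  intro γ hγ
  obtain ⟨n, hn⟩ := exists_nat_one_div_lt (abs_pos.2 hγ)
  exact mem_iUnion.2 ⟨n, hn.le⟩

lemma eq_of_forall_continuousMap_eq {Y : Type*} [TopologicalSpace Y] [CompactSpace Y] [T2Space Y]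
    {y y' : Y} (hy : ∀ g : C(Y, ℝ), g y = g y') : y = y' := by
  by_contra hne
  obtain ⟨g, hg, hgne⟩ := separatesPoints_continuous_of_t35Space hne
  exact hgne (hy ⟨g, hg⟩)

/-- The functions in `C(X)` lying close to the algebra generated by a `c₀`-embedding of `X` are
covered by countably many pointwise compact sets of continuous functions. -/
lemma exists_compact_approximation {X Γ : Type*} [TopologicalSpace X] [CompactSpace X]
    {ψ : X → Γ → ℝ} (hψ : IsEmbedding ψ) (hc : ∀ x, ∀ ε > (0 : ℝ), {γ | ε ≤ |ψ x γ|}.Finite) :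
    ∃ S : ℕ → Set (X → ℝ), (∀ n, IsCompact (S n)) ∧ (∀ n, ∀ s ∈ S n, Continuous s) ∧
      ∀ g : C(X, ℝ), ∀ ε > 0, ∃ n, ∃ s ∈ S n, ∀ x, |s x - g x| < ε := by
  let S₀ : Set (X → ℝ) := insert 0 (range fun γ x => ψ x γ)
  let S : ℕ → Set (X → ℝ) := fun n => Nat.rec S₀
    (fun n A => (image2 (· + ·) A A ∪ image2 (· * ·) A A) ∪
      (fun r _ => r) '' Icc (-(n : ℝ)) n) n
  have hSs : ∀ n, S (n + 1) = (image2 (· + ·) (S n) (S n) ∪ image2 (· * ·) (S n) (S n)) ∪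
      (fun r _ => r) '' Icc (-(n : ℝ)) n := fun n => rfl
  have hcont : ∀ γ, Continuous fun x => ψ x γ := fun γ =>
    (continuous_apply γ).comp hψ.continuous
  have h0 : ∀ n, (0 : X → ℝ) ∈ S n := by
    intro n
    induction n with
    | zero => exact mem_insert _ _
    | succ n ih => exact Or.inl (Or.inl ⟨0, ih, 0, ih, add_zero _⟩)
  have hmono : Monotone S := monotone_nat_of_le_succ fun n s hs =>
    Or.inl (Or.inl ⟨s, hs, 0, h0 n, add_zero _⟩)
  have hcpt : ∀ n, IsCompact (S n) := by
    intro n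
    induction n with
    | zero =>
      refine Filter.Tendsto.isCompact_insert_range_of_cofinite (tendsto_pi_nhds.2 fun x => ?_)
      rw [Metric.tendsto_nhds]
      intro ε hε
      rw [eventually_cofinite]
      simpa using hc x ε hε
    | succ n ih =>
      rw [hSs]
      rw [← image_prod, ← image_prod]
      exact (((ih.prod ih).image continuous_add).union ((ih.prod ih).image continuous_mul)).union
        (isCompact_Icc.image (continuous_pi fun _ => continuous_id))
  have hSc : ∀ n, ∀ s ∈ S n, Continuous s := by
    intro n
    induction n with
    | zero =>
      rintro s (rfl | ⟨γ, rfl⟩)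
      · exact continuous_zero
      · exact hcont γ
    | succ n ih =>
      rintro s ((⟨a, ha, b, hb, rfl⟩ | ⟨a, ha, b, hb, rfl⟩) | ⟨r, _, rfl⟩)
      · exact (ih a ha).add (ih b hb)
      · exact (ih a ha).mul (ih b hb)
      · exact continuous_const
  let 𝒜 : Subalgebra ℝ C(X, ℝ) :=
    { carrier := {g | ∃ n, ⇑g ∈ S n}
      add_mem' := by
        rintro a b ⟨n, hn⟩ ⟨m, hm⟩
        exact ⟨max n m + 1, Or.inl (Or.inl ⟨a, hmono (le_max_left _ _) hn, b,
          hmono (le_max_right _ _) hm, rfl⟩)⟩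
      mul_mem' := by
        rintro a b ⟨n, hn⟩ ⟨m, hm⟩
        exact ⟨max n m + 1, Or.inl (Or.inr ⟨a, hmono (le_max_left _ _) hn, b,
          hmono (le_max_right _ _) hm, rfl⟩)⟩
      algebraMap_mem' := by
        intro r
        obtain ⟨n, hn⟩ := exists_nat_ge |r|
        exact ⟨n + 1, Or.inr ⟨r, abs_le.1 hn, rfl⟩⟩ }
  have hsep : 𝒜.SeparatesPoints := by
    intro x x' hne
    obtain ⟨γ, hγ⟩ := Function.ne_iff.1 (hψ.injective.ne hne)
    exact ⟨_, ⟨⟨_, hcont γ⟩, ⟨0, Or.inr ⟨γ, rfl⟩⟩, rfl⟩, hγ⟩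
  refine ⟨S, hcpt, hSc, fun g ε hε => ?_⟩
  obtain ⟨⟨s, n, hn⟩, hs⟩ :=
    ContinuousMap.exists_mem_subalgebra_near_continuous_of_separatesPoints 𝒜 hsep g g.continuous ε hε
  exact ⟨n, s, hn, hs⟩

lemma exists_coloring_of_isEmbedding {X Γ : Type*} [TopologicalSpace X] [CompactSpace X]
    {ψ : X → Γ → ℝ} (hψ : IsEmbedding ψ) (hc : ∀ x, ∀ ε > (0 : ℝ), {γ | ε ≤ |ψ x γ|}.Finite)
    {ε : ℝ} (hε : 0 < ε) :
    ∃ c : C(X, ℝ) → ℕ, ∀ (m : ℕ) (g : ℕ → C(X, ℝ)) (z : ℕ → X) (x : X), (∀ k, c (g k) = m) →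
      Tendsto z atTop (𝓝 x) → (∀ j k, j ≤ k → g k (z j) = 0) → ∃ k, |g k x| ≤ ε := by
  obtain ⟨S, hS, hSc, happ⟩ := exists_compact_approximation hψ hc
  choose c s hs hsg using fun g => happ g (ε / 3) (by positivity)
  refine ⟨c, fun m g z x hm hz hg => ?_⟩
  by_contra! hlt
  obtain ⟨t, htS, ht⟩ := (hS m).ultrafilter_le_nhds ((hyperfilter ℕ).map fun k => s (g k)) (by
    rw [le_principal_iff, Ultrafilter.coe_map, mem_map]
    exact univ_mem' fun k => hm k ▸ hs (g k))
  have hev : ∀ y, Tendsto (fun k => s (g k) y) (hyperfilter ℕ) (𝓝 (t y)) := fun y =>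
    ((continuous_apply y).tendsto t).comp ht
  have hle : (hyperfilter ℕ : Filter ℕ) ≤ atTop := by
    rw [← Nat.cofinite_eq_atTop]; exact hyperfilter_le_cofinite
  have h1 : ∀ j, |t (z j)| ≤ ε / 3 := fun j => by
    refine le_of_tendsto (hev (z j)).abs (hle ?_)
    filter_upwards [eventually_ge_atTop j] with k hk
    have := hsg (g k) (z j)
    rw [hg j k hk, sub_zero] at this
    exact this.le
  have h2 : |t x| ≤ ε / 3 :=
    le_of_tendsto (((hSc m t htS).tendsto x).comp hz).abs (Eventually.of_forall h1)
  have h3 : 2 * ε / 3 ≤ |t x| := by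
    refine ge_of_tendsto (hev x).abs (Eventually.of_forall fun k => ?_)
    have h4 := hsg (g k) x
    have h5 := hlt k
    have h6 := abs_sub_abs_le_abs_sub (g k x) (s (g k) x)
    rw [abs_sub_comm] at h6
    linarith
  linarith

/-- Every closed set of countably supported functions is stable under restriction to the sets of
coordinates which are closed under a suitable finitary operation with countable values. -/
lemma exists_closing_operation {Γ E : Type*} [NormedAddCommGroup E] [SecondCountableTopology E]
    {R : Set (Γ → E)} (hR : IsClosed R) (hs : ∀ p ∈ R, (Function.support p).Countable) :
    ∃ h : Finset Γ → Set Γ, (∀ F, (h F).Countable) ∧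
      ∀ A, (∀ F : Finset Γ, (F : Set Γ) ⊆ A → h F ⊆ A) → ∀ p ∈ R, A.indicator p ∈ R := by
  classical
  choose Q hQR hQc hQd using fun F : Finset Γ =>
    exists_countable_subset_image_subset_closure (fun (p : Γ → E) (γ : F) => p γ) R
  refine ⟨fun F => ⋃ p ∈ Q F, Function.support p,
    fun F => (hQc F).biUnion fun p hp => hs p (hQR F hp), fun A hA p hp => ?_⟩
  have key : ∀ i : Finset Γ × ℕ, ∃ q ∈ R, Function.support q ⊆ A ∧
      ∀ γ ∈ i.1, γ ∈ A → dist (q γ) (p γ) < 1 / ((i.2 : ℝ) + 1) := by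
    rintro ⟨F, n⟩
    obtain ⟨_, ⟨q, hq, rfl⟩, hqd⟩ := Metric.mem_closure_iff.1
      (hQd (F.filter (· ∈ A)) (mem_image_of_mem _ hp)) _ (Nat.one_div_pos_of_nat (n := n))
    refine ⟨q, hQR _ hq, (subset_biUnion_of_mem (u := fun p : Γ → E => Function.support p) hq).trans
      (hA _ fun γ hγ => (Finset.mem_filter.1 hγ).2), fun γ hγ hγA => ?_⟩
    rw [dist_comm]
    exact (dist_le_pi_dist _ _ (⟨γ, Finset.mem_filter.2 ⟨hγ, hγA⟩⟩ : F.filter (· ∈ A))).trans_lt hqd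
  choose q hqR hqA hqd using key
  refine hR.mem_of_tendsto (f := q) (b := atTop) (tendsto_pi_nhds.2 fun γ => ?_)
    (Eventually.of_forall hqR)
  by_cases hγ : γ ∈ A
  · rw [indicator_of_mem hγ, Metric.tendsto_nhds]
    intro ε hε
    obtain ⟨n, hn⟩ := exists_nat_one_div_lt hε
    filter_upwards [eventually_ge_atTop (({γ}, n) : Finset Γ × ℕ)] with i hi
    refine (hqd i γ (hi.1 (Finset.mem_singleton_self γ)) hγ).trans_le (le_trans ?_ hn.le)
    exact Nat.one_div_le_one_div hi.2
  · rw [indicator_of_notMem hγ]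
    refine tendsto_const_nhds.congr fun i => ?_
    by_contra hne
    exact hγ (hqA i (Ne.symm hne))

/-- Coordinate restrictions of `X` along a closing operation which are compatible with `f`. -/
lemma exists_restrictions {X Y Γ : Type*} [TopologicalSpace X] [CompactSpace X]
    [TopologicalSpace Y] [T2Space Y] {ψ : X → Γ → ℝ} (hψ : IsEmbedding ψ)
    (hc : ∀ x, ∀ ε > (0 : ℝ), {γ | ε ≤ |ψ x γ|}.Finite) {f : X → Y} (hf : Continuous f) :
    ∃ (h : Finset Γ → Set Γ) (r : Set Γ → X → X), (∀ F, (h F).Countable) ∧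
      ∀ A, ClosedUnder h A → (∀ x, ψ (r A x) = A.indicator (ψ x)) ∧
        ∀ x x', f x = f x' → f (r A x) = f (r A x') := by
  let P : Set (X × X) := {p | f p.1 = f p.2}
  let j : X × X → Γ → ℝ × ℝ := fun p γ => (ψ p.1 γ, ψ p.2 γ)
  have hj : Continuous j := continuous_pi fun γ =>
    ((continuous_apply γ).comp (hψ.continuous.comp continuous_fst)).prodMk
      ((continuous_apply γ).comp (hψ.continuous.comp continuous_snd))
  have hP : IsClosed P := isClosed_eq (hf.comp continuous_fst) (hf.comp continuous_snd)
  have hs : ∀ p ∈ j '' P, (Function.support p).Countable := by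
    rintro _ ⟨p, -, rfl⟩
    refine ((countable_support_of_finite (hc p.1)).union
      (countable_support_of_finite (hc p.2))).mono fun γ hγ => ?_
    by_contra hn
    simp only [mem_union, Function.mem_support, not_or, not_not] at hn
    exact hγ (Prod.ext hn.1 hn.2)
  obtain ⟨h, hh, hA⟩ := exists_closing_operation (hP.isCompact.image hj).isClosed hs
  have key : ∀ A, ClosedUnder h A → ∀ x x', f x = f x' → ∃ z z', f z = f z' ∧
      ψ z = A.indicator (ψ x) ∧ ψ z' = A.indicator (ψ x') := by
    classical
    intro A hAc x x' hxx
    obtain ⟨⟨z, z'⟩, hz, hzA⟩ := hA A hAc (j (x, x')) ⟨(x, x'), hxx, rfl⟩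
    refine ⟨z, z', hz, funext fun γ => ?_, funext fun γ => ?_⟩
    · have := congrArg Prod.fst (congrFun hzA γ)
      by_cases hγ : γ ∈ A <;> simpa [j, hγ] using this
    · have := congrArg Prod.snd (congrFun hzA γ)
      by_cases hγ : γ ∈ A <;> simpa [j, hγ] using this
  have hr : ∀ A x, ∃ z, ClosedUnder h A → ψ z = A.indicator (ψ x) := by
    intro A x
    by_cases hAc : ClosedUnder h A
    · obtain ⟨z, -, -, hz, -⟩ := key A hAc x x rfl
      exact ⟨z, fun _ => hz⟩
    · exact ⟨x, fun hn => absurd hn hAc⟩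
  choose r hr using hr
  refine ⟨h, r, hh, fun A hAc => ⟨fun x => hr A x hAc, fun x x' hxx => ?_⟩⟩
  obtain ⟨z, z', hz, h1, h2⟩ := key A hAc x x' hxx
  rw [hψ.injective ((hr A x hAc).trans h1.symm), hψ.injective ((hr A x' hAc).trans h2.symm), hz]

lemma tendsto_indicator_iUnion {Γ ι : Type*} [LinearOrder ι] [Nonempty ι] {B : ι → Set Γ}
    (hB : Monotone B) (x : Γ → ℝ) :
    Tendsto (fun i => (B i).indicator x) atTop (𝓝 ((⋃ i, B i).indicator x)) := by
  refine tendsto_pi_nhds.2 fun γ => ?_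
  by_cases hγ : γ ∈ ⋃ i, B i
  · obtain ⟨i, hi⟩ := mem_iUnion.1 hγ
    refine tendsto_const_nhds.congr' ?_
    filter_upwards [eventually_ge_atTop i] with k hk
    rw [indicator_of_mem hγ, indicator_of_mem (hB hk hi)]
  · refine tendsto_const_nhds.congr fun i => ?_
    rw [indicator_of_notMem hγ, indicator_of_notMem fun hi => hγ (mem_iUnion.2 ⟨i, hi⟩)]

/-- If `r` is a map of `X` onto a set of points determined by countably many coordinates, then
countably many continuous functions on `Y` separate the points of `f '' range r`. -/
lemma exists_separating_of_countable {X Y Γ : Type*} [TopologicalSpace X] [CompactSpace X]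
    [TopologicalSpace Y] [CompactSpace Y] [T2Space Y] {ψ : X → Γ → ℝ} (hψ : IsEmbedding ψ)
    {f : X → Y} (hf : Continuous f) {A : Set Γ} (hA : A.Countable) {r : X → X} (hr : Continuous r)
    (hrA : ∀ x, ψ (r x) = A.indicator (ψ x)) :
    ∃ e : ℕ → C(Y, ℝ), ∀ x x', (∀ n, e n (f (r x)) = e n (f (r x'))) → f (r x) = f (r x') := by
  have : Countable A := hA.to_subtype
  have : CompactSpace (range r) := isCompact_iff_compactSpace.1 (isCompact_range hr)
  let j : range r → A → ℝ := fun z γ => ψ z γ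
  have hj : IsClosedEmbedding j := by
    refine Continuous.isClosedEmbedding (continuous_pi fun γ =>
      (continuous_apply (γ : Γ)).comp (hψ.continuous.comp continuous_subtype_val)) ?_
    rintro ⟨_, x, rfl⟩ ⟨_, x', rfl⟩ hxx
    refine Subtype.ext (hψ.injective (funext fun γ => ?_))
    by_cases hγ : γ ∈ A
    · exact congrFun hxx ⟨γ, hγ⟩
    · simp only [hrA, indicator_of_notMem hγ]
  have : SecondCountableTopology (range r) := hj.isInducing.secondCountableTopology
  have : T2Space (range r) := hj.isEmbedding.t2Space
  let Φ : C(Y, ℝ) → C(range r, ℝ) := fun g =>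
    g.comp ⟨fun z => f z, hf.comp continuous_subtype_val⟩
  obtain ⟨Q, -, hQc, hQ⟩ := exists_countable_subset_image_subset_closure Φ univ
  have hQne : Q.Nonempty := by
    by_contra hemp
    rw [not_nonempty_iff_eq_empty] at hemp
    rw [hemp, image_empty, closure_empty] at hQ
    exact hQ (mem_image_of_mem Φ (mem_univ 0))
  obtain ⟨e, rfl⟩ := hQc.exists_eq_range hQne
  refine ⟨e, fun x x' hxx => eq_of_forall_continuousMap_eq fun g => ?_⟩
  let a : range r := ⟨r x, x, rfl⟩
  let b : range r := ⟨r x', x', rfl⟩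
  have hcl : IsClosed {u : C(range r, ℝ) | u a = u b} :=
    isClosed_eq (continuous_eval_const a) (continuous_eval_const b)
  refine closure_minimal ?_ hcl (hQ (mem_image_of_mem Φ (mem_univ g)))
  rintro _ ⟨_, ⟨n, rfl⟩, rfl⟩
  exact hxx n

lemma exists_isRetractionSystem {X Y Γ : Type u} [TopologicalSpace X] [CompactSpace X]
    [TopologicalSpace Y] [CompactSpace Y] [T2Space Y] {ψ : X → Γ → ℝ} (hψ : IsEmbedding ψ)
    (hc : ∀ x, ∀ ε > (0 : ℝ), {γ | ε ≤ |ψ x γ|}.Finite) {f : X → Y} (hf : Continuous f)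
    (hsurj : Function.Surjective f) :
    ∃ (h : Finset Γ → Set Γ) (ρ : Set Γ → Y → Y), IsRetractionSystem h ρ := by
  obtain ⟨h, r, hh, hr⟩ := exists_restrictions hψ hc hf
  obtain ⟨ρ, hρ⟩ : ∃ ρ : Set Γ → Y → Y, ∀ {A}, ClosedUnder h A → ∀ x, ρ A (f x) = f (r A x) :=
    ⟨fun A y => f (r A (Function.surjInv hsurj y)), fun hA x =>
      (hr _ hA).2 _ _ (Function.surjInv_eq hsurj _)⟩
  have hrcont : ∀ {A}, ClosedUnder h A → Continuous (r A) := fun {A} hA => by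
    classical
    rw [hψ.isInducing.continuous_iff]
    refine continuous_pi fun γ => ?_
    simp only [Function.comp_def, (hr A hA).1]
    by_cases hγ : γ ∈ A
    · have : Continuous fun x => ψ x γ := (continuous_apply γ).comp hψ.continuous
      simpa [hγ] using this
    · simpa [hγ] using continuous_const
  have hrlim : ∀ {ι : Type u} [LinearOrder ι] [Nonempty ι] (B : ι → Set Γ), Monotone B →
      (∀ i, ClosedUnder h (B i)) → ∀ x, Tendsto (fun i => r (B i) x) atTop (𝓝 (r (⋃ i, B i) x)) := by
    intro ι _ _ B hB hBc x
    rw [hψ.isInducing.tendsto_nhds_iff, (hr _ (ClosedUnder.iUnion hB hBc)).1]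
    exact (tendsto_indicator_iUnion hB (ψ x)).congr fun i => ((hr _ (hBc i)).1 x).symm
  have hrr : ∀ {A B}, ClosedUnder h A → ClosedUnder h B → A ⊆ B →
      ∀ x, r A (r B x) = r A x ∧ r B (r A x) = r A x := by
    intro A B hA hB hAB x
    constructor <;> apply hψ.injective
    · rw [(hr A hA).1, (hr A hA).1, (hr B hB).1, indicator_indicator, inter_eq_left.2 hAB]
    · rw [(hr B hB).1, (hr A hA).1, indicator_indicator, inter_eq_right.2 hAB]
  refine ⟨h, ρ, hh, ?_, ?_, ?_, ?_, ?_, ?_⟩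
  · intro A hA
    rw [(hf.isClosedMap.isQuotientMap hf hsurj).continuous_iff]
    exact (hf.comp (hrcont hA)).congr fun x => (hρ hA x).symm
  · intro A B hA hB hAB y
    obtain ⟨x, rfl⟩ := hsurj y
    rw [hρ hB x, hρ hA x, hρ hA (r B x), hρ hB (r A x), (hrr hA hB hAB x).1, (hrr hA hB hAB x).2]
    exact ⟨rfl, rfl⟩
  · intro y
    obtain ⟨x, rfl⟩ := hsurj y
    have hU : ClosedUnder h univ := fun _ _ => subset_univ _
    rw [hρ hU]
    exact congrArg f (hψ.injective (by rw [(hr _ hU).1, indicator_univ]))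
  · intro ι _ _ B hB hBc y
    obtain ⟨x, rfl⟩ := hsurj y
    rw [hρ (ClosedUnder.iUnion hB hBc)]
    exact ((hf.tendsto _).comp (hrlim B hB hBc x)).congr fun i => (hρ (hBc i) x).symm
  · intro A hA hAc
    obtain ⟨e, he⟩ := exists_separating_of_countable hψ hf hAc (hrcont hA) (hr A hA).1
    have hρc : Continuous (ρ A) := by
      rw [(hf.isClosedMap.isQuotientMap hf hsurj).continuous_iff]
      exact (hf.comp (hrcont hA)).congr fun x => (hρ hA x).symm
    refine ⟨fun n => (e n).comp ⟨ρ A, hρc⟩, fun n y => ?_, fun y y' hyy => ?_⟩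
    · obtain ⟨x, rfl⟩ := hsurj y
      simp only [ContinuousMap.comp_apply, ContinuousMap.coe_mk, hρ hA,
        (hrr hA hA subset_rfl x).1]
    · obtain ⟨x, rfl⟩ := hsurj y
      obtain ⟨x', rfl⟩ := hsurj y'
      simp only [ContinuousMap.comp_apply, ContinuousMap.coe_mk, hρ hA] at hyy ⊢
      exact he x x' hyy
  · intro ε hε
    obtain ⟨c, hc⟩ := exists_coloring_of_isEmbedding hψ hc hε
    refine ⟨fun g => c (g.comp ⟨f, hf⟩), fun m B hB hBc e hem he0 he1 y => ?_⟩
    obtain ⟨x, rfl⟩ := hsurj y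
    have hU := ClosedUnder.iUnion hB hBc
    obtain ⟨k, hk⟩ := hc m (fun k => (e k).comp ⟨f, hf⟩) (fun k => r (B k) x)
      (r (⋃ i, B i) x) hem (by
        rw [hψ.isInducing.tendsto_nhds_iff, (hr _ hU).1]
        exact (tendsto_indicator_iUnion hB (ψ x)).congr fun i => ((hr _ (hBc i)).1 x).symm)
      (fun j k hjk => by
        have := he0 k (f (r (B j) x))
        rwa [hρ (hBc k), (hrr (hBc j) (hBc k) (hB hjk) x).2] at this)
    refine ⟨k, ?_⟩
    have h1 := he1 k (f (r (⋃ i, B i) x))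
    have h2 := he1 k (f x)
    rw [hρ (hBc _), (hrr (hBc _) hU (subset_iUnion B (k + 1)) x).1] at h1
    rw [hρ (hBc _)] at h2
    rw [← h2, h1]
    exact hk

/-- A Hausdorff continuous image of an Eberlein compact space is Eberlein compact
(Benyamini, Rudin, Wage). -/
theorem isEberleinCompact_of_surjective {X Y : Type u} [TopologicalSpace X] [TopologicalSpace Y]
    [T2Space Y] (hX : IsEberleinCompact X) {f : X → Y} (hf : Continuous f)
    (hsurj : Function.Surjective f) : IsEberleinCompact Y := by
  obtain ⟨_, _, Γ, ψ, hψ, hc⟩ := hX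
  have : CompactSpace Y := hsurj.compactSpace hf
  obtain ⟨h, ρ, hρ⟩ := exists_isRetractionSystem hψ hc hf hsurj
  obtain ⟨ι, e, he, hs⟩ := hρ.exists_family
  exact isEberleinCompact_of_isSigmaCZero he hs

lemma finite_le_abs_prod {Γ : Type*} {v : Γ → ℝ} (hv : ∀ γ, |v γ| ≤ 1 / 2)
    (hc : ∀ ε > (0 : ℝ), {γ | ε ≤ |v γ|}.Finite) {ε : ℝ} (hε : 0 < ε) :
    {m : Multiset Γ | ε ≤ |(m.map v).prod|}.Finite := by
  classical
  have hb : ∀ m : Multiset Γ, |(m.map v).prod| ≤ (1 / 2) ^ m.card := by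
    intro m
    induction m using Multiset.induction with
    | empty => simp
    | cons a m ih =>
      rw [Multiset.map_cons, Multiset.prod_cons, abs_mul, Multiset.card_cons, pow_succ']
      exact mul_le_mul (hv a) ih (abs_nonneg _) (by norm_num)
  obtain ⟨N, hN⟩ := exists_pow_lt_of_lt_one hε (by norm_num : (1 / 2 : ℝ) < 1)
  refine ((N • (hc ε hε).toFinset.val).powerset.toFinset.finite_toSet).subset fun m hm => ?_
  rw [Finset.mem_coe, Multiset.mem_toFinset, Multiset.mem_powerset, Multiset.le_iff_count]
  intro a
  by_cases ha : a ∈ m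
  · have hcard : m.card ≤ N := by
      by_contra! hlt
      have := hm.trans (hb m)
      exact absurd ((pow_le_pow_of_le_one (by norm_num) (by norm_num) hlt.le).trans_lt hN)
        (not_lt.2 this)
    have haε : ε ≤ |v a| := by
      refine (mem_ofPred.1 hm).trans ?_
      obtain ⟨m', rfl⟩ := Multiset.exists_cons_of_mem ha
      rw [Multiset.map_cons, Multiset.prod_cons, abs_mul]
      exact mul_le_of_le_one_right (abs_nonneg _)
        ((hb m').trans (pow_le_one₀ (by norm_num) (by norm_num)))
    rw [Multiset.count_nsmul, Multiset.count_eq_one_of_mem (Finset.nodup _) (by simpa using haε),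
      mul_one]
    exact (Multiset.count_le_card _ _).trans hcard
  · rw [Multiset.count_eq_zero_of_notMem ha]
    exact Nat.zero_le _

/-- On an Eberlein compact space there is a bounded pointwise `c₀` family of continuous functions
with dense linear span. -/
lemma exists_dense_span {Y : Type u} [TopologicalSpace Y] (hY : IsEberleinCompact Y) :
    ∃ (ι : Type u) (g : ι → C(Y, ℝ)), (∀ i y, |g i y| ≤ 1) ∧
      (∀ y, ∀ ε > (0 : ℝ), {i | ε ≤ |g i y|}.Finite) ∧
      ∀ f, f ∈ closure (Submodule.span ℝ (range g) : Set C(Y, ℝ)) := by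
  obtain ⟨_, _, Γ, ψ, hψ, hc⟩ := hY
  let u : Γ → C(Y, ℝ) := fun γ => ⟨fun y => ψ y γ, (continuous_apply γ).comp hψ.continuous⟩
  let v : Γ → C(Y, ℝ) := fun γ => (1 / (2 * (1 + ‖u γ‖))) • u γ
  have hpos : ∀ γ, 0 < 2 * (1 + ‖u γ‖) := fun γ => by positivity
  have hvu : ∀ γ y, |v γ y| = |ψ y γ| / (2 * (1 + ‖u γ‖)) := fun γ y => by
    simp only [v, ContinuousMap.smul_apply, smul_eq_mul, abs_mul, abs_of_pos (one_div_pos.2 (hpos γ))]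
    rw [one_div_mul_eq_div]
    rfl
  have hv : ∀ y γ, |v γ y| ≤ 1 / 2 := fun y γ => by
    rw [hvu, div_le_iff₀ (hpos γ)]
    have : |ψ y γ| ≤ ‖u γ‖ := (u γ).norm_coe_le_norm y
    linarith
  have hvc : ∀ y, ∀ ε > (0 : ℝ), {γ | ε ≤ |v γ y|}.Finite := fun y ε hε =>
    (hc y ε hε).subset fun γ hγ => (mem_ofPred.1 hγ).trans <| by
      rw [hvu, div_le_iff₀ (hpos γ)]
      nlinarith [abs_nonneg (ψ y γ), norm_nonneg (u γ),
        mul_nonneg (abs_nonneg (ψ y γ)) (norm_nonneg (u γ))]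
  have happ : ∀ (m : Multiset Γ) y, (m.map v).prod y = (m.map fun γ => v γ y).prod := fun m y => by
    induction m using Multiset.induction with
    | empty => simp
    | cons a m ih => simp only [Multiset.map_cons, Multiset.prod_cons, ContinuousMap.mul_apply, ih]
  refine ⟨Multiset Γ, fun m => (m.map v).prod, fun m y => ?_, fun y ε hε => ?_, fun f => ?_⟩
  · rw [happ]
    induction m using Multiset.induction with
    | empty => simp
    | cons a m ih =>
      rw [Multiset.map_cons, Multiset.prod_cons, abs_mul]
      exact mul_le_one₀ ((hv y a).trans (by norm_num)) (abs_nonneg _) ih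
  · simp only [happ]
    exact finite_le_abs_prod (hv y) (hvc y) hε
  · have hsep : (Algebra.adjoin ℝ (range v)).SeparatesPoints := by
      intro y y' hyy
      by_contra! hcon
      refine hyy (hψ.injective (funext fun γ => ?_))
      have := hcon (v γ) ⟨v γ, Algebra.subset_adjoin (mem_range_self γ), rfl⟩
      simp only [v, ContinuousMap.smul_apply, smul_eq_mul] at this
      exact mul_left_cancel₀ (one_div_pos.2 (hpos γ)).ne' this
    have htop := ContinuousMap.subalgebra_topologicalClosure_eq_top_of_separatesPoints _ hsep
    have hf : f ∈ (Algebra.adjoin ℝ (range v)).topologicalClosure := htop ▸ Algebra.mem_top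
    refine closure_mono ?_ hf
    intro e he
    have he' : e ∈ Subalgebra.toSubmodule (Algebra.adjoin ℝ (range v)) := he
    rw [Algebra.adjoin_eq_span] at he'
    refine Submodule.span_mono ?_ he'
    intro a ha
    induction ha using Submonoid.closure_induction with
    | mem a ha =>
      obtain ⟨γ, rfl⟩ := ha
      exact ⟨{γ}, by simp⟩
    | one => exact ⟨0, by simp⟩
    | mul a b _ _ ha hb =>
      obtain ⟨m, rfl⟩ := ha
      obtain ⟨m', rfl⟩ := hb
      exact ⟨m + m', by simp⟩

open MeasureTheory in
/-- Positive functionals map bounded pointwise `c₀` families into `c₀`. -/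
lemma finite_le_abs_of_nonneg {Y ι : Type*} [TopologicalSpace Y] [CompactSpace Y] [T2Space Y]
    {g : ι → C(Y, ℝ)} (hg : ∀ i y, |g i y| ≤ 1) (hc : ∀ y, ∀ ε > (0 : ℝ), {i | ε ≤ |g i y|}.Finite)
    (φ : C(Y, ℝ) →ₗ[ℝ] ℝ) (hφ : ∀ f, 0 ≤ f → 0 ≤ φ f) {ε : ℝ} (hε : 0 < ε) :
    {i | ε ≤ |φ (g i)|}.Finite := by
  by_contra hinf
  let j := Set.Infinite.natEmbedding _ hinf
  let _ : MeasurableSpace Y := borel Y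
  have : BorelSpace Y := ⟨rfl⟩
  let c : C(Y, ℝ) → CompactlySupportedContinuousMap Y ℝ :=
    CompactlySupportedContinuousMap.continuousMapEquiv
  let Λ : CompactlySupportedContinuousMap Y ℝ →ₚ[ℝ] ℝ := PositiveLinearMap.mk₀
    { toFun := fun f => φ f.toContinuousMap
      map_add' := fun f f' => map_add φ f.toContinuousMap f'.toContinuousMap
      map_smul' := fun a f => map_smul φ a f.toContinuousMap } fun f hf => hφ _ hf
  have hmeas : ∀ f, ∫ y, f y ∂(RealRMK.rieszMeasure Λ) = φ f := fun f =>
    RealRMK.integral_rieszMeasure Λ (c f)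
  have hlim : Tendsto (fun n => ∫ y, g (j n) y ∂(RealRMK.rieszMeasure Λ)) atTop
      (𝓝 (∫ _, (0 : ℝ) ∂(RealRMK.rieszMeasure Λ))) := by
    refine tendsto_integral_of_dominated_convergence (fun _ => 1)
      (fun n => (g (j n)).continuous.aestronglyMeasurable) (integrable_const 1)
      (fun n => .of_forall fun y => hg _ y) (.of_forall fun y => ?_)
    rw [Metric.tendsto_nhds]
    intro δ hδ
    have hfin := (hc y δ hδ).preimage
      (Subtype.val_injective.comp j.injective).injOn
    rw [← Nat.cofinite_eq_atTop]
    filter_upwards [hfin.compl_mem_cofinite] with n hn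
    simpa using hn
  simp only [hmeas, integral_zero] at hlim
  obtain ⟨n, hn⟩ := ((Metric.tendsto_nhds.1 hlim) ε hε).exists
  rw [Real.dist_0_eq_abs] at hn
  exact absurd (j n).2 (not_le.2 hn)

/-- The set of positive linear functionals of norm at most one on `C(Y, ℝ)`. -/
def positiveBall (Y : Type*) [TopologicalSpace Y] [CompactSpace Y] : Set (C(Y, ℝ) → ℝ) :=
  {φ | (∀ f g, φ (f + g) = φ f + φ g) ∧ (∀ (a : ℝ) f, φ (a • f) = a * φ f) ∧ ∀ f, φ f ≤ ‖f ⊔ 0‖}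

section PositiveBall

variable {Y : Type u} [TopologicalSpace Y] [CompactSpace Y]

lemma norm_sup_zero_le (f : C(Y, ℝ)) : ‖f ⊔ 0‖ ≤ ‖f‖ := by
  refine (ContinuousMap.norm_le _ (norm_nonneg f)).2 fun y => ?_
  rw [ContinuousMap.sup_apply, ContinuousMap.zero_apply, Real.norm_of_nonneg le_sup_right]
  exact sup_le ((le_abs_self _).trans (f.norm_coe_le_norm y)) (norm_nonneg f)

lemma norm_add_sup_zero_le (f g : C(Y, ℝ)) : ‖(f + g) ⊔ 0‖ ≤ ‖f ⊔ 0‖ + ‖g ⊔ 0‖ := by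
  refine (ContinuousMap.norm_le _ (by positivity)).2 fun y => ?_
  have hf := (le_abs_self _).trans ((f ⊔ 0).norm_coe_le_norm y)
  have hg := (le_abs_self _).trans ((g ⊔ 0).norm_coe_le_norm y)
  simp only [ContinuousMap.sup_apply, ContinuousMap.zero_apply, ContinuousMap.add_apply,
    sup_le_iff] at hf hg ⊢
  rw [Real.norm_of_nonneg le_sup_right]
  exact sup_le (add_le_add hf.1 hg.1) (add_nonneg hf.2 hg.2)

lemma norm_smul_sup_zero {a : ℝ} (ha : 0 < a) (f : C(Y, ℝ)) :
    ‖(a • f) ⊔ 0‖ = a * ‖f ⊔ 0‖ := by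
  have : (a • f) ⊔ 0 = a • (f ⊔ 0) := by
    ext y
    simp only [ContinuousMap.sup_apply, ContinuousMap.zero_apply, ContinuousMap.smul_apply,
      smul_eq_mul]
    rw [mul_max_of_nonneg _ _ ha.le, mul_zero]
  rw [this, norm_smul, Real.norm_of_nonneg ha.le]

lemma norm_le_norm_sup_zero_add (f : C(Y, ℝ)) : ‖f‖ ≤ ‖f ⊔ 0‖ + ‖(-f) ⊔ 0‖ := by
  have : f = f ⊔ 0 - (-f) ⊔ 0 := by
    ext y
    simp only [ContinuousMap.sup_apply, ContinuousMap.zero_apply, ContinuousMap.sub_apply,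
      ContinuousMap.neg_apply]
    rcases le_total 0 (f y) with h | h <;> simp [h]
  calc ‖f‖ = ‖f ⊔ 0 - (-f) ⊔ 0‖ := congrArg _ this
    _ ≤ _ := norm_sub_le _ _

variable {φ : C(Y, ℝ) → ℝ}

/-- The linear map underlying an element of `positiveBall Y`. -/
def positiveBall.toLinearMap (hφ : φ ∈ positiveBall Y) : C(Y, ℝ) →ₗ[ℝ] ℝ where
  toFun := φ
  map_add' := hφ.1
  map_smul' := hφ.2.1

lemma positiveBall.abs_le (hφ : φ ∈ positiveBall Y) (f : C(Y, ℝ)) : |φ f| ≤ ‖f‖ := by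
  have hneg : φ (-f) = -φ f := map_neg (positiveBall.toLinearMap hφ) f
  refine abs_le'.2 ⟨(hφ.2.2 f).trans (norm_sup_zero_le f), ?_⟩
  rw [← hneg, ← norm_neg f]
  exact (hφ.2.2 (-f)).trans (norm_sup_zero_le (-f))

lemma positiveBall.nonneg (hφ : φ ∈ positiveBall Y) {f : C(Y, ℝ)} (hf : 0 ≤ f) : 0 ≤ φ f := by
  have hneg : φ (-f) = -φ f := map_neg (positiveBall.toLinearMap hφ) f
  have := hφ.2.2 (-f)
  rw [sup_eq_right.2 (neg_nonpos.2 hf), norm_zero, hneg] at this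
  linarith

variable (Y) in
lemma isCompact_positiveBall : IsCompact (positiveBall Y) := by
  refine (isCompact_univ_pi fun f : C(Y, ℝ) => isCompact_Icc (a := -‖f‖) (b := ‖f‖)).of_isClosed_subset
    ?_ fun φ hφ f _ => abs_le.1 (positiveBall.abs_le hφ f)
  simp only [positiveBall, ofPred_and, ofPred_forall]
  refine IsClosed.inter ?_ (IsClosed.inter ?_ ?_)
  · exact isClosed_iInter fun f => isClosed_iInter fun g =>
      isClosed_eq (continuous_apply _) ((continuous_apply f).add (continuous_apply g))
  · exact isClosed_iInter fun a => isClosed_iInter fun f =>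
      isClosed_eq (continuous_apply _) (continuous_const.mul (continuous_apply f))
  · exact isClosed_iInter fun f => isClosed_le (continuous_apply _) continuous_const

lemma positiveBall.eq_of_dense_span {φ' : C(Y, ℝ) → ℝ} (hφ : φ ∈ positiveBall Y)
    (hφ' : φ' ∈ positiveBall Y) {ι : Type*} {g : ι → C(Y, ℝ)}
    (hd : ∀ f, f ∈ closure (Submodule.span ℝ (range g) : Set C(Y, ℝ)))
    (h : ∀ i, φ (g i) = φ' (g i)) : φ = φ' := by
  have hcont : ∀ {χ : C(Y, ℝ) → ℝ}, χ ∈ positiveBall Y → Continuous χ := fun hχ =>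
    AddMonoidHomClass.continuous_of_bound (positiveBall.toLinearMap hχ) 1 fun f => by
      rw [one_mul]
      exact positiveBall.abs_le hχ f
  funext f
  refine closure_minimal ?_ (isClosed_eq (hcont hφ) (hcont hφ')) (hd f)
  intro e he
  exact LinearMap.eqOn_span (f := positiveBall.toLinearMap hφ)
    (g := positiveBall.toLinearMap hφ') (by rintro _ ⟨i, rfl⟩; exact h i) he

/-- Closed sets of pairs of positive functionals of norm at most one over an Eberlein compact
space are Eberlein compact. -/
lemma isEberleinCompact_of_isClosed (hY : IsEberleinCompact Y)
    {S : Set ((C(Y, ℝ) → ℝ) × (C(Y, ℝ) → ℝ))} (hS : IsClosed S)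
    (hSP : S ⊆ positiveBall Y ×ˢ positiveBall Y) : IsEberleinCompact S := by
  obtain ⟨ι, g, hg, hc, hd⟩ := exists_dense_span hY
  have : T2Space Y := hY.2.1
  have : CompactSpace S := isCompact_iff_compactSpace.1
    (((isCompact_positiveBall Y).prod (isCompact_positiveBall Y)).of_isClosed_subset hS hSP)
  refine ⟨this, inferInstance, ι ⊕ ι,
    fun p => Sum.elim (fun i => p.1.1 (g i)) (fun i => p.1.2 (g i)), ?_, fun p ε hε => ?_⟩
  · refine (Continuous.isClosedEmbedding (continuous_pi ?_) ?_).isEmbedding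
    · rintro (i | i)
      · exact (continuous_apply (g i)).comp (continuous_fst.comp continuous_subtype_val)
      · exact (continuous_apply (g i)).comp (continuous_snd.comp continuous_subtype_val)
    · intro p q hpq
      exact Subtype.ext (Prod.ext
        (positiveBall.eq_of_dense_span (hSP p.2).1 (hSP q.2).1 hd fun i => congrFun hpq (.inl i))
        (positiveBall.eq_of_dense_span (hSP p.2).2 (hSP q.2).2 hd fun i => congrFun hpq (.inr i)))
  · have hfin : ∀ {φ}, φ ∈ positiveBall Y → {i | ε ≤ |φ (g i)|}.Finite := fun hφ =>
      finite_le_abs_of_nonneg hg hc (positiveBall.toLinearMap hφ)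
        (fun _ hf => positiveBall.nonneg hφ hf) hε
    refine (((hfin (hSP p.2).1).image Sum.inl).union ((hfin (hSP p.2).2).image Sum.inr)).subset ?_
    rintro (i | i) hi
    · exact .inl ⟨i, hi, rfl⟩
    · exact .inr ⟨i, hi, rfl⟩

variable {Z : Type u} [TopologicalSpace Z] [CompactSpace Z]

/-- Point evaluations on `Z` extend along a map bounded below to differences of positive
functionals. -/
lemma exists_mem_positiveBall (S : C(Z, ℝ) →ₗ[ℝ] C(Y, ℝ)) {M : ℝ} (hM : 0 < M)
    (hS : ∀ e, ‖e‖ ≤ M * ‖S e‖) (z : Z) :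
    ∃ φ ∈ positiveBall Y, ∃ φ' ∈ positiveBall Y, ∀ e, M * (φ (S e) - φ' (S e)) = e z := by
  let j : C(Z, ℝ) →ₗ[ℝ] C(Y, ℝ) × C(Y, ℝ) := S.prod (-S)
  have hj : Function.Injective j := by
    refine (injective_iff_map_eq_zero j).2 fun e he => ?_
    have h0 : S e = 0 := congrArg Prod.fst he
    have := hS e
    rw [h0, norm_zero, mul_zero] at this
    exact norm_le_zero_iff.1 this
  let ev : C(Z, ℝ) →ₗ[ℝ] ℝ :=
    { toFun := fun e => M⁻¹ * e z
      map_add' := fun e e' => mul_add _ _ _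
      map_smul' := fun a e => mul_left_comm _ _ _ }
  let q : (C(Y, ℝ) × C(Y, ℝ)) →ₗ.[ℝ] ℝ :=
    ⟨LinearMap.range j, ev ∘ₗ (LinearEquiv.ofInjective j hj).symm.toLinearMap⟩
  have hq : ∀ e, q (LinearEquiv.ofInjective j hj e) = M⁻¹ * e z := fun e =>
    congrArg ev ((LinearEquiv.ofInjective j hj).symm_apply_apply e)
  obtain ⟨χ, hχ, hχN⟩ := exists_extension_of_le_sublinear q (fun p => ‖p.1 ⊔ 0‖ + ‖p.2 ⊔ 0‖)
    (fun a ha p => by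
      rw [Prod.smul_fst, Prod.smul_snd, norm_smul_sup_zero ha, norm_smul_sup_zero ha, mul_add])
    (fun p p' => by
      have h1 := norm_add_sup_zero_le p.1 p'.1
      have h2 := norm_add_sup_zero_le p.2 p'.2
      rw [Prod.fst_add, Prod.snd_add]
      linarith)
    (fun p => by
      obtain ⟨e, rfl⟩ := (LinearEquiv.ofInjective j hj).surjective p
      rw [hq]
      refine le_trans ?_ (norm_le_norm_sup_zero_add (S e))
      rw [inv_mul_le_iff₀ hM]
      exact ((le_abs_self _).trans (e.norm_coe_le_norm z)).trans (hS e))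
  have hχS : ∀ e, χ (S e, -S e) = M⁻¹ * e z := fun e =>
    (hχ (LinearEquiv.ofInjective j hj e)).trans (hq e)
  refine ⟨fun f => χ (f, 0), ⟨fun f g => ?_, fun a f => ?_, fun f => ?_⟩,
    fun f => χ (0, f), ⟨fun f g => ?_, fun a f => ?_, fun f => ?_⟩, fun e => ?_⟩
  · rw [← map_add, Prod.mk_add_mk, add_zero]
  · rw [← smul_eq_mul, ← map_smul, Prod.smul_mk, smul_zero]
  · simpa using hχN (f, 0)
  · rw [← map_add, Prod.mk_add_mk, add_zero]
  · rw [← smul_eq_mul, ← map_smul, Prod.smul_mk, smul_zero]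
  · simpa using hχN (0, f)
  · rw [← map_sub, Prod.mk_sub_mk, sub_zero, zero_sub, hχS, mul_inv_cancel_left₀ hM.ne']

/-- If `C(Z, ℝ)` embeds isomorphically into `C(Y, ℝ)` and `Y` is Eberlein compact, then so is
`Z`. -/
theorem isEberleinCompact_of_norm_le [T2Space Z] (hY : IsEberleinCompact Y)
    (S : C(Z, ℝ) →ₗ[ℝ] C(Y, ℝ)) {M : ℝ} (hM : 0 < M) (hS : ∀ e, ‖e‖ ≤ M * ‖S e‖) :
    IsEberleinCompact Z := by
  let δ : Z → C(Z, ℝ) → ℝ := fun z e => e z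
  have hδ : IsClosedEmbedding δ := Continuous.isClosedEmbedding
    (continuous_pi fun e => e.continuous)
    fun z z' h => eq_of_forall_continuousMap_eq fun e => congrFun h e
  let R : (C(Y, ℝ) → ℝ) × (C(Y, ℝ) → ℝ) → C(Z, ℝ) → ℝ := fun p e => M * (p.1 (S e) - p.2 (S e))
  have hR : Continuous R := continuous_pi fun e => continuous_const.mul
    (((continuous_apply (S e)).comp continuous_fst).sub
      ((continuous_apply (S e)).comp continuous_snd))
  let X : Set ((C(Y, ℝ) → ℝ) × (C(Y, ℝ) → ℝ)) :=
    positiveBall Y ×ˢ positiveBall Y ∩ R ⁻¹' range δ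
  have hX : IsEberleinCompact X := isEberleinCompact_of_isClosed hY
    (((isCompact_positiveBall Y).isClosed.prod (isCompact_positiveBall Y).isClosed).inter
      (hδ.isClosed_range.preimage hR)) inter_subset_left
  choose F hF using fun p : X => p.2.2
  refine isEberleinCompact_of_surjective hX (f := F) ?_ fun z => ?_
  · rw [hδ.isInducing.continuous_iff]
    exact (hR.comp continuous_subtype_val).congr fun p => (hF p).symm
  · obtain ⟨φ, hφ, φ', hφ', he⟩ := exists_mem_positiveBall S hM hS z
    have hz : R (φ, φ') = δ z := funext he
    refine ⟨⟨(φ, φ'), ⟨hφ, hφ'⟩, z, hz.symm⟩, hδ.injective ?_⟩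
    rw [hF]
    exact hz

end PositiveBall

end EberleinCompact

/-- Let `K` and `L` be compact Hausdorff spaces, and let `T : C_p(K) → C_p(L)` be a
linear map which is a homeomorphism onto its image, with closed image. If `L` is
Eberlein compact, then so is `K`. -/
theorem stmt11 (K L : Type u) [TopologicalSpace K] [CompactSpace K] [T2Space K]
    [TopologicalSpace L] [CompactSpace L] [T2Space L]
    (T : Cp K →ₗ[ℝ] Cp L)
    (hTemb : Topology.IsEmbedding T) (hTclosed : IsClosed (Set.range T))
    (hL : IsEberleinCompact L) :
    IsEberleinCompact K := by
  let S : C(K, ℝ) →ₗ[ℝ] C(L, ℝ) :=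
    { toFun := fun e => ⟨(T ⟨e, e.continuous⟩ : L → ℝ), (T ⟨e, e.continuous⟩).2⟩
      map_add' := fun e e' => ContinuousMap.ext fun y =>
        congrFun (congrArg Subtype.val (map_add T ⟨e, e.continuous⟩ ⟨e', e'.continuous⟩)) y
      map_smul' := fun a e => ContinuousMap.ext fun y =>
        congrFun (congrArg Subtype.val (map_smul T a ⟨e, e.continuous⟩)) y }
  let jK : C(K, ℝ) → Cp K := fun e => ⟨e, e.continuous⟩
  let jL : C(L, ℝ) → Cp L := fun e => ⟨e, e.continuous⟩
  have hjK : Continuous jK :=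
    (continuous_pi fun x => ContinuousEvalConst.continuous_eval_const x).subtype_mk _
  have hjL : Continuous jL :=
    (continuous_pi fun x => ContinuousEvalConst.continuous_eval_const x).subtype_mk _
  have hjLinj : Function.Injective jL := fun e e' h => DFunLike.coe_injective (congrArg Subtype.val h)
  have hjS : ∀ e, jL (S e) = T (jK e) := fun e => rfl
  have hgraph : IsClosed (S.graph : Set (C(K, ℝ) × C(L, ℝ))) := by
    have : (S.graph : Set (C(K, ℝ) × C(L, ℝ))) = {p | jL p.2 = T (jK p.1)} := by
      ext p
      rw [SetLike.mem_coe, LinearMap.mem_graph_iff, Set.mem_ofPred, ← hjS, hjLinj.eq_iff]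
    rw [this]
    exact isClosed_eq (hjL.comp continuous_snd)
      (hTemb.continuous.comp (hjK.comp continuous_fst))
  have hinj : Function.Injective S := fun e e' h =>
    DFunLike.coe_injective (congrArg Subtype.val (hTemb.injective (congrArg jL h)))
  have hrange : IsClosed (Set.range S) := by
    have : Set.range S = jL ⁻¹' Set.range T := by
      ext f
      constructor
      · rintro ⟨e, rfl⟩
        exact ⟨jK e, rfl⟩
      · rintro ⟨e, he⟩
        exact ⟨⟨e.1, e.2⟩, hjLinj he⟩
    rw [this]
    exact hTclosed.preimage hjL
  obtain ⟨M, hM⟩ := (ContinuousLinearMap.ofIsClosedGraph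
    hgraph).antilipschitz_of_injective_of_isClosed_range hinj hrange
  refine EberleinCompact.isEberleinCompact_of_norm_le hL S (M := M + 1) (by positivity) fun e => ?_
  have h := hM.le_mul_dist e 0
  rw [ContinuousLinearMap.coeFn_ofIsClosedGraph, map_zero, dist_zero_right, dist_zero_right] at h
  exact h.trans (mul_le_mul_of_nonneg_right (by linarith) (norm_nonneg _))
end

section
/- Let K be an Eberlein compact space and let L be an NY compact space. If there exists a linear map T : C_p(K) → C_p(L) which is a homeomorphism onto its image, then K is NY compact as well. -/
universe u

/-- The zero point of the Hilbert cube `I^ω = [0,1]^ℕ`. -/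
def hilbertZero : ℕ → Set.Icc (0 : ℝ) 1 :=
  fun _ => ⟨0, Set.left_mem_Icc.mpr zero_le_one⟩

/-- A space is NY compact if it is a compact Hausdorff space homeomorphic to a subspace
of the σ-product `σ(I^ω, Γ) = {x ∈ (I^ω)^Γ : x γ = 0 for all but finitely many γ}` of
Hilbert cubes, for some index set `Γ`. -/
def IsNYCompact (K : Type u) [TopologicalSpace K] : Prop :=
  CompactSpace K ∧ T2Space K ∧
    ∃ (Γ : Type u) (f : K → Γ → ℕ → Set.Icc (0 : ℝ) 1),
      Topology.IsEmbedding f ∧ ∀ k, {γ | f k γ ≠ hilbertZero}.Finite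

open Set

/-- A well-founded linear order admitting a strictly antitone map on `S` into a well-founded order
forces `S` to be finite. -/
theorem finite_of_strictAntiOn_wellFoundedLT {α β : Type*} [LinearOrder α] [WellFoundedLT α]
    [Preorder β] [WellFoundedLT β] {S : Set α} {f : α → β} (hf : StrictAntiOn f S) :
    S.Finite := by
  by_contra hS
  have : Infinite S := Set.infinite_coe_iff.2 hS
  let g := Infinite.natEmbedding S
  obtain ⟨k, hk | hk⟩ := exists_increasing_or_nonincreasing_subseq (· < ·) (fun n => (g n : α))
  · exact not_strictAnti_of_wellFoundedLT (fun n => f (g (k n)))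
      fun m n hmn => hf (g (k m)).2 (g (k n)).2 (hk m n hmn)
  · refine not_strictAnti_of_wellFoundedLT (fun n => (g (k n) : α)) fun m n hmn => ?_
    refine lt_of_le_of_ne (not_lt.1 (hk m n hmn)) fun h => hmn.ne' ?_
    exact k.injective (g.injective (Subtype.ext h))

/-- A set is closed under a countable-set-valued operation `H` on finite sets of points labelled
by `Q`. -/
def FinitarilyClosed {Γ Q : Type*} (H : Finset (Γ × Q) → Set Γ) (A : Set Γ) : Prop :=
  ∀ D : Finset (Γ × Q), (∀ d ∈ D, d.1 ∈ A) → H D ⊆ A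

/-- The smallest `FinitarilyClosed` set containing `E`. -/
def finitaryClosure {Γ Q : Type*} (H : Finset (Γ × Q) → Set Γ) (E : Set Γ) : Set Γ :=
  ⋂₀ {A | E ⊆ A ∧ FinitarilyClosed H A}

section finitaryClosure

variable {Γ : Type u} {Q : Type} {H : Finset (Γ × Q) → Set Γ}

theorem subset_finitaryClosure (E : Set Γ) : E ⊆ finitaryClosure H E :=
  subset_sInter fun _ hA => hA.1

theorem finitaryClosure_mono {E E' : Set Γ} (h : E ⊆ E') :
    finitaryClosure H E ⊆ finitaryClosure H E' :=
  sInter_subset_sInter fun _ hA => ⟨h.trans hA.1, hA.2⟩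

theorem finitarilyClosed_finitaryClosure (E : Set Γ) :
    FinitarilyClosed H (finitaryClosure H E) := by
  intro D hD
  exact subset_sInter fun A hA => hA.2 D fun d hd => hD d hd A hA

open Cardinal in
theorem mk_finitaryClosure_le [Countable Q] (hH : ∀ D, (H D).Countable) (E : Set Γ) :
    #(finitaryClosure H E) ≤ max #E ℵ₀ := by
  classical
  let step : Set Γ → Set Γ := fun A =>
    A ∪ ⋃ D : Finset (A × Q), H (D.image fun d => ((d.1 : Γ), d.2))
  have hstep : ∀ A : Set Γ, #A ≤ max #E ℵ₀ → #(step A) ≤ max #E ℵ₀ := by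
    intro A hA
    have hfin : #(Finset (A × Q)) ≤ max #E ℵ₀ := by
      rcases finite_or_infinite (A × Q) with h | h
      · exact (mk_lt_aleph0).le.trans (le_max_right _ _)
      · rw [mk_finset_of_infinite, mk_prod]
        refine (mul_le_max _ _).trans (max_le (max_le ?_ ?_) (le_max_right _ _))
        · simpa using hA
        · refine le_trans ?_ (le_max_right _ _)
          simp
    refine (mk_union_le _ _).trans ((add_le_max _ _).trans
      (max_le (max_le hA ?_) (le_max_right _ _)))
    refine (mk_iUnion_le _).trans ((mul_le_max _ _).trans
      (max_le (max_le hfin ?_) (le_max_right _ _)))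
    exact (ciSup_le' fun D => (hH _).le_aleph0).trans (le_max_right _ _)
  let A : ℕ → Set Γ := fun n => step^[n] E
  have hA : ∀ n, A (n + 1) = step (A n) := fun n => Function.iterate_succ_apply' _ _ _
  have hcard : ∀ n, #(A n) ≤ max #E ℵ₀ := by
    intro n
    induction n with
    | zero => exact le_max_left _ _
    | succ n ih => rw [hA]; exact hstep _ ih
  have hmono : Monotone A := monotone_nat_of_le_succ fun n => by
    rw [hA]; exact subset_union_left
  have hclosed : FinitarilyClosed H (⋃ n, A n) := by
    intro D hD
    have hex : ∃ n, ∀ d ∈ D, d.1 ∈ A n := by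
      choose! n hn using fun d hd => mem_iUnion.1 (hD d hd)
      exact ⟨D.sup n, fun d hd => hmono (Finset.le_sup hd) (hn d hd)⟩
    obtain ⟨n, hn⟩ := hex
    refine subset_trans ?_ (subset_iUnion A (n + 1))
    rw [hA]
    refine subset_trans ?_ subset_union_right
    refine subset_trans ?_ (subset_iUnion _
      (D.attach.image fun d => ((⟨d.1.1, hn _ d.2⟩ : A n), d.1.2)))
    rw [Finset.image_image]
    simp only [Function.comp_def, Finset.attach_image_val, Prod.mk.eta]
    rfl
  have hsub : finitaryClosure H E ⊆ ⋃ n, A n :=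
    sInter_subset_of_mem ⟨subset_iUnion A 0, hclosed⟩
  refine (mk_le_mk_of_subset hsub).trans ?_
  have hunion := mk_iUnion_le_lift A
  simp only [lift_uzero, mk_nat, lift_aleph0] at hunion
  refine hunion.trans ((mul_le_max _ _).trans
    (max_le (max_le (le_max_right _ _) (ciSup_le' hcard)) (le_max_right _ _)))

end finitaryClosure

open Cardinal in
/-- If, along inclusions of sets closed under a finitary operation, every member of a hereditary
family `𝒮` can gain elements only finitely often, then the index set splits into countable blocks
such that every member of `𝒮` meets only finitely many of them. -/
theorem exists_countable_blocks {Γ : Type u} {Q : Type} [Countable Q]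
    {H : Finset (Γ × Q) → Set Γ} (hH : ∀ D, (H D).Countable) (𝒮 : Set (Set Γ))
    (hinter : ∀ S ∈ 𝒮, ∀ A, FinitarilyClosed H A → S ∩ A ∈ 𝒮)
    (hrank : ∀ S ∈ 𝒮, ∃ τ : Set Γ → Ordinal.{u}, ∀ A A', FinitarilyClosed H A →
      FinitarilyClosed H A' → A ⊆ A' → (S ∩ (A' \ A)).Nonempty → τ A' < τ A) (A : Set Γ) :
    ∃ (J : Type u) (b : Γ → J), (∀ j, (A ∩ b ⁻¹' {j}).Countable) ∧
      ∀ S ∈ 𝒮, S ⊆ A → (b '' S).Finite := by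
  classical
  induction hκ : #A using WellFoundedLT.induction generalizing A with
  | ind κ ih =>
  subst hκ
  rcases le_or_gt #A ℵ₀ with hA | hA
  · exact ⟨PUnit, fun _ => PUnit.unit, fun j => (le_aleph0_iff_set_countable.1 hA).mono
      inter_subset_left, fun S _ _ => Set.toFinite _⟩
  obtain ⟨_, _, hord⟩ := exists_ord_eq_type_lt A
  let C : A → Set Γ := fun a => finitaryClosure H ((↑) '' Iic a)
  have hCcard : ∀ a, #(C a) < #A := by
    intro a
    refine (mk_finitaryClosure_le hH _).trans_lt (max_lt (mk_image_le.trans_lt ?_) hA)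
    rw [← Iio_insert]
    exact (mk_insert_le).trans_lt (add_lt_of_lt hA.le (mk_Iio_lt a hord) (one_lt_aleph0.trans hA))
  have hCmono : Monotone C := fun a a' h => finitaryClosure_mono (image_mono (Iic_subset_Iic.2 h))
  have hC : ∀ a, FinitarilyClosed H (C a) := fun a => finitarilyClosed_finitaryClosure _
  choose J b hb hfin using fun a => ih _ (hCcard a) (C a) rfl
  have hex : ∀ x : A, ∃ a, (x : Γ) ∈ C a := fun x =>
    ⟨x, subset_finitaryClosure _ ⟨x, mem_Iic.2 le_rfl, rfl⟩⟩
  choose s hs hmin using fun x : A => WellFounded.has_min (wellFounded_lt (α := A))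
    {a | (x : Γ) ∈ C a} (hex x)
  refine ⟨Option (Σ a : A, J a), fun x => if hx : x ∈ A then some ⟨s ⟨x, hx⟩, b _ x⟩ else none,
    ?_, ?_⟩
  · rintro (_ | ⟨a, j⟩)
    · refine countable_empty.mono ?_
      rintro x ⟨hx, h⟩
      simp [hx] at h
    · refine (hb a j).mono ?_
      rintro x ⟨hx, h⟩
      simp only [mem_preimage, hx, dif_pos, mem_singleton_iff, Option.some.injEq] at h
      obtain ⟨rfl, h⟩ := Sigma.mk.inj_iff.1 h
      exact ⟨hs ⟨x, hx⟩, eq_of_heq h⟩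
  · intro S hS hSA
    obtain ⟨τ, hτ⟩ := hrank S hS
    let R : Set A := {a | ∃ x : A, (x : Γ) ∈ S ∧ s x = a}
    have hR : R.Finite := by
      refine finite_of_strictAntiOn_wellFoundedLT (f := fun a => τ (C a)) ?_
      rintro c - a ⟨x, hxS, rfl⟩ hca
      refine hτ _ _ (hC _) (hC _) (hCmono hca.le) ⟨x, hxS, hs x, fun hx => ?_⟩
      exact hmin x c hx hca
    refine (hR.biUnion fun a _ => ((hfin a (S ∩ C a) (hinter S hS _ (hC a))
      inter_subset_right).image fun j => some (⟨a, j⟩ : Σ a : A, J a))).subset ?_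
    rintro _ ⟨x, hx, rfl⟩
    simp only [hSA hx, dif_pos, mem_iUnion]
    exact ⟨s ⟨x, hSA hx⟩, ⟨⟨x, hSA hx⟩, hx, rfl⟩, _, ⟨x, ⟨hx, hs ⟨x, hSA hx⟩⟩, rfl⟩, rfl⟩

section rank

/-- The increasing transfinite sequence of sets generated by the enlargement `O ↦ O ∪ U O`. -/
noncomputable def transfiniteLayers {X : Type u} (U : Set X → Set X) (α : Ordinal.{u}) : Set X :=
  ⋃ β : Iio α, transfiniteLayers U β ∪ U (transfiniteLayers U β)
termination_by α
decreasing_by all_goals exact β.2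

/-- If every nonempty closed set has a nonempty relatively open subset satisfying `P`, then the
space carries an upper semicontinuous ordinal-valued rank whose fibers satisfy `P`. -/
theorem exists_rank {X : Type u} [TopologicalSpace X] {P : Set X → Prop}
    (h : ∀ F : Set X, IsClosed F → F.Nonempty →
      ∃ U, IsOpen U ∧ (U ∩ F).Nonempty ∧ P (U ∩ F)) :
    ∃ ρ : X → Ordinal.{u}, (∀ α, IsOpen {x | ρ x < α}) ∧ ∀ x, P {x' | ρ x' = ρ x} := by
  have h' : ∀ O : Set X, ∃ U, IsOpen O →
      IsOpen U ∧ (O ≠ univ → (U ∩ Oᶜ).Nonempty ∧ P (U ∩ Oᶜ)) := by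
    intro O
    by_cases hO : IsOpen O ∧ O ≠ univ
    · obtain ⟨U, hU⟩ := h Oᶜ hO.1.isClosed_compl (nonempty_compl.2 hO.2)
      exact ⟨U, fun _ => ⟨hU.1, fun _ => hU.2⟩⟩
    · exact ⟨∅, fun hO' => ⟨isOpen_empty, fun hne => absurd ⟨hO', hne⟩ hO⟩⟩
  choose U hU using h'
  let G : Ordinal.{u} → Set X := transfiniteLayers U
  have hG : ∀ α x, x ∈ G α ↔ ∃ β < α, x ∈ G β ∪ U (G β) := by
    intro α x
    simp only [G]
    conv_lhs => rw [transfiniteLayers]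
    simp
  have hopen : ∀ α, IsOpen (G α) := by
    intro α
    induction α using WellFoundedLT.induction with
    | ind α ih =>
    have : G α = ⋃ β : Iio α, G β ∪ U (G β) := by
      simp only [G]
      conv_lhs => rw [transfiniteLayers]
    rw [this]
    exact isOpen_iUnion fun β => (ih β β.2).union (hU _ (ih β β.2)).1
  have hex : ∀ x, ∃ α, x ∈ G α ∪ U (G α) := by
    intro x
    by_contra! hx
    have hne : ∀ α, G α ≠ univ := fun α hα => hx α (Or.inl (hα ▸ mem_univ x))
    choose p hp using fun α => ((hU _ (hopen α)).2 (hne α)).1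
    refine not_injective_of_ordinal p fun α β hαβ => ?_
    have key : ∀ α β, α < β → p α ≠ p β := fun α β hlt heq =>
      (hp β).2 (heq ▸ (hG β _).2 ⟨α, hlt, Or.inr (hp α).1⟩)
    rcases lt_trichotomy α β with hlt | heq | hlt
    · exact absurd hαβ (key _ _ hlt)
    · exact heq
    · exact absurd hαβ.symm (key _ _ hlt)
  choose ρ hρ hmin using fun x : X => WellFounded.has_min (wellFounded_lt (α := Ordinal.{u}))
    {α | x ∈ G α ∪ U (G α)} (hex x)
  have hlt : ∀ x α, ρ x < α ↔ x ∈ G α := by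
    intro x α
    rw [hG]
    refine ⟨fun hx => ⟨_, hx, hρ x⟩, ?_⟩
    rintro ⟨β, hβ, hx⟩
    exact (not_lt.1 (hmin x β hx)).trans_lt hβ
  refine ⟨ρ, fun α => ?_, fun x => ?_⟩
  · simpa only [hlt, ofPred_mem_eq] using hopen α
  · have hx : x ∉ G (ρ x) := fun hx => lt_irrefl _ ((hlt x _).2 hx)
    have heq : {x' | ρ x' = ρ x} = U (G (ρ x)) ∩ (G (ρ x))ᶜ := by
      ext x'
      constructor
      · intro hx'
        have hx'' : x' ∉ G (ρ x) := fun hm => ((hlt x' _).2 hm).ne hx'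
        have := hρ x'
        rw [show ρ x' = ρ x from hx'] at this
        exact ⟨this.resolve_left hx'', hx''⟩
      · rintro ⟨h1, h2⟩
        exact le_antisymm (not_lt.1 (hmin x' _ (Or.inr h1)))
          (not_lt.1 fun hm => h2 ((hlt x' _).1 hm))
    rw [heq]
    exact ((hU _ (hopen _)).2 fun hu => hx (hu ▸ mem_univ x)).2

variable {K : Type u} {Γ : Type u}

/-- The points of `K` whose coordinates satisfy finitely many rational bounds. -/
def rationalBox (e : K → Γ → ℝ) (D : Finset (Γ × ℚ × ℚ)) : Set K :=
  {x | ∀ d ∈ D, (d.2.1 : ℝ) ≤ e x d.1 ∧ e x d.1 ≤ d.2.2}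

/-- The coordinates at which some point of `K`, of the same rank as the points of maximal rank in
`rationalBox e D`, does not vanish. -/
def topRankSupport (e : K → Γ → ℝ) (ρ : K → Ordinal.{u}) (D : Finset (Γ × ℚ × ℚ)) : Set Γ :=
  {γ | ∃ x ∈ rationalBox e D, (∀ x' ∈ rationalBox e D, ρ x' ≤ ρ x) ∧ ∃ z, ρ z = ρ x ∧ e z γ ≠ 0}

theorem countable_topRankSupport {e : K → Γ → ℝ} {ρ : K → Ordinal.{u}}
    (hρ : ∀ x, {γ | ∃ z, ρ z = ρ x ∧ e z γ ≠ 0}.Countable) (D : Finset (Γ × ℚ × ℚ)) :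
    (topRankSupport e ρ D).Countable := by
  rcases (topRankSupport e ρ D).eq_empty_or_nonempty with h | ⟨_, x, hx, hmax, _⟩
  · simp [h]
  · refine (hρ x).mono ?_
    rintro γ ⟨x', hx', hmax', h⟩
    rwa [le_antisymm (hmax x' hx') (hmax' x hx)] at h

variable [TopologicalSpace K]

theorem isClosed_rationalBox {e : K → Γ → ℝ} (he : Continuous e) (D : Finset (Γ × ℚ × ℚ)) :
    IsClosed (rationalBox e D) := by
  simp only [rationalBox, ofPred_forall]
  refine isClosed_biInter fun d _ => ?_
  have := (continuous_apply d.1).comp he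
  exact (isClosed_le continuous_const this).inter (isClosed_le this continuous_const)

/-- Restricting a point of `K` to a closed set of coordinates gives a point of `K` which maximizes
the rank on some neighbourhood of the given point determined by these coordinates. -/
theorem exists_restriction [CompactSpace K] {e : K → Γ → ℝ} (he : Continuous e)
    {ρ : K → Ordinal.{u}} (hρ : ∀ α, IsOpen {x | ρ x < α}) {A : Set Γ}
    (hA : FinitarilyClosed (topRankSupport e ρ) A) (y : K) :
    ∃ (z : K) (D : Finset (Γ × ℚ × ℚ)), e z = A.indicator (e y) ∧ (∀ d ∈ D, d.1 ∈ A) ∧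
      y ∈ rationalBox e D ∧ (∀ x ∈ rationalBox e D, ρ x ≤ ρ z) ∧
      ∀ x, ρ x = ρ z → ∀ γ, e x γ ≠ 0 → γ ∈ A := by
  classical
  have hmax : ∀ D, y ∈ rationalBox e D →
      ∃ x ∈ rationalBox e D, ∀ x' ∈ rationalBox e D, ρ x' ≤ ρ x := fun D hD =>
    UpperSemicontinuousOn.exists_isMaxOn ⟨y, hD⟩ (isClosed_rationalBox he D).isCompact
      fun x _ α hα => (nhdsWithin_le_nhds ((hρ α).mem_nhds hα))
  let ι := {D : Finset (Γ × ℚ × ℚ) // (∀ d ∈ D, d.1 ∈ A) ∧ y ∈ rationalBox e D}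
  choose m hm hmle using fun D : ι => hmax D.1 D.2.2
  have hι : Nonempty ι := ⟨⟨∅, by simp [rationalBox]⟩⟩
  obtain ⟨D₀, hD₀⟩ : ∃ D₀ : ι, ∀ D : ι, ρ (m D₀) ≤ ρ (m D) := by
    obtain ⟨D₀, -, hD₀⟩ := WellFounded.has_min (InvImage.wf (fun D : ι => ρ (m D)) wellFounded_lt)
      univ ⟨hι.some, mem_univ _⟩
    exact ⟨D₀, fun D => not_lt.1 (hD₀ D (mem_univ _))⟩
  have hunion : ∀ D D', rationalBox e (D ∪ D') = rationalBox e D ∩ rationalBox e D' := by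
    intro D D'
    ext x
    simp only [rationalBox, Finset.mem_union, mem_inter_iff, mem_ofPred]
    grind
  let un : ι → ι → ι := fun D D' => ⟨D.1 ∪ D'.1, by
    intro d hd
    exact (Finset.mem_union.1 hd).elim (D.2.1 d) (D'.2.1 d), by
    rw [hunion]; exact ⟨D.2.2, D'.2.2⟩⟩
  have hne : (⋂ D : ι, rationalBox e (un D₀ D).1 ∩ {x | ρ (m D₀) ≤ ρ x}).Nonempty := by
    have hcl : ∀ D : ι, IsClosed (rationalBox e (un D₀ D).1 ∩ {x | ρ (m D₀) ≤ ρ x}) := by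
      intro D
      refine (isClosed_rationalBox he _).inter ?_
      simpa only [← isOpen_compl_iff, compl_ofPred, not_le] using hρ (ρ (m D₀))
    refine IsCompact.nonempty_iInter_of_directed_nonempty_isCompact_isClosed _ ?_
      (fun D => ⟨m (un D₀ D), hm _, hD₀ _⟩) (fun D => (hcl D).isCompact) hcl
    intro D D'
    refine ⟨un D D', ?_, ?_⟩ <;>
    · simp only [un, hunion]
      grind
  obtain ⟨z, hz⟩ := hne
  rw [mem_iInter] at hz
  have hzD : ∀ D : ι, z ∈ rationalBox e D.1 := fun D => by
    have := (hz D).1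
    simp only [un, hunion] at this
    exact this.2
  have hρz : ρ z = ρ (m D₀) := le_antisymm (hmle _ _ (hzD D₀)) (hz D₀).2
  have hsupp : ∀ x, ρ x = ρ z → ∀ γ, e x γ ≠ 0 → γ ∈ A := fun x hx γ hγ =>
    hA D₀.1 D₀.2.1 ⟨m D₀, hm D₀, hmle D₀, x, hx.trans hρz, hγ⟩
  refine ⟨z, D₀.1, ?_, D₀.2.1, D₀.2.2, fun x hx => (hmle D₀ x hx).trans_eq hρz.symm, hsupp⟩
  ext γ
  by_cases hγ : γ ∈ A
  · rw [indicator_of_mem hγ]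
    have hbox : ∀ p q : ℚ, (p : ℝ) ≤ e y γ → e y γ ≤ q → (p : ℝ) ≤ e z γ ∧ e z γ ≤ q := by
      intro p q hp hq
      have := hzD ⟨{(γ, p, q)}, by simpa using hγ, by simp [rationalBox, hp, hq]⟩
      simpa [rationalBox] using this
    refine le_antisymm (le_of_not_gt fun hlt => ?_) (le_of_not_gt fun hlt => ?_)
    · obtain ⟨q, hq, hq'⟩ := exists_rat_btwn hlt
      obtain ⟨p, hp⟩ := exists_rat_lt (e y γ)
      exact absurd (hbox p q hp.le hq.le).2 (not_le.2 hq')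
    · obtain ⟨p, hp, hp'⟩ := exists_rat_btwn hlt
      obtain ⟨q, hq⟩ := exists_rat_gt (e y γ)
      exact absurd (hbox p q hp'.le hq.le).1 (not_le.2 hp)
  · rw [indicator_of_notMem hγ]
    by_contra h
    exact hγ (hsupp z rfl γ h)

/-- If `K` carries an upper semicontinuous rank each of whose fibers lives on countably many
coordinates, the coordinates split into countable blocks such that every point of `K` lives on
finitely many of them. -/
theorem exists_blocks_of_rank [CompactSpace K] {e : K → Γ → ℝ} (he : Continuous e)
    {ρ : K → Ordinal.{u}} (hρ : ∀ α, IsOpen {x | ρ x < α})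
    (hcount : ∀ x, {γ | ∃ z, ρ z = ρ x ∧ e z γ ≠ 0}.Countable) :
    ∃ (J : Type u) (b : Γ → J), (∀ j, (b ⁻¹' {j}).Countable) ∧
      ∀ x, (b '' {γ | e x γ ≠ 0}).Finite := by
  classical
  suffices h : ∃ (J : Type u) (b : Γ → J), (∀ j, (univ ∩ b ⁻¹' {j}).Countable) ∧
      ∀ S ∈ range fun x => {γ | e x γ ≠ 0}, S ⊆ univ → (b '' S).Finite by
    obtain ⟨J, b, hb, hfin⟩ := h
    exact ⟨J, b, by simpa using hb, fun x => hfin _ ⟨x, rfl⟩ (subset_univ _)⟩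
  refine exists_countable_blocks (countable_topRankSupport hcount) _ ?_ ?_ univ
  · rintro _ ⟨y, rfl⟩ A hA
    obtain ⟨z, -, hz, -⟩ := exists_restriction he hρ hA y
    refine ⟨z, ?_⟩
    ext γ
    simp [hz, and_comm]
  · rintro _ ⟨y, rfl⟩
    have : Nonempty K := ⟨y⟩
    choose! z D hz hD hyD hmax hsupp using
      fun A (hA : FinitarilyClosed (topRankSupport e ρ) A) => exists_restriction he hρ hA y
    refine ⟨fun A => ρ (z A), fun A A' hA hA' hAA' => ?_⟩
    rintro ⟨γ, hγ, hγA', hγA⟩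
    refine lt_of_le_of_ne (hmax A hA _ fun d hd => ?_) fun heq => ?_
    · rw [hz A' hA', indicator_of_mem (hAA' (hD A hA d hd))]
      exact hyD A hA d hd
    · refine hγA (hsupp A hA _ heq γ ?_)
      rw [hz A' hA', indicator_of_mem hγA']
      exact hγ

end rank

open Filter Topology

/-- Suppose a compact Hausdorff space `K` is covered by countably many continuous images of compact
sets carrying a lower semicontinuous finite-set-valued map `s`. Then every nonempty closed set has
a nonempty relatively open subset covered by the images of finitely many fibers of `s`. -/
theorem exists_relOpen_subset_image_fibers {K ι Λ : Type*} [TopologicalSpace K] [CompactSpace K]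
    [T2Space K] [Countable ι] {E : ι → Type*} [∀ i, TopologicalSpace (E i)] {Z : ∀ i, Set (E i)}
    (hZ : ∀ i, IsCompact (Z i)) {s : ∀ i, E i → Finset Λ}
    (hs : ∀ i z, ∀ᶠ z' in 𝓝 z, s i z ⊆ s i z') {π : ∀ i, E i → K} (hπ : ∀ i, Continuous (π i))
    (hcover : ∀ x, ∃ i, ∃ z ∈ Z i, π i z = x) {F : Set K} (hF : IsClosed F) (hne : F.Nonempty) :
    ∃ U, IsOpen U ∧ (U ∩ F).Nonempty ∧ ∃ (i : ι) (𝒯 : Finset (Finset Λ)),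
      ∀ x ∈ U ∩ F, ∃ z ∈ Z i, π i z = x ∧ s i z ∈ 𝒯 := by
  classical
  let C : ι → ℕ → Set K := fun i j => π i '' (Z i ∩ {z | (s i z).card ≤ j})
  have hcard : ∀ i j, IsClosed {z | (s i z).card ≤ j} := by
    intro i j
    rw [← isOpen_compl_iff, isOpen_iff_mem_nhds]
    intro z hz
    filter_upwards [hs i z] with z' hz' hle
    exact hz ((Finset.card_le_card hz').trans hle)
  have hC : ∀ i j, IsCompact (Z i ∩ {z | (s i z).card ≤ j}) := fun i j =>
    (hZ i).inter_right (hcard i j)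
  have hCclosed : ∀ i j, IsClosed (C i j) := fun i j => ((hC i j).image (hπ i)).isClosed
  have : Nonempty F := hne.to_subtype
  have : CompactSpace F := isCompact_iff_compactSpace.1 hF.isCompact
  obtain ⟨⟨i, j⟩, x, hx⟩ := nonempty_interior_of_iUnion_of_closed
    (f := fun p : ι × ℕ => ((↑) : F → K) ⁻¹' C p.1 p.2)
    (fun p => (hCclosed _ _).preimage continuous_subtype_val) (by
      refine eq_univ_of_forall fun x => ?_
      obtain ⟨i, z, hz, hzx⟩ := hcover x
      exact mem_iUnion.2 ⟨(i, (s i z).card), z, ⟨hz, show (s i z).card ≤ (s i z).card from le_rfl⟩, hzx⟩)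
  obtain ⟨_, ⟨⟨U, hU, rfl⟩, hVsub⟩, hxU⟩ := hx
  have hP : ∃ j, ∃ U, IsOpen U ∧ (U ∩ F).Nonempty ∧ U ∩ F ⊆ C i j :=
    ⟨j, U, hU, ⟨x, hxU, x.2⟩, fun y hy => @hVsub ⟨y, hy.2⟩ hy.1⟩
  obtain ⟨U, hU, hUne, hUsub⟩ := Nat.find_spec hP
  set k := Nat.find hP with hk
  obtain ⟨x, hx, hxk⟩ : ∃ x ∈ U ∩ F, ∀ z ∈ Z i, π i z = x → k ≤ (s i z).card := by
    by_contra! hcon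
    have hpos : k ≠ 0 := by
      rintro h0
      obtain ⟨y, hy⟩ := hUne
      obtain ⟨z, -, -, hz⟩ := hcon y hy
      omega
    refine Nat.find_min hP (m := k - 1) (by omega) ⟨U, hU, hUne, fun y hy => ?_⟩
    obtain ⟨z, hz, hzy, hlt⟩ := hcon y hy
    exact ⟨z, ⟨hz, show (s i z).card ≤ k - 1 by omega⟩, hzy⟩
  obtain ⟨t, ht, htsub⟩ := ((hC i k).inter_right (isClosed_singleton.preimage (hπ i) :
    IsClosed (π i ⁻¹' {x}))).elim_nhds_subcover (fun z => interior {z' | s i z ⊆ s i z'})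
    fun z _ => interior_mem_nhds.2 (hs i z)
  refine ⟨U ∩ (π i '' ((Z i ∩ {z | (s i z).card ≤ k}) \
    ⋃ z ∈ t, interior {z' | s i z ⊆ s i z'}))ᶜ, ?_, ⟨x, ⟨hx.1, ?_⟩, hx.2⟩, i, t.image (s i), ?_⟩
  · exact hU.inter (((hC i k).diff (isOpen_biUnion fun _ _ => isOpen_interior)).image
      (hπ i)).isClosed.isOpen_compl
  · rintro ⟨z, ⟨hz, hzt⟩, hzx⟩
    exact hzt (htsub ⟨hz, hzx⟩)
  · rintro y ⟨⟨hyU, hy⟩, hyF⟩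
    obtain ⟨z, hz, hzy⟩ := hUsub ⟨hyU, hyF⟩
    refine ⟨z, hz.1, hzy, ?_⟩
    have hzt : z ∈ ⋃ z ∈ t, interior {z' | s i z ⊆ s i z'} := by
      by_contra hzt
      exact hy ⟨z, ⟨hz, hzt⟩, hzy⟩
    obtain ⟨w, hwt, hw⟩ := mem_iUnion₂.1 hzt
    have hww := ht w hwt
    exact Finset.mem_image.2 ⟨w, hwt, Finset.eq_of_subset_of_card_le (interior_subset hw)
      (hz.2.trans (hxk w hww.1.1 hww.2))⟩

section Cp

variable {K L : Type u} [TopologicalSpace K] [TopologicalSpace L]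

/-- If `T : C_p(K) → C_p(L)` is a linear embedding, every evaluation on `K` is a finite linear
combination of evaluations on `L` composed with `T`. -/
theorem exists_eval_eq_sum (T : Cp K →ₗ[ℝ] Cp L) (hT : IsEmbedding T) (x : K) :
    ∃ (n : ℕ) (a : Fin n → ℝ) (y : Fin n → L), ∀ f : Cp K, f.1 x = ∑ i, a i * (T f).1 (y i) := by
  let ev : L → Cp K →ₗ[ℝ] ℝ := fun y => (LinearMap.proj y).comp ((cpSubmodule L).subtype.comp T)
  let δ : Cp K →ₗ[ℝ] ℝ := (LinearMap.proj x).comp (cpSubmodule K).subtype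
  have htop : (inferInstance : TopologicalSpace (Cp K)) =
      ⨅ y, TopologicalSpace.induced (ev y) inferInstance := by
    rw [(IsEmbedding.subtypeVal.comp hT).eq_induced, Pi.topologicalSpace, induced_iInf]
    simp only [induced_compose]
    rfl
  have hδ : Continuous δ := (continuous_apply x).comp continuous_subtype_val
  have hmem : δ ∈ Submodule.span ℝ (range ev) := by
    rw [LinearMap.mem_span_iff_continuous, ← htop]
    exact hδ
  obtain ⟨c, hc⟩ := Finsupp.mem_span_range_iff_exists_finsupp.1 hmem
  let q := c.support.equivFin.symm
  refine ⟨_, fun i => c (q i), fun i => q i, fun f => ?_⟩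
  have hf := LinearMap.congr_fun hc f
  rw [Finsupp.sum, LinearMap.sum_apply, ← Finset.sum_coe_sort] at hf
  refine hf.symm.trans ?_
  rw [← Equiv.sum_comp q]
  rfl

/-- The set of coordinates not vanishing at some point of `K` represented over a second countable
family of points of `L` is countable. -/
theorem countable_support_of_secondCountable {Γ : Type u} {e : K → Γ → ℝ} (he : Continuous e)
    (hcount : ∀ x, {γ | e x γ ≠ 0}.Countable) (T : Cp K → Cp L) (n : ℕ) (M : Set L)
    [SecondCountableTopology M] :
    {γ | ∃ x, (∃ (a : Fin n → ℝ) (y : Fin n → M),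
      ∀ f : Cp K, f.1 x = ∑ i, a i * (T f).1 (y i)) ∧ e x γ ≠ 0}.Countable := by
  let R : Set ((Fin n → ℝ) × (Fin n → M)) :=
    {p | ∃ x, ∀ f : Cp K, f.1 x = ∑ i, p.1 i * (T f).1 (p.2 i)}
  obtain ⟨Q, hQ, hQd⟩ := TopologicalSpace.exists_countable_dense R
  choose x hx using fun p : R => p.2
  let c : Γ → Cp K := fun γ => ⟨fun k => e k γ, (continuous_apply γ).comp he⟩
  refine (hQ.biUnion fun q _ => hcount (x q)).mono ?_
  rintro γ ⟨x₀, ⟨a, y, hay⟩, hγ⟩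
  by_contra hcon
  have hzero : (fun p : R => ∑ i, p.1.1 i * (T (c γ)).1 (p.1.2 i)) = fun _ => 0 := by
    refine Continuous.ext_on hQd ?_ continuous_const fun q hq => ?_
    · have hTc : Continuous (T (c γ)).1 := (T (c γ)).2
      fun_prop
    · have := hx q (c γ)
      rw [← this]
      by_contra hne
      exact hcon (mem_iUnion₂.2 ⟨q, hq, hne⟩)
  exact hγ ((hay (c γ)).trans (congr_fun hzero ⟨(a, y), x₀, hay⟩))

/-- The points of a compact space embedded in a `σ`-product of Hilbert cubes which are supported on
a given finite set form a second countable subspace. -/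
theorem secondCountable_of_support_subset [CompactSpace L] {Λ : Type u}
    {φ : L → Λ → ℕ → Icc (0 : ℝ) 1} (hφ : IsEmbedding φ) (t : Finset Λ) :
    SecondCountableTopology {y : L | ∀ l ∉ t, φ y l = hilbertZero} := by
  have hcl : IsClosed {y : L | ∀ l ∉ t, φ y l = hilbertZero} := by
    simp only [ofPred_forall]
    exact isClosed_biInter fun l _ =>
      isClosed_singleton.preimage ((continuous_apply l).comp hφ.continuous)
  have : CompactSpace {y : L | ∀ l ∉ t, φ y l = hilbertZero} :=
    isCompact_iff_compactSpace.1 hcl.isCompact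
  have hcont := hφ.continuous
  let r : {y : L | ∀ l ∉ t, φ y l = hilbertZero} → t → ℕ → Icc (0 : ℝ) 1 := fun y l => φ y l
  have hr : Continuous r := by fun_prop
  refine (hr.isClosedEmbedding fun y y' h => ?_).isEmbedding.secondCountableTopology
  refine Subtype.ext (hφ.injective (funext fun l => ?_))
  by_cases hl : l ∈ t
  · exact congr_fun h ⟨l, hl⟩
  · rw [y.2 l hl, y'.2 l hl]

/-- If `C_p(K)` embeds linearly into `C_p(L)` with `L` NY compact, every nonempty closed subset of
`K` has a nonempty relatively open subset living on countably many coordinates. -/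
theorem exists_relOpen_countable_support [CompactSpace K] [T2Space K] (hL : IsNYCompact L)
    {Γ : Type u} {e : K → Γ → ℝ} (he : Continuous e) (hcount : ∀ x, {γ | e x γ ≠ 0}.Countable)
    (T : Cp K →ₗ[ℝ] Cp L) (hT : IsEmbedding T) {F : Set K} (hF : IsClosed F) (hne : F.Nonempty) :
    ∃ U, IsOpen U ∧ (U ∩ F).Nonempty ∧ {γ | ∃ x ∈ U ∩ F, e x γ ≠ 0}.Countable := by
  classical
  obtain ⟨_, _, Λ, φ, hφ, hfin⟩ := hL
  let E : ℕ × ℕ → Type u := fun p => (Fin p.1 → ℝ) × (Fin p.1 → L) × K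
  let Z : ∀ p, Set (E p) := fun p => {z | (∀ i, z.1 i ∈ Icc (-(p.2 : ℝ)) p.2) ∧
    ∀ f : Cp K, f.1 z.2.2 = ∑ i, z.1 i * (T f).1 (z.2.1 i)}
  have hZ : ∀ p, IsCompact (Z p) := by
    intro p
    have hcpt : IsCompact ((univ.pi fun _ : Fin p.1 => Icc (-(p.2 : ℝ)) p.2) ×ˢ
        (univ : Set ((Fin p.1 → L) × K))) :=
      (isCompact_univ_pi fun _ => isCompact_Icc).prod isCompact_univ
    have hcl : IsClosed {z : E p | ∀ f : Cp K, f.1 z.2.2 = ∑ i, z.1 i * (T f).1 (z.2.1 i)} := by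
      simp only [ofPred_forall]
      refine isClosed_iInter fun f => ?_
      have hf : Continuous f.1 := f.2
      have hTf : Continuous (T f).1 := (T f).2
      simp only [E]
      exact isClosed_eq (by fun_prop) (by fun_prop)
    convert hcpt.inter_right hcl using 1
    ext z
    exact ⟨fun h => ⟨⟨fun i _ => h.1 i, trivial⟩, h.2⟩, fun h => ⟨fun i => h.1.1 i trivial, h.2⟩⟩
  let s : ∀ p, E p → Finset Λ := fun p z => Finset.univ.biUnion fun i => (hfin (z.2.1 i)).toFinset
  have hs : ∀ p z, ∀ᶠ z' in 𝓝 z, s p z ⊆ s p z' := by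
    intro p z
    simp only [Finset.subset_iff]
    rw [eventually_all_finset]
    intro l hl
    simp only [s, Finset.mem_biUnion, Finset.mem_univ, true_and, Finite.mem_toFinset] at hl ⊢
    obtain ⟨i, hi⟩ := hl
    have hcont : Continuous fun z : E p => φ (z.2.1 i) l := by
      have := hφ.continuous
      simp only [E]
      fun_prop
    filter_upwards [(isOpen_ne.preimage hcont).mem_nhds hi] with z' hz'
    exact ⟨i, hz'⟩
  obtain ⟨U, hU, hUF, p, 𝒯, h𝒯⟩ := exists_relOpen_subset_image_fibers hZ hs (π := fun p z => z.2.2)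
    (fun p => continuous_snd.comp continuous_snd) (fun x => by
      obtain ⟨n, a, y, hay⟩ := exists_eval_eq_sum T hT x
      obtain ⟨m, hm⟩ := exists_nat_ge (∑ i, |a i|)
      refine ⟨(n, m), (a, y, x), ⟨fun i => ?_, hay⟩, rfl⟩
      exact abs_le.1 ((Finset.single_le_sum (f := fun i => |a i|) (fun i _ => abs_nonneg _)
        (Finset.mem_univ i)).trans hm)) hF hne
  refine ⟨U, hU, hUF, ?_⟩
  have hsmall := fun t : Finset Λ =>
    have := secondCountable_of_support_subset hφ t
    countable_support_of_secondCountable he hcount T p.1 {y : L | ∀ l ∉ t, φ y l = hilbertZero}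
  refine (𝒯.countable_toSet.biUnion fun t _ => hsmall t).mono ?_
  rintro γ ⟨x, hx, hγ⟩
  obtain ⟨z, hz, rfl, hzt⟩ := h𝒯 x hx
  refine mem_iUnion₂.2 ⟨s p z, hzt, z.2.2, ⟨z.1, fun i => ⟨z.2.1 i, fun l hl => ?_⟩, hz.2⟩, hγ⟩
  by_contra hne'
  exact hl (Finset.mem_biUnion.2 ⟨i, Finset.mem_univ _, (hfin _).mem_toFinset.2 hne'⟩)

end Cp

/-- The map `t ↦ t⁺ / (1 + t⁺)` into the unit interval. -/
noncomputable def posSquash (t : ℝ) : Icc (0 : ℝ) 1 :=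
  ⟨max t 0 / (1 + max t 0), by positivity, by
    rw [div_le_one (by positivity)]; linarith⟩

theorem continuous_posSquash : Continuous posSquash := by
  refine Continuous.subtype_mk ?_ _
  refine Continuous.div (by fun_prop) (by fun_prop) fun t => ?_
  positivity

theorem posSquash_zero : posSquash 0 = 0 := by
  ext
  simp [posSquash]

theorem eq_of_posSquash_eq {t t' : ℝ} (hpos : posSquash t = posSquash t')
    (hneg : posSquash (-t) = posSquash (-t')) : t = t' := by
  have key : ∀ {t t' : ℝ}, posSquash t = posSquash t' → max t 0 = max t' 0 := by
    intro t t' h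
    have h := Subtype.ext_iff.1 h
    simp only [posSquash] at h
    rw [div_eq_div_iff (by positivity) (by positivity)] at h
    linarith
  rw [← max_zero_sub_max_neg_zero_eq_self t, ← max_zero_sub_max_neg_zero_eq_self t', key hpos,
    key hneg]

/-- A compact Hausdorff space of points in `ℝ^Γ` whose supports meet only finitely many members of
a partition of `Γ` into countable blocks is NY compact. -/
theorem isNYCompact_of_countable_blocks {K : Type u} [TopologicalSpace K] [CompactSpace K]
    [T2Space K] {Γ J : Type u} {e : K → Γ → ℝ} (he : Continuous e) (hinj : Function.Injective e)
    (b : Γ → J) (hb : ∀ j, (b ⁻¹' {j}).Countable)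
    (hfin : ∀ x, (b '' {γ | e x γ ≠ 0}).Finite) : IsNYCompact K := by
  have hv : ∀ j : range b, ∃ v : ℕ → Γ, b ⁻¹' {j.1} = range v := fun j =>
    (hb j).exists_eq_range (by obtain ⟨_, γ, rfl⟩ := j; exact ⟨γ, rfl⟩)
  choose v hv using hv
  have hvb : ∀ j n, b (v j n) = j := fun j n => by
    have : v j n ∈ b ⁻¹' {j.1} := hv j ▸ mem_range_self n
    exact this
  let σ : ℕ ≃ Bool × ℕ := Equiv.boolProdNatEquivNat.symm
  let g : K → range b → ℕ → Icc (0 : ℝ) 1 := fun x j n =>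
    posSquash (bif (σ n).1 then e x (v j (σ n).2) else -e x (v j (σ n).2))
  refine ⟨inferInstance, inferInstance, range b, g, ?_, fun x => ?_⟩
  · have hg : Continuous g := by
      refine continuous_pi fun j => continuous_pi fun n => continuous_posSquash.comp ?_
      cases (σ n).1
      · exact ((continuous_apply _).comp he).neg
      · exact (continuous_apply _).comp he
    refine (hg.isClosedEmbedding fun x x' h => hinj (funext fun γ => ?_)).isEmbedding
    obtain ⟨n, hn⟩ : γ ∈ range (v ⟨b γ, mem_range_self γ⟩) := hv ⟨b γ, mem_range_self γ⟩ ▸ rfl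
    have hσ : ∀ c, g x ⟨b γ, mem_range_self γ⟩ (σ.symm (c, n)) =
      g x' ⟨b γ, mem_range_self γ⟩ (σ.symm (c, n)) := fun c => by rw [h]
    simp only [g, Equiv.apply_symm_apply, hn] at hσ
    exact eq_of_posSquash_eq (hσ true) (hσ false)
  · refine ((hfin x).preimage Subtype.val_injective.injOn).subset fun j hj => ?_
    by_contra hcon
    refine hj (funext fun n => ?_)
    have hz : e x (v j (σ n).2) = 0 := by
      by_contra hne
      exact hcon ⟨_, hne, hvb j _⟩
    simp only [g, hz, neg_zero, Bool.cond_self, posSquash_zero]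
    rfl

/-- Let `K` be Eberlein compact and `L` NY compact. If there exists a linear map
`T : C_p(K) → C_p(L)` which is a homeomorphism onto its image, then `K` is NY compact
as well. -/
theorem stmt12 (K L : Type u) [TopologicalSpace K] [TopologicalSpace L]
    (hK : IsEberleinCompact K) (hL : IsNYCompact L)
    (T : Cp K →ₗ[ℝ] Cp L) (hTemb : Topology.IsEmbedding T) :
    IsNYCompact K := by
  obtain ⟨_, _, Γ, e, he, hc₀⟩ := hK
  have hcount : ∀ x, {γ | e x γ ≠ 0}.Countable := by
    intro x
    refine (countable_iUnion fun n : ℕ =>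
      (hc₀ x (1 / ((n : ℝ) + 1)) (by positivity)).countable).mono fun γ hγ => ?_
    obtain ⟨n, hn⟩ := exists_nat_one_div_lt (abs_pos.2 hγ)
    exact mem_iUnion.2 ⟨n, hn.le⟩
  obtain ⟨ρ, hρ, hρcount⟩ := exists_rank (P := fun S : Set K => {γ | ∃ x ∈ S, e x γ ≠ 0}.Countable)
    fun F hF hne => exists_relOpen_countable_support hL he.continuous hcount T hTemb hF hne
  obtain ⟨J, b, hb, hfin⟩ := exists_blocks_of_rank he.continuous hρ hρcount
  exact isNYCompact_of_countable_blocks he.continuous he.injective b hb hfin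
end
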